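/- arXiv:1504.06143 — 2 statements merged into one kernel-verified Lean document; each statement's English description precedes it below -/
import Mathlib

section
/- Quantum reverse hypercontractivity for the depolarizing channel: Let n ≥ 1, let f ∈ M_{2^n} be a positive semidefinite complex 2^n × 2^n matrix, and let p, q be real numbers with −∞ < q ≤ p ≤ 1, p ≠ 0, q ≠ 0 (and if p < 0, assume f is positive definite). Then for every γ with 0 ≤ γ ≤ √((1−p)/(1−q)), one has ‖D_γ^{⊗n}(f)‖_q ≥ ‖f‖_p. -/
open Matrix
open scoped ComplexOrder

noncomputable section

/-- Apply a real function to a Hermitian matrix via the functional calculus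
(junk value `0` on non-Hermitian matrices). -/
def hermFC {ι : Type*} [Fintype ι] [DecidableEq ι] (φ : ℝ → ℝ)
    (f : Matrix ι ι ℂ) : Matrix ι ι ℂ :=
  if hf : f.IsHermitian then
    (hf.eigenvectorUnitary : Matrix ι ι ℂ) *
      Matrix.diagonal (fun i => (φ (hf.eigenvalues i) : ℂ)) *
      (star hf.eigenvectorUnitary : Matrix ι ι ℂ)
  else 0

/-- Real matrix powers of a Hermitian matrix, via the functional calculus on eigenvalues. -/
def mpow {ι : Type*} [Fintype ι] [DecidableEq ι] (f : Matrix ι ι ℂ) (a : ℝ) :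
    Matrix ι ι ℂ :=
  hermFC (fun x => x ^ a) f

/-- The normalized trace `τ(f) = Tr f / d` (real part). -/
def ntrace {ι : Type*} [Fintype ι] [DecidableEq ι] (f : Matrix ι ι ℂ) : ℝ :=
  (f.trace).re / (Fintype.card ι)

/-- Normalized Schatten p-'norm': `‖f‖_p = ((1/d) Tr |f|^p)^(1/p)` with `|f| = √(f† f)`. -/
def snorm {ι : Type*} [Fintype ι] [DecidableEq ι] (p : ℝ) (f : Matrix ι ι ℂ) : ℝ :=
  (ntrace (mpow (fᴴ * f) (p / 2))) ^ (1 / p)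

/-- The entropy `Ent(f) = τ(f ln f) − τ(f) ln τ(f)`. -/
def mEnt {ι : Type*} [Fintype ι] [DecidableEq ι] (f : Matrix ι ι ℂ) : ℝ :=
  ntrace (hermFC (fun x => x * Real.log x) f) - ntrace f * Real.log (ntrace f)

/-- The Dirichlet form `E_L(f,g) = τ(f L(g))`. -/
def dirichlet {ι : Type*} [Fintype ι] [DecidableEq ι]
    (L : Matrix ι ι ℂ → Matrix ι ι ℂ) (f g : Matrix ι ι ℂ) : ℝ :=
  ntrace (f * L g)

/-- Complete positivity: every matrix extension `id_m ⊗ T` maps PSD matrices to PSD matrices. -/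
def IsCompletelyPositive {ι : Type*} [Fintype ι] [DecidableEq ι]
    (T : Matrix ι ι ℂ → Matrix ι ι ℂ) : Prop :=
  ∀ (m : ℕ) (M : Matrix (Fin m × ι) (Fin m × ι) ℂ), M.PosSemidef →
    (Matrix.of fun p q : Fin m × ι =>
      T (Matrix.of fun i j : ι => M (p.1, i) (q.1, j)) p.2 q.2).PosSemidef

/-- A quantum channel: a linear, completely positive, trace-preserving map. -/
def IsQChannel {ι : Type*} [Fintype ι] [DecidableEq ι]
    (T : Matrix ι ι ℂ → Matrix ι ι ℂ) : Prop :=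
  IsLinearMap ℂ T ∧ IsCompletelyPositive T ∧ ∀ f, (T f).trace = f.trace

/-- Reversibility (detailed balance w.r.t. the trace): `τ(f T(g)) = τ(T(f) g)`. -/
def IsReversible {ι : Type*} [Fintype ι] [DecidableEq ι]
    (T : Matrix ι ι ℂ → Matrix ι ι ℂ) : Prop :=
  ∀ f g : Matrix ι ι ℂ, (f * T g).trace = (T f * g).trace

/-- Primitivity: iterates of `T` converge on every density matrix to a fixed
full-rank state independent of the input. -/
def IsPrimitive {ι : Type*} [Fintype ι] [DecidableEq ι]
    (T : Matrix ι ι ℂ → Matrix ι ι ℂ) : Prop :=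
  ∃ σ : Matrix ι ι ℂ, σ.PosDef ∧ σ.trace = 1 ∧
    ∀ ρ : Matrix ι ι ℂ, ρ.PosSemidef → ρ.trace = 1 →
      Filter.Tendsto (fun k => T^[k] ρ) Filter.atTop (nhds σ)

/-- The depolarizing channel with parameter `γ` applied to the `k`-th qubit of `n` qubits:
`D_γ(f) = γ f + (1−γ) (tr_k f) ⊗_k (I/2)`. -/
def depolAt {n : ℕ} (γ : ℝ) (k : Fin n)
    (f : Matrix (Fin n → Fin 2) (Fin n → Fin 2) ℂ) :
    Matrix (Fin n → Fin 2) (Fin n → Fin 2) ℂ :=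
  Matrix.of fun x y =>
    (γ : ℂ) * f x y +
      ((1 - γ : ℝ) : ℂ) *
        (if x k = y k then
          (1 / 2) * ∑ b : Fin 2, f (Function.update x k b) (Function.update y k b)
        else 0)

/-- The tensor power `D_γ^{⊗n}` of the qubit depolarizing channel, acting on `n` qubits. -/
def depolChannel {n : ℕ} (γ : ℝ)
    (f : Matrix (Fin n → Fin 2) (Fin n → Fin 2) ℂ) :
    Matrix (Fin n → Fin 2) (Fin n → Fin 2) ℂ :=
  (List.finRange n).foldl (fun g k => depolAt γ k g) f

/-- The semigroup element `e^{−tL}` applied to `f`, defined by its power series. -/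
def opExp {ι : Type*} [Fintype ι] [DecidableEq ι]
    (L : Matrix ι ι ℂ → Matrix ι ι ℂ) (t : ℝ) (f : Matrix ι ι ℂ) : Matrix ι ι ℂ :=
  ∑' k : ℕ, (((-t) ^ k / (Nat.factorial k) : ℝ) : ℂ) • L^[k] f

/-- The classical noise operator `T_γ` on functions on the boolean cube:
each bit is flipped independently with probability `(1−γ)/2`. -/
def noiseOp {n : ℕ} (γ : ℝ) (f : (Fin n → Fin 2) → ℝ) : (Fin n → Fin 2) → ℝ :=
  fun x => ∑ y : Fin n → Fin 2,
    (∏ i : Fin n, if y i = x i then (1 + γ) / 2 else (1 - γ) / 2) * f y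

/-- The normalized `ℓ_p` 'norm' `‖f‖_p = (2^{-n} Σ_x |f(x)|^p)^{1/p}` on the boolean cube. -/
def lpnorm {n : ℕ} (p : ℝ) (f : (Fin n → Fin 2) → ℝ) : ℝ :=
  ((∑ x : Fin n → Fin 2, |f x| ^ p) / 2 ^ n) ^ (1 / p)

end

section Spectral

variable {ι : Type*} [Fintype ι] [DecidableEq ι]

/-- The matrix with eigenvector matrix `U` and eigenvalues `a`. -/
def specMat (U : Matrix ι ι ℂ) (a : ι → ℝ) : Matrix ι ι ℂ :=
  U * Matrix.diagonal (fun i => (a i : ℂ)) * Uᴴ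

theorem specMat_isHermitian (U : Matrix ι ι ℂ) (a : ι → ℝ) : (specMat U a).IsHermitian := by
  unfold specMat
  apply isHermitian_mul_mul_conjTranspose
  apply isHermitian_diagonal_of_self_adjoint
  ext i
  simp

theorem specMat_mul {U : Matrix ι ι ℂ} (hU : Uᴴ * U = 1) (a b : ι → ℝ) :
    specMat U a * specMat U b = specMat U (fun i => a i * b i) := by
  unfold specMat
  calc _ = U * Matrix.diagonal (fun i => (a i : ℂ)) * (Uᴴ * U) *
        Matrix.diagonal (fun i => (b i : ℂ)) * Uᴴ := by simp only [Matrix.mul_assoc]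
    _ = _ := by
      rw [hU, Matrix.mul_one, Matrix.mul_assoc U, Matrix.diagonal_mul_diagonal]
      simp

theorem specMat_add (U : Matrix ι ι ℂ) (a b : ι → ℝ) :
    specMat U a + specMat U b = specMat U (fun i => a i + b i) := by
  unfold specMat
  rw [← Matrix.add_mul, ← Matrix.mul_add, Matrix.diagonal_add]
  simp

theorem specMat_const {U : Matrix ι ι ℂ} (hU : Uᴴ * U = 1) (c : ℝ) :
    specMat U (fun _ => c) = (c : ℂ) • (1 : Matrix ι ι ℂ) := by
  unfold specMat
  rw [← Matrix.smul_one_eq_diagonal, Matrix.mul_smul, Matrix.mul_one, Matrix.smul_mul,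
    mul_eq_one_comm.1 hU]

theorem specMat_posSemidef (U : Matrix ι ι ℂ) {a : ι → ℝ} (ha : ∀ i, 0 ≤ a i) :
    (specMat U a).PosSemidef := by
  unfold specMat
  apply PosSemidef.mul_mul_conjTranspose_same
  rw [posSemidef_diagonal_iff]
  intro i
  exact_mod_cast ha i

theorem conj_specMat {U : Matrix ι ι ℂ} (hU : Uᴴ * U = 1) (a : ι → ℝ) :
    Uᴴ * specMat U a * U = Matrix.diagonal (fun i => (a i : ℂ)) := by
  unfold specMat
  calc _ = (Uᴴ * U) * Matrix.diagonal (fun i => (a i : ℂ)) * (Uᴴ * U) := by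
        simp only [Matrix.mul_assoc]
    _ = _ := by rw [hU, Matrix.one_mul, Matrix.mul_one]

theorem specMat_posSemidef_iff {U : Matrix ι ι ℂ} (hU : Uᴴ * U = 1) {a : ι → ℝ} :
    (specMat U a).PosSemidef ↔ ∀ i, 0 ≤ a i := by
  refine ⟨fun h => ?_, specMat_posSemidef U⟩
  have h2 := h.conjTranspose_mul_mul_same U
  rw [conj_specMat hU, posSemidef_diagonal_iff] at h2
  intro i
  exact_mod_cast h2 i

theorem exists_specMat {A : Matrix ι ι ℂ} (hA : A.IsHermitian) :
    ∃ (U : Matrix ι ι ℂ) (a : ι → ℝ), Uᴴ * U = 1 ∧ A = specMat U a := by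
  refine ⟨hA.eigenvectorUnitary, hA.eigenvalues, ?_, ?_⟩
  · exact Unitary.coe_star_mul_self hA.eigenvectorUnitary
  · conv_lhs => rw [hA.spectral_theorem, Unitary.conjStarAlgAut_apply]
    rfl

theorem exists_specMat_nonneg {A : Matrix ι ι ℂ} (hA : A.PosSemidef) :
    ∃ (U : Matrix ι ι ℂ) (a : ι → ℝ), Uᴴ * U = 1 ∧ A = specMat U a ∧ ∀ i, 0 ≤ a i := by
  obtain ⟨U, a, hU, rfl⟩ := exists_specMat hA.1
  exact ⟨U, a, hU, rfl, (specMat_posSemidef_iff hU).1 hA⟩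

theorem trace_specMat {U : Matrix ι ι ℂ} (hU : Uᴴ * U = 1) (a : ι → ℝ) :
    (specMat U a).trace = ((∑ i, a i : ℝ) : ℂ) := by
  unfold specMat
  rw [Matrix.trace_mul_comm, ← Matrix.mul_assoc, hU, Matrix.one_mul, Matrix.trace_diagonal]
  simp

/-- The overlaps `|⟨u_i, v_j⟩|²` of the columns of two matrices. -/
def overlap {κ : Type*} [Fintype κ] (U V : Matrix κ κ ℂ) (i j : κ) : ℝ := Complex.normSq ((Uᴴ * V) i j)

theorem overlap_nonneg {κ : Type*} [Fintype κ] (U V : Matrix κ κ ℂ) (i j : κ) : 0 ≤ overlap U V i j :=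
  Complex.normSq_nonneg _

theorem sum_normSq_row {κ : Type*} [Fintype κ] (A : Matrix κ κ ℂ) (i : κ) :
    ((A * Aᴴ) i i) = ((∑ j, Complex.normSq (A i j) : ℝ) : ℂ) := by
  simp [Matrix.mul_apply, Complex.mul_conj]

theorem sum_normSq_col {κ : Type*} [Fintype κ] (A : Matrix κ κ ℂ) (j : κ) :
    ((Aᴴ * A) j j) = ((∑ i, Complex.normSq (A i j) : ℝ) : ℂ) := by
  simp [Matrix.mul_apply, Complex.normSq_eq_conj_mul_self]

theorem conjTranspose_mul_isometry {U V : Matrix ι ι ℂ} (hU : Uᴴ * U = 1) (hV : Vᴴ * V = 1) :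
    (Uᴴ * V)ᴴ * (Uᴴ * V) = 1 := by
  rw [conjTranspose_mul, conjTranspose_conjTranspose, Matrix.mul_assoc, ← Matrix.mul_assoc U,
    mul_eq_one_comm.1 hU, Matrix.one_mul, hV]

theorem sum_overlap_left {U V : Matrix ι ι ℂ} (hU : Uᴴ * U = 1) (hV : Vᴴ * V = 1) (j : ι) :
    ∑ i, overlap U V i j = 1 := by
  have h := sum_normSq_col (Uᴴ * V) j
  rw [conjTranspose_mul_isometry hU hV, Matrix.one_apply_eq] at h
  exact_mod_cast h.symm

theorem sum_overlap_right {U V : Matrix ι ι ℂ} (hU : Uᴴ * U = 1) (hV : Vᴴ * V = 1) (i : ι) :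
    ∑ j, overlap U V i j = 1 := by
  have h := sum_normSq_row (Uᴴ * V) i
  rw [mul_eq_one_comm.1 (conjTranspose_mul_isometry hU hV), Matrix.one_apply_eq] at h
  exact_mod_cast h.symm

theorem trace_specMat_mul (U V : Matrix ι ι ℂ) (a b : ι → ℝ) :
    (specMat U a * specMat V b).trace = ((∑ i, ∑ j, overlap U V i j * (a i * b j) : ℝ) : ℂ) := by
  have h : (specMat U a * specMat V b).trace =
      (Matrix.diagonal (fun i => (a i : ℂ)) * ((Uᴴ * V) *
        (Matrix.diagonal (fun i => (b i : ℂ)) * (Uᴴ * V)ᴴ))).trace := by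
    unfold specMat
    rw [conjTranspose_mul, conjTranspose_conjTranspose]
    simp only [Matrix.mul_assoc]
    rw [Matrix.trace_mul_comm]
    simp only [Matrix.mul_assoc]
  rw [h]
  simp only [Matrix.trace, Matrix.diag_apply, Matrix.diagonal_mul, overlap]
  push_cast
  refine Finset.sum_congr rfl fun i _ => ?_
  rw [Matrix.mul_apply, Finset.mul_sum]
  refine Finset.sum_congr rfl fun j _ => ?_
  rw [Matrix.diagonal_mul, conjTranspose_apply, Complex.star_def, ← Complex.mul_conj]
  ring

theorem charpoly_specMat {U : Matrix ι ι ℂ} (hU : Uᴴ * U = 1) (a : ι → ℝ) :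
    (specMat U a).charpoly.roots = Multiset.map (fun i => (a i : ℂ)) Finset.univ.val := by
  unfold specMat
  rw [Matrix.mul_assoc, Matrix.charpoly_mul_comm, Matrix.mul_assoc, hU, Matrix.mul_one,
    Matrix.charpoly_diagonal, Polynomial.roots_prod]
  · simp
  · simp [Finset.prod_ne_zero_iff, Polynomial.X_sub_C_ne_zero]

theorem sum_eq_of_charpoly_eq {U V : Matrix ι ι ℂ} (hU : Uᴴ * U = 1) (hV : Vᴴ * V = 1)
    {a b : ι → ℝ} (h : (specMat U a).charpoly = (specMat V b).charpoly) (φ : ℝ → ℝ) :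
    ∑ i, φ (a i) = ∑ i, φ (b i) := by
  have h1 := charpoly_specMat hU a
  rw [h, charpoly_specMat hV b] at h1
  have h2 := congrArg (fun s => (Multiset.map (fun z : ℂ => φ z.re) s).sum) h1
  simpa [Multiset.map_map, Function.comp_def] using h2.symm

theorem trace_hermFC {U : Matrix ι ι ℂ} (hU : Uᴴ * U = 1) (a : ι → ℝ) (φ : ℝ → ℝ) :
    ((hermFC φ (specMat U a)).trace).re = ∑ i, φ (a i) := by
  have hf := specMat_isHermitian U a
  have hW : ((hf.eigenvectorUnitary : Matrix ι ι ℂ))ᴴ * hf.eigenvectorUnitary = 1 :=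
    Unitary.coe_star_mul_self hf.eigenvectorUnitary
  have hs : specMat U a = specMat hf.eigenvectorUnitary hf.eigenvalues := by
    conv_lhs => rw [hf.spectral_theorem, Unitary.conjStarAlgAut_apply]
    rfl
  have h1 : hermFC φ (specMat U a) =
      specMat hf.eigenvectorUnitary (fun i => φ (hf.eigenvalues i)) := by
    unfold hermFC
    rw [dif_pos hf]
    rfl
  rw [h1, trace_specMat hW, Complex.ofReal_re]
  exact (sum_eq_of_charpoly_eq hU hW (congrArg charpoly hs) φ).symm

theorem snorm_specMat {U : Matrix ι ι ℂ} (hU : Uᴴ * U = 1) {a : ι → ℝ} (ha : ∀ i, 0 ≤ a i)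
    (p : ℝ) :
    snorm p (specMat U a) = ((∑ i, a i ^ p) / Fintype.card ι) ^ (1 / p) := by
  unfold snorm ntrace mpow
  rw [(specMat_isHermitian U a).eq, specMat_mul hU, trace_hermFC hU]
  congr 2
  refine Finset.sum_congr rfl fun i _ => ?_
  rw [← sq, ← Real.rpow_natCast, ← Real.rpow_mul (ha i)]
  congr 1
  push_cast
  ring

end Spectral

theorem two_mul_sq_mul_log_le {x : ℝ} (hx : 0 < x) :
    2 * x ^ 2 * Real.log x - 2 * (x - 1) ≤ (x - 1) ^ 2 * (3 + Real.log ((x ^ 2 + 2) / 3)) := by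
  set G : ℝ → ℝ := fun t =>
    ((t - 1) ^ 2 * (3 + Real.log ((t ^ 2 + 2) / 3)) + 2 * (t - 1)) / t ^ 2 - 2 * Real.log t with hG
  set K : ℝ → ℝ := fun t => Real.log ((t ^ 2 + 2) / 3) + 2 * (1 - t) / (t ^ 2 + 2) with hK
  have hKnn : ∀ t, 0 ≤ K t := by
    intro t
    have h2 : 0 < t ^ 2 + 2 := by positivity
    have h1 := Real.one_sub_inv_le_log_of_pos (x := (t ^ 2 + 2) / 3) (by positivity)
    have h3 : 1 - ((t ^ 2 + 2) / 3)⁻¹ + 2 * (1 - t) / (t ^ 2 + 2) = (t - 1) ^ 2 / (t ^ 2 + 2) := by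
      field_simp
      ring
    have h4 : 0 ≤ (t - 1) ^ 2 / (t ^ 2 + 2) := by positivity
    simp only [hK]
    linarith
  have hder : ∀ t, 0 < t → HasDerivAt G (2 * (t - 1) / t ^ 3 * K t) t := by
    intro t ht
    have h2 : 0 < t ^ 2 + 2 := by positivity
    have hL : HasDerivAt (fun t : ℝ => Real.log ((t ^ 2 + 2) / 3)) (2 * t / (t ^ 2 + 2)) t := by
      have := (((hasDerivAt_pow 2 t).add_const 2).div_const 3).log (by positivity)
      convert this using 1
      field_simp
      norm_num
    have h1 : HasDerivAt (fun t : ℝ => t - 1) 1 t := (hasDerivAt_id t).sub_const 1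
    have := (((((h1.pow 2).mul (hL.const_add 3)).add (h1.const_mul 2)).div
      (hasDerivAt_pow 2 t) (by positivity)).sub ((Real.hasDerivAt_log ht.ne').const_mul 2))
    refine HasDerivAt.congr_deriv (f := G) this ?_
    have h3 : K t = Real.log ((t ^ 2 + 2) / 3) + 2 * (1 - t) / (t ^ 2 + 2) := rfl
    rw [h3]
    simp
    field_simp
    ring
  have hG1 : G 1 = 0 := by simp [hG]
  have hGx : 0 ≤ G x := by
    rcases le_total 1 x with h | h
    · have hm : MonotoneOn G (Set.Ici 1) := by
        apply monotoneOn_of_deriv_nonneg (convex_Ici 1)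
        · intro t ht
          exact (hder t (lt_of_lt_of_le one_pos ht)).continuousAt.continuousWithinAt
        · intro t ht
          rw [interior_Ici] at ht
          exact (hder t (one_pos.trans ht)).differentiableAt.differentiableWithinAt
        · intro t ht
          rw [interior_Ici] at ht
          have ht' : 1 < t := ht
          rw [(hder t (one_pos.trans ht)).deriv]
          have := hKnn t
          have h5 : 0 ≤ 2 * (t - 1) / t ^ 3 := div_nonneg (by linarith) (by positivity)
          positivity
      rw [← hG1]
      exact hm (Set.mem_Ici.2 le_rfl) h h
    · have hm : AntitoneOn G (Set.Ioc 0 1) := by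
        apply antitoneOn_of_deriv_nonpos (convex_Ioc 0 1)
        · intro t ht
          exact (hder t ht.1).continuousAt.continuousWithinAt
        · intro t ht
          rw [interior_Ioc] at ht
          exact (hder t ht.1).differentiableAt.differentiableWithinAt
        · intro t ht
          rw [interior_Ioc] at ht
          rw [(hder t ht.1).deriv]
          have h0 := ht.1
          have h1 := ht.2
          exact mul_nonpos_of_nonpos_of_nonneg
            (div_nonpos_of_nonpos_of_nonneg (by linarith) (by positivity)) (hKnn t)
      rw [← hG1]
      exact hm ⟨hx, h⟩ ⟨one_pos, le_rfl⟩ h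
  have h6 : 0 ≤ x ^ 2 * G x := by positivity
  have h7 : x ^ 2 * G x = (x - 1) ^ 2 * (3 + Real.log ((x ^ 2 + 2) / 3)) + 2 * (x - 1) -
      2 * x ^ 2 * Real.log x := by
    simp only [hG]
    field_simp
  linarith

theorem sq_mul_log_sq_bregman_le {x y : ℝ} (hx : 0 ≤ x) (hy : 0 ≤ y) :
    x ^ 2 * Real.log (x ^ 2) - y ^ 2 * Real.log (y ^ 2) -
        (2 * y * Real.log (y ^ 2) + 2 * y) * (x - y) ≤
      (x - y) ^ 2 * (3 + Real.log ((x ^ 2 + 2 * y ^ 2) / 3)) := by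
  rcases hy.eq_or_lt with rfl | hy
  · rcases hx.eq_or_lt with rfl | hx
    · simp
    have h3 : Real.log 3 ≤ 3 := by
      have := Real.log_le_sub_one_of_pos (x := 3) (by norm_num)
      linarith
    have h : Real.log ((x ^ 2 + 2 * 0 ^ 2) / 3) = Real.log (x ^ 2) - Real.log 3 := by
      rw [← Real.log_div (by positivity) (by norm_num)]
      simp
    rw [h]
    nlinarith [mul_nonneg (sq_nonneg x) (sub_nonneg.2 h3)]
  rcases hx.eq_or_lt with rfl | hx
  · have h3 : -1 ≤ Real.log (2 / 3) := by
      have := Real.one_sub_inv_le_log_of_pos (x := (2 : ℝ) / 3) (by norm_num)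
      norm_num at this
      linarith
    have h : Real.log ((0 ^ 2 + 2 * y ^ 2) / 3) = Real.log (y ^ 2) + Real.log (2 / 3) := by
      rw [← Real.log_mul (by positivity) (by norm_num)]
      congr 1
      ring
    rw [h]
    nlinarith [mul_nonneg (sq_nonneg y) (neg_le_iff_add_nonneg.1 h3)]
  have h := two_mul_sq_mul_log_le (div_pos hx hy)
  have h1 : Real.log (x ^ 2) = 2 * Real.log (x / y) + Real.log (y ^ 2) := by
    rw [Real.log_pow, Real.log_pow, Real.log_div hx.ne' hy.ne']
    push_cast
    ring
  have h2 : Real.log ((x ^ 2 + 2 * y ^ 2) / 3) =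
      Real.log (((x / y) ^ 2 + 2) / 3) + Real.log (y ^ 2) := by
    rw [← Real.log_mul (by positivity) (by positivity)]
    congr 1
    field_simp
  rw [h1, h2]
  have h3 : x = x / y * y := by field_simp
  set z := x / y
  have h4 := mul_le_mul_of_nonneg_left h (sq_nonneg y)
  rw [h3]
  linarith

theorem exp_neg_ge_cubic {u : ℝ} (hu : 0 ≤ u) : 1 - u + u ^ 2 / 2 - u ^ 3 / 6 ≤ Real.exp (-u) := by
  have ha : AntitoneOn (fun t : ℝ => Real.exp t * (1 - t + t ^ 2 / 2 - t ^ 3 / 6)) (Set.Ici 0) := by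
    have hd : ∀ t : ℝ, HasDerivAt (fun t : ℝ => Real.exp t * (1 - t + t ^ 2 / 2 - t ^ 3 / 6))
        (Real.exp t * (- t ^ 3 / 6)) t := by
      intro t
      have h1 : HasDerivAt (fun t : ℝ => 1 - t + t ^ 2 / 2 - t ^ 3 / 6)
          (-1 + t - t ^ 2 / 2) t := by
        have := ((((hasDerivAt_id t).const_sub 1).add ((hasDerivAt_pow 2 t).div_const 2)).sub
          ((hasDerivAt_pow 3 t).div_const 6))
        refine this.congr_deriv ?_
        norm_num
        ring
      refine ((Real.hasDerivAt_exp t).mul h1).congr_deriv ?_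
      ring
    apply antitoneOn_of_deriv_nonpos (convex_Ici 0)
    · exact fun t _ => (hd t).continuousAt.continuousWithinAt
    · exact fun t _ => (hd t).differentiableAt.differentiableWithinAt
    · intro t ht
      rw [interior_Ici] at ht
      have ht' : 0 < t := ht
      rw [(hd t).deriv]
      have : 0 < Real.exp t * (t ^ 3 / 6) := by positivity
      linarith
  have := ha (Set.mem_Ici.2 le_rfl) hu hu
  simp only [Real.exp_zero] at this
  rw [Real.exp_neg, inv_eq_one_div, le_div_iff₀ (Real.exp_pos u)]
  linarith

theorem mul_log_le_of_pos {t c : ℝ} (ht : 0 ≤ t) (hc : 0 < c) :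
    t * Real.log t ≤ t * (t / c - 1 + Real.log c) := by
  rcases ht.eq_or_lt with rfl | ht
  · simp
  apply mul_le_mul_of_nonneg_left _ ht.le
  have := Real.log_le_sub_one_of_pos (div_pos ht hc)
  rw [Real.log_div ht.ne' hc.ne'] at this
  linarith

theorem entropy_split_aux {X Y : ℝ} (hX : 0 ≤ X) (hY : 0 ≤ Y) :
    Y + X * Real.log X + Y * Real.log (X + Y / 3) ≤ (X + Y) * Real.log (X + Y) := by
  rcases hY.eq_or_lt with rfl | hY
  · simp
  set N := X + Y with hN
  have hNpos : 0 < N := by positivity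
  set u := Y / N with hu
  have hu0 : 0 ≤ u := by positivity
  have hu1 : u ≤ 1 := by rw [hu, div_le_one hNpos]; linarith
  have hYu : Y = u * N := by rw [hu]; field_simp
  have hXu : X = (1 - u) * N := by rw [sub_mul, ← hYu]; linarith
  set c := N * Real.exp (-u) with hc
  have hcpos : 0 < c := by positivity
  have hlc : Real.log c = Real.log N - u := by
    rw [hc, Real.log_mul hNpos.ne' (Real.exp_pos _).ne', Real.log_exp]; ring
  have h1 := mul_log_le_of_pos hX hcpos
  have h2 : Real.log (X + Y / 3) ≤ (X + Y / 3) / c - 1 + Real.log c := by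
    have := Real.log_le_sub_one_of_pos (x := (X + Y / 3) / c) (by positivity)
    rw [Real.log_div (by positivity) hcpos.ne'] at this
    linarith
  have h3 := mul_le_mul_of_nonneg_left h2 hY.le
  have h4 : X * X + Y * (X + Y / 3) ≤ N * c := by
    have h5 := exp_neg_ge_cubic hu0
    have h6 : X * X + Y * (X + Y / 3) = N ^ 2 * (1 - u + u ^ 2 / 3) := by
      rw [hYu, hXu]; ring
    rw [h6, hc]
    have h7 : 1 - u + u ^ 2 / 3 ≤ Real.exp (-u) := by
      nlinarith [mul_nonneg (sq_nonneg u) (sub_nonneg.2 hu1)]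
    nlinarith [mul_le_mul_of_nonneg_left h7 (sq_nonneg N)]
  have h8 : X * (X / c) + Y * ((X + Y / 3) / c) ≤ N := by
    rw [show X * (X / c) + Y * ((X + Y / 3) / c) = (X * X + Y * (X + Y / 3)) / c by ring,
      div_le_iff₀ hcpos]
    exact h4
  have h9 : (X + Y) * Real.log c = N * Real.log N - Y := by
    rw [hlc, ← hN, mul_sub, hYu]; ring
  nlinarith

section Convexity

variable {ι : Type*} [Fintype ι] [DecidableEq ι]

theorem normSq_diagonal_conj_row {A B : Matrix ι ι ℂ} (hB : Bᴴ * B = 1) (v : ι → ℝ) (i : ι) :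
    ∑ j, Complex.normSq ((A * diagonal (fun k => (v k : ℂ)) * Bᴴ) i j) =
      ∑ k, Complex.normSq (A i k) * v k ^ 2 := by
  have h := sum_normSq_row (A * diagonal (fun k => (v k : ℂ)) * Bᴴ) i
  have h2 : (A * diagonal (fun k => (v k : ℂ)) * Bᴴ) * (A * diagonal (fun k => (v k : ℂ)) * Bᴴ)ᴴ =
      (A * diagonal (fun k => (v k : ℂ))) * (A * diagonal (fun k => (v k : ℂ)))ᴴ := by
    rw [conjTranspose_mul, conjTranspose_conjTranspose, Matrix.mul_assoc, ← Matrix.mul_assoc Bᴴ,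
      hB, Matrix.one_mul]
  rw [h2, sum_normSq_row] at h
  have h3 : ∀ k, Complex.normSq ((A * diagonal (fun k => (v k : ℂ))) i k) =
      Complex.normSq (A i k) * v k ^ 2 := by
    intro k
    rw [mul_diagonal, Complex.normSq_mul, Complex.normSq_ofReal, pow_two]
  simp only [h3] at h
  exact_mod_cast h.symm

theorem normSq_diagonal_conj_col {A B : Matrix ι ι ℂ} (hA : Aᴴ * A = 1) (v : ι → ℝ) (j : ι) :
    ∑ i, Complex.normSq ((A * diagonal (fun k => (v k : ℂ)) * Bᴴ) i j) =
      ∑ k, Complex.normSq (B j k) * v k ^ 2 := by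
  rw [← normSq_diagonal_conj_row (A := B) hA v j]
  refine Finset.sum_congr rfl fun i _ => ?_
  have h : B * diagonal (fun k => (v k : ℂ)) * Aᴴ = (A * diagonal (fun k => (v k : ℂ)) * Bᴴ)ᴴ := by
    rw [conjTranspose_mul, conjTranspose_mul, conjTranspose_conjTranspose, diagonal_conjTranspose,
      Matrix.mul_assoc]
    congr 3
    ext k
    simp
  rw [h, conjTranspose_apply]
  exact (Complex.normSq_conj _).symm

theorem sum_re_conj_mul_diagonal_conj {A B : Matrix ι ι ℂ} (hA : Aᴴ * A = 1) (hB : Bᴴ * B = 1)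
    (v w : ι → ℝ) :
    ∑ i, ∑ j, (star ((A * diagonal (fun k => (v k : ℂ)) * Bᴴ) i j) *
      (A * diagonal (fun k => (w k : ℂ)) * Bᴴ) i j).re = ∑ k, v k * w k := by
  have h : ((A * diagonal (fun k => (v k : ℂ)) * Bᴴ)ᴴ *
      (A * diagonal (fun k => (w k : ℂ)) * Bᴴ)).trace = ((∑ k, v k * w k : ℝ) : ℂ) := by
    have h1 : (A * diagonal (fun k => (v k : ℂ)) * Bᴴ)ᴴ *
      (A * diagonal (fun k => (w k : ℂ)) * Bᴴ) =
      B * diagonal (fun k => ((v k * w k : ℝ) : ℂ)) * Bᴴ := by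
      rw [conjTranspose_mul, conjTranspose_mul, conjTranspose_conjTranspose,
        diagonal_conjTranspose]
      calc _ = B * (diagonal (star fun k => (v k : ℂ)) * (Aᴴ * A) *
          diagonal (fun k => (w k : ℂ))) * Bᴴ := by simp only [Matrix.mul_assoc]
        _ = _ := by
          rw [hA, Matrix.mul_one, diagonal_mul_diagonal]
          congr 3
          ext k
          simp
    rw [h1]
    exact trace_specMat hB _
  have h2 := congrArg Complex.re h
  rw [Complex.ofReal_re] at h2
  rw [← h2, trace, Complex.re_sum, Finset.sum_comm]
  refine Finset.sum_congr rfl fun j _ => ?_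
  rw [diag_apply, mul_apply, Complex.re_sum]
  rfl

theorem sum_sq_div_le_sum_normSq_div {A B : Matrix ι ι ℂ} (hA : Aᴴ * A = 1) (hB : Bᴴ * B = 1)
    (w α β : ι → ℝ) (hα : ∀ i, 0 ≤ α i) (hβ : ∀ i, 0 ≤ β i) {s : ℝ} (hs : 0 < s) :
    ∑ k, w k ^ 2 / ((∑ i, Complex.normSq (A i k) * α i + ∑ j, Complex.normSq (B j k) * β j) + s) ≤
      ∑ i, ∑ j, Complex.normSq ((A * diagonal (fun k => (w k : ℂ)) * Bᴴ) i j) /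
        (α i + β j + s) := by
  set c : ι → ℝ := fun k =>
    (∑ i, Complex.normSq (A i k) * α i + ∑ j, Complex.normSq (B j k) * β j) + s with hc
  have hcpos : ∀ k, 0 < c k := fun k => by
    have h1 : 0 ≤ ∑ i, Complex.normSq (A i k) * α i :=
      Finset.sum_nonneg fun i _ => mul_nonneg (Complex.normSq_nonneg _) (hα i)
    have h2 : 0 ≤ ∑ j, Complex.normSq (B j k) * β j :=
      Finset.sum_nonneg fun i _ => mul_nonneg (Complex.normSq_nonneg _) (hβ i)
    simp only [hc]
    linarith
  set R := A * diagonal (fun k => (w k : ℂ)) * Bᴴ with hR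
  set ξ := A * diagonal (fun k => ((w k / c k : ℝ) : ℂ)) * Bᴴ with hξ
  have hpt : ∀ i j, 2 * (star (ξ i j) * R i j).re - (α i + β j + s) * Complex.normSq (ξ i j) ≤
      Complex.normSq (R i j) / (α i + β j + s) := by
    intro i j
    have hM : 0 < α i + β j + s := by linarith [hα i, hβ j]
    rw [le_div_iff₀ hM]
    have := Complex.normSq_nonneg (R i j - ((α i + β j + s : ℝ) : ℂ) * ξ i j)
    rw [Complex.normSq_apply] at this ⊢
    rw [Complex.normSq_apply]
    simp at this ⊢
    nlinarith
  have hsum : ∑ i, ∑ j, (2 * (star (ξ i j) * R i j).re -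
      (α i + β j + s) * Complex.normSq (ξ i j)) = ∑ k, w k ^ 2 / c k := by
    have h1 : ∑ i, ∑ j, α i * Complex.normSq (ξ i j) =
        ∑ k, (w k / c k) ^ 2 * ∑ i, Complex.normSq (A i k) * α i := by
      simp only [← Finset.mul_sum, hξ, normSq_diagonal_conj_row hB]
      simp only [Finset.mul_sum]
      rw [Finset.sum_comm]
      exact Finset.sum_congr rfl fun _ _ => Finset.sum_congr rfl fun _ _ => by ring
    have h2 : ∑ i, ∑ j, β j * Complex.normSq (ξ i j) =
        ∑ k, (w k / c k) ^ 2 * ∑ i, Complex.normSq (B i k) * β i := by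
      rw [Finset.sum_comm]
      simp only [← Finset.mul_sum, hξ, normSq_diagonal_conj_col hA]
      simp only [Finset.mul_sum]
      rw [Finset.sum_comm]
      exact Finset.sum_congr rfl fun _ _ => Finset.sum_congr rfl fun _ _ => by ring
    have h3 : ∑ i, ∑ j, s * Complex.normSq (ξ i j) =
        ∑ k, (w k / c k) ^ 2 * s := by
      rw [Finset.sum_comm]
      simp only [← Finset.mul_sum, ← Finset.sum_mul, hξ, normSq_diagonal_conj_col hA]
      rw [Finset.sum_comm, mul_comm]
      congr 1
      refine Finset.sum_congr rfl fun k _ => ?_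
      rw [← Finset.sum_mul]
      have h := sum_normSq_col B k
      rw [hB, one_apply_eq] at h
      have h' : ∑ i, Complex.normSq (B i k) = 1 := by exact_mod_cast h.symm
      rw [h', one_mul]
    have h4 := sum_re_conj_mul_diagonal_conj hA hB (fun k => w k / c k) w
    have h5 : ∑ i, ∑ j, (2 * (star (ξ i j) * R i j).re -
      (α i + β j + s) * Complex.normSq (ξ i j)) =
        2 * ∑ i, ∑ j, (star (ξ i j) * R i j).re - (∑ i, ∑ j, α i * Complex.normSq (ξ i j) +
        ∑ i, ∑ j, β j * Complex.normSq (ξ i j) + ∑ i, ∑ j, s * Complex.normSq (ξ i j)) := by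
      simp only [add_mul, Finset.sum_add_distrib, Finset.sum_sub_distrib, Finset.mul_sum]
    rw [h5, h1, h2, h3, h4, ← Finset.sum_add_distrib, ← Finset.sum_add_distrib, Finset.mul_sum,
      ← Finset.sum_sub_distrib]
    refine Finset.sum_congr rfl fun k _ => ?_
    rw [← mul_add, ← mul_add]
    have hk := (hcpos k).ne'
    change 2 * (w k / c k * w k) - (w k / c k) ^ 2 * c k = w k ^ 2 / c k
    field_simp
    ring
  rw [← hsum]
  exact Finset.sum_le_sum fun i _ => Finset.sum_le_sum fun j _ => hpt i j

theorem sum_mul_log_le_of_resolvent {κ σ : Type*} [Fintype κ] [Fintype σ] {r M : κ → ℝ} {u c : σ → ℝ}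
    (hM : ∀ i, 0 ≤ M i) (hc : ∀ k, 0 ≤ c k) (hru : ∑ i, r i = ∑ k, u k)
    (h : ∀ s : ℝ, 0 < s → ∑ k, u k / (c k + s) ≤ ∑ i, r i / (M i + s)) {s : ℝ} (hs : 0 < s) :
    ∑ i, r i * Real.log (M i + s) ≤ ∑ k, u k * Real.log (c k + s) := by
  set G : ℝ → ℝ := fun s => ∑ k, u k * Real.log (c k + s) - ∑ i, r i * Real.log (M i + s) with hG
  have hder : ∀ s, 0 < s → HasDerivAt G (∑ k, u k / (c k + s) - ∑ i, r i / (M i + s)) s := by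
    intro s hs
    have aux : ∀ (v x : ℝ), 0 ≤ x → HasDerivAt (fun s => v * Real.log (x + s)) (v / (x + s)) s := by
      intro v x hx
      have := (((hasDerivAt_id s).const_add x).log (by simp; positivity)).const_mul v
      refine this.congr_deriv ?_
      simp [div_eq_mul_inv]
    exact (HasDerivAt.fun_sum fun k _ => aux (u k) (c k) (hc k)).sub
      (HasDerivAt.fun_sum fun i _ => aux (r i) (M i) (hM i))
  have hanti : AntitoneOn G (Set.Ioi 0) := by
    apply antitoneOn_of_deriv_nonpos (convex_Ioi 0)
    · exact fun t ht => (hder t ht).continuousAt.continuousWithinAt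
    · rw [interior_Ioi]
      exact fun t ht => (hder t ht).differentiableAt.differentiableWithinAt
    · rw [interior_Ioi]
      intro t ht
      rw [(hder t ht).deriv]
      linarith [h t ht]
  have hlim : Filter.Tendsto G Filter.atTop (nhds 0) := by
    have aux : ∀ (v x : ℝ), Filter.Tendsto (fun s => v * Real.log (x / s + 1)) Filter.atTop (nhds 0) := by
      intro v x
      have h1 : Filter.Tendsto (fun s : ℝ => x / s + 1) Filter.atTop (nhds 1) := by
        simpa using (Filter.Tendsto.div_atTop (tendsto_const_nhds (x := x)) Filter.tendsto_id).add_const 1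
      have h2 := (h1.log one_ne_zero).const_mul v
      simpa using h2
    have h3 : Filter.Tendsto (fun s => ∑ k, u k * Real.log (c k / s + 1) -
        ∑ i, r i * Real.log (M i / s + 1)) Filter.atTop (nhds 0) := by
      have := (tendsto_finsetSum Finset.univ fun k _ => aux (u k) (c k)).sub
        (tendsto_finsetSum Finset.univ fun k _ => aux (r k) (M k))
      simpa using this
    refine h3.congr' ?_
    filter_upwards [Filter.eventually_gt_atTop 0] with s hs
    have aux2 : ∀ (v x : ℝ), 0 ≤ x → v * Real.log (x / s + 1) =
        v * Real.log (x + s) - v * Real.log s := by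
      intro v x hx
      rw [← mul_sub, ← Real.log_div (by positivity) hs.ne', add_div, div_self hs.ne']
    simp only [hG]
    rw [Finset.sum_congr rfl fun k _ => aux2 (u k) (c k) (hc k),
      Finset.sum_congr rfl fun k _ => aux2 (r k) (M k) (hM k), Finset.sum_sub_distrib,
      Finset.sum_sub_distrib, ← Finset.sum_mul, ← Finset.sum_mul, hru]
    ring
  have : 0 ≤ G s := by
    refine le_of_tendsto' (hlim.comp (Filter.tendsto_atTop_add_const_left _ s Filter.tendsto_abs_atTop_atTop)) ?_
    intro t
    exact sub_nonneg.1 (by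
      have := hanti (Set.mem_Ioi.2 hs) (Set.mem_Ioi.2 (by positivity : 0 < s + |t|)) (by simp)
      simpa using this)
  simp only [hG] at this
  linarith

theorem gibbs_sum_le {κ : Type*} [Fintype κ] {u c : κ → ℝ} (hu : ∀ k, 0 ≤ u k) (hc : ∀ k, 0 < c k)
    (hY : 0 < ∑ k, u k) :
    ∑ k, u k * Real.log (c k) ≤ ∑ k, u k * Real.log (u k) +
      (∑ k, u k) * Real.log ((∑ k, c k) / ∑ k, u k) := by
  set Y := ∑ k, u k with hYd
  set P := ∑ k, c k with hPd
  have hne : (Finset.univ : Finset κ).Nonempty := by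
    by_contra h
    rw [Finset.not_nonempty_iff_eq_empty] at h
    simp [hYd, h] at hY
  have hP : 0 < P := Finset.sum_pos (fun k _ => hc k) hne
  have hpt : ∀ k, u k * Real.log (c k) ≤ u k * Real.log (u k) + u k * Real.log (P / Y) +
      (c k * (Y / P) - u k) := by
    intro k
    rcases (hu k).eq_or_lt with h | h
    · rw [← h]
      have := hc k
      have : 0 ≤ c k * (Y / P) := by positivity
      simpa using this
    · have h1 := Real.log_le_sub_one_of_pos (x := c k * (Y / P) / u k)
        (by have := hc k; positivity)
      have h2 : Real.log (c k * (Y / P) / u k) = Real.log (c k) - Real.log (P / Y) - Real.log (u k) := by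
        have := (hc k).ne'
        rw [Real.log_div (by positivity) h.ne', Real.log_mul this (by positivity),
          Real.log_div hP.ne' hY.ne', Real.log_div hY.ne' hP.ne']
        ring
      rw [h2] at h1
      have h3 := mul_le_mul_of_nonneg_left h1 h.le
      have h4 : u k * (c k * (Y / P) / u k - 1) = c k * (Y / P) - u k := by field_simp
      linarith
  refine (Finset.sum_le_sum fun k _ => hpt k).trans_eq ?_
  rw [Finset.sum_add_distrib, Finset.sum_add_distrib, ← Finset.sum_mul, Finset.sum_sub_distrib,
    ← Finset.sum_mul, ← hYd, ← hPd]
  field_simp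
  ring

end Convexity

/-- The entropy `∑ b ln b - (∑ b) ln (mean b)`. -/
noncomputable def sumEnt {κ : Type*} [Fintype κ] (b : κ → ℝ) : ℝ :=
  ∑ i, b i * Real.log (b i) - (∑ i, b i) * Real.log ((∑ i, b i) / Fintype.card κ)

section Convexity

variable {ι : Type*} [Fintype ι] [DecidableEq ι]

theorem sumEnt_eq {κ : Type*} [Fintype κ] [Nonempty κ] (b : κ → ℝ) :
    sumEnt b = ∑ i, b i * Real.log (b i) - (∑ i, b i) * Real.log (∑ i, b i) +
      (∑ i, b i) * Real.log (Fintype.card κ) := by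
  unfold sumEnt
  by_cases h : ∑ i, b i = 0
  · simp [h]
  · rw [Real.log_div h (by simp)]
    ring

theorem sum_normSq_eq_of_add {U V W : Matrix ι ι ℂ} (hU : Uᴴ * U = 1) (hV : Vᴴ * V = 1)
    {l m w : ι → ℝ} (h : specMat U l = specMat V m + specMat W w) (i j : ι) :
    Complex.normSq (((Uᴴ * W) * diagonal (fun k => (w k : ℂ)) * (Vᴴ * W)ᴴ) i j) =
      overlap U V i j * (l i - m j) ^ 2 := by
  have h1 : (Uᴴ * W) * diagonal (fun k => (w k : ℂ)) * (Vᴴ * W)ᴴ = Uᴴ * specMat W w * V := by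
    rw [conjTranspose_mul, conjTranspose_conjTranspose]
    unfold specMat
    simp only [Matrix.mul_assoc]
  have h2 : Uᴴ * specMat W w * V =
      diagonal (fun k => (l k : ℂ)) * (Uᴴ * V) - (Uᴴ * V) * diagonal (fun k => (m k : ℂ)) := by
    rw [eq_sub_of_add_eq' h.symm]
    unfold specMat
    rw [Matrix.mul_sub, Matrix.sub_mul]
    congr 1
    · rw [← Matrix.mul_assoc, ← Matrix.mul_assoc, hU, Matrix.one_mul, Matrix.mul_assoc]
    · simp only [Matrix.mul_assoc, hV, Matrix.mul_one]
  have h3 : (Uᴴ * specMat W w * V) i j = (Uᴴ * V) i j * ((l i - m j : ℝ) : ℂ) := by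
    rw [h2, Matrix.sub_apply, diagonal_mul, mul_diagonal]
    push_cast
    ring
  rw [h1, h3, Complex.normSq_mul, Complex.normSq_ofReal, overlap, pow_two]

/-- Entropic uniform convexity inequality for the Schatten norm `‖·‖_2`. -/
theorem sumEnt_sq_le_of_add {U V W : Matrix ι ι ℂ} (hU : Uᴴ * U = 1) (hV : Vᴴ * V = 1)
    (hW : Wᴴ * W = 1) {l m w : ι → ℝ} (hl : ∀ i, 0 ≤ l i) (hm : ∀ i, 0 ≤ m i)
    (h : specMat U l = specMat V m + specMat W w)
    (horth : ∀ ψ : ι → ℝ, (∀ i j, m i = m j → ψ i = ψ j) →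
      (specMat V ψ * specMat W w).trace = 0) :
    sumEnt (fun i => l i ^ 2) ≤
      sumEnt (fun i => m i ^ 2) + sumEnt (fun i => w i ^ 2) + 2 * ∑ i, w i ^ 2 := by
  rcases isEmpty_or_nonempty ι with hι | hι
  · simp [sumEnt]
  have hov := sum_overlap_left hU hV
  have hov' := sum_overlap_right hU hV
  set R := (Uᴴ * W) * diagonal (fun k => (w k : ℂ)) * (Vᴴ * W)ᴴ with hR
  have hA := conjTranspose_mul_isometry hU hW
  have hB := conjTranspose_mul_isometry hV hW
  have hr := sum_normSq_eq_of_add hU hV h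
  have hrow : ∑ i, ∑ j, Complex.normSq (R i j) = ∑ k, w k ^ 2 := by
    simp only [hR, normSq_diagonal_conj_row hB]
    rw [Finset.sum_comm]
    simp only [← Finset.sum_mul]
    refine Finset.sum_congr rfl fun k _ => ?_
    have := sum_overlap_left hU hW k
    unfold overlap at this
    rw [this, one_mul]
  set X := ∑ i, m i ^ 2 with hX
  set Y := ∑ i, w i ^ 2 with hY
  have hX0 : 0 ≤ X := Finset.sum_nonneg fun i _ => sq_nonneg _
  have hY0 : 0 ≤ Y := Finset.sum_nonneg fun i _ => sq_nonneg _
  have key : ∀ ψ : ι → ℝ, (∀ i j, m i = m j → ψ i = ψ j) →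
      ∑ i, ∑ j, overlap U V i j * (ψ j * (l i - m j)) = 0 := by
    intro ψ hψ
    have h1 := horth ψ hψ
    rw [eq_sub_of_add_eq' h.symm, Matrix.mul_sub, trace_sub, trace_mul_comm, trace_specMat_mul,
      specMat_mul hV, trace_specMat hV] at h1
    have h2 : ∑ i, ∑ j, overlap U V i j * (l i * ψ j) - ∑ j, ψ j * m j = 0 := by
      exact_mod_cast h1
    rw [← h2]
    have h3 : ∑ j, ψ j * m j = ∑ i, ∑ j, overlap U V i j * (ψ j * m j) := by
      rw [Finset.sum_comm]
      simp only [← Finset.sum_mul, hov, one_mul]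
    rw [h3, ← Finset.sum_sub_distrib]
    refine Finset.sum_congr rfl fun i _ => ?_
    rw [← Finset.sum_sub_distrib]
    exact Finset.sum_congr rfl fun j _ => by ring
  have hsplit : ∀ φ χ : ℝ → ℝ, ∑ i, ∑ j, overlap U V i j * (φ (l i) - χ (m j)) =
      ∑ i, φ (l i) - ∑ j, χ (m j) := by
    intro φ χ
    simp only [mul_sub, Finset.sum_sub_distrib]
    congr 1
    · simp only [← Finset.sum_mul, hov', one_mul]
    · rw [Finset.sum_comm]
      simp only [← Finset.sum_mul, hov, one_mul]
  have hN : ∑ i, l i ^ 2 = X + Y := by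
    have h1 := hsplit (fun x => x ^ 2) (fun x => x ^ 2)
    have h2 := key m (fun i j h => h)
    have h3 : ∑ i, ∑ j, overlap U V i j * (l i ^ 2 - m j ^ 2) =
        ∑ i, ∑ j, Complex.normSq (R i j) + 2 * ∑ i, ∑ j, overlap U V i j * (m j * (l i - m j)) := by
      simp only [Finset.mul_sum, ← Finset.sum_add_distrib]
      refine Finset.sum_congr rfl fun i _ => Finset.sum_congr rfl fun j _ => ?_
      rw [hR, hr]
      ring
    rw [h3, h2, hrow] at h1
    linarith
  set L1 := ∑ i, l i ^ 2 * Real.log (l i ^ 2) with hL1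
  set L2 := ∑ i, m i ^ 2 * Real.log (m i ^ 2) with hL2
  set L3 := ∑ i, w i ^ 2 * Real.log (w i ^ 2) with hL3
  have hstep : L1 - L2 ≤ 3 * Y +
      ∑ i, ∑ j, Complex.normSq (R i j) * Real.log ((l i ^ 2 + 2 * m j ^ 2) / 3) := by
    have h1 := hsplit (fun x => x ^ 2 * Real.log (x ^ 2)) (fun x => x ^ 2 * Real.log (x ^ 2))
    have h2 := key (fun j => 2 * m j * Real.log (m j ^ 2) + 2 * m j)
      (fun i j h => by simp only [h])
    have h3 : L1 - L2 = ∑ i, ∑ j, overlap U V i j *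
        (l i ^ 2 * Real.log (l i ^ 2) - m j ^ 2 * Real.log (m j ^ 2) -
          (2 * m j * Real.log (m j ^ 2) + 2 * m j) * (l i - m j)) := by
      rw [hL1, hL2, ← h1, ← sub_zero (∑ i, ∑ j, _), ← h2, ← Finset.sum_sub_distrib]
      refine Finset.sum_congr rfl fun i _ => ?_
      rw [← Finset.sum_sub_distrib]
      exact Finset.sum_congr rfl fun j _ => by ring
    rw [h3, ← hrow, Finset.mul_sum, ← Finset.sum_add_distrib]
    refine Finset.sum_le_sum fun i _ => ?_
    rw [Finset.mul_sum, ← Finset.sum_add_distrib]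
    refine Finset.sum_le_sum fun j _ => ?_
    rw [hR, hr]
    have := mul_le_mul_of_nonneg_left (sq_mul_log_sq_bregman_le (hl i) (hm j))
      (overlap_nonneg U V i j)
    linarith
  have hfin : L1 - L2 ≤ 2 * Y + L3 - Y * Real.log Y + (X + Y) * Real.log (X + Y) -
      X * Real.log X := by
    rcases hY0.eq_or_lt with hY1 | hYpos
    · have hw : ∀ k, w k = 0 := by
        intro k
        have := (Finset.sum_eq_zero_iff_of_nonneg (fun i _ => sq_nonneg (w i))).1 hY1.symm k
          (Finset.mem_univ _)
        exact pow_eq_zero_iff (by norm_num) |>.1 this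
      have hRz : ∀ i j, Complex.normSq (R i j) = 0 := by
        intro i j
        have h0 : (fun k => (w k : ℂ)) = 0 := by
          ext k
          simp [hw k]
        rw [hR, h0]
        simp
      have hL3z : L3 = 0 := by
        simp [hL3, hw]
      simp only [hRz, zero_mul, Finset.sum_const_zero] at hstep
      rw [hL3z, ← hY1]
      rw [← hY1] at hstep
      simp only [add_zero]
      linarith
    · have hgs : ∀ s : ℝ, 0 < s →
          ∑ i, ∑ j, Complex.normSq (R i j) * Real.log ((l i ^ 2 + 2 * m j ^ 2) / 3) ≤
          L3 + Y * Real.log ((X + Y / 3 + Fintype.card ι * s) / Y) := by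
        intro s hs
        set c : ι → ℝ := fun k => ∑ i, Complex.normSq ((Uᴴ * W) i k) * (l i ^ 2 / 3) +
          ∑ j, Complex.normSq ((Vᴴ * W) j k) * (2 * m j ^ 2 / 3) with hc
        have hc0 : ∀ k, 0 ≤ c k := fun k => add_nonneg
          (Finset.sum_nonneg fun i _ => mul_nonneg (Complex.normSq_nonneg _) (by positivity))
          (Finset.sum_nonneg fun i _ => mul_nonneg (Complex.normSq_nonneg _) (by positivity))
        have h1 := sum_mul_log_le_of_resolvent
          (r := fun ij : ι × ι => Complex.normSq (R ij.1 ij.2))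
          (M := fun ij : ι × ι => l ij.1 ^ 2 / 3 + 2 * m ij.2 ^ 2 / 3)
          (u := fun k => w k ^ 2) (c := c)
          (fun ij => by positivity) hc0 (by rw [Fintype.sum_prod_type]; exact hrow)
          (fun t ht => by
            have := sum_sq_div_le_sum_normSq_div hA hB w (fun i => l i ^ 2 / 3)
              (fun j => 2 * m j ^ 2 / 3) (fun i => by positivity) (fun j => by positivity) ht
            rw [Fintype.sum_prod_type]
            exact this) hs
        rw [Fintype.sum_prod_type] at h1
        have h2 := gibbs_sum_le (u := fun k => w k ^ 2) (c := fun k => c k + s)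
          (fun k => sq_nonneg _) (fun k => by linarith [hc0 k]) hYpos
        have h3 : ∑ k, (c k + s) = X + Y / 3 + Fintype.card ι * s := by
          have e1 : ∑ k, ∑ i, Complex.normSq ((Uᴴ * W) i k) * (l i ^ 2 / 3) =
              (X + Y) / 3 := by
            rw [Finset.sum_comm, ← hN, Finset.sum_div]
            refine Finset.sum_congr rfl fun i _ => ?_
            rw [← Finset.sum_mul]
            have := sum_overlap_right hU hW i
            unfold overlap at this
            rw [this, one_mul]
          have e2 : ∑ k, ∑ i, Complex.normSq ((Vᴴ * W) i k) * (2 * m i ^ 2 / 3) =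
              2 * X / 3 := by
            rw [Finset.sum_comm, hX, Finset.mul_sum, Finset.sum_div]
            refine Finset.sum_congr rfl fun i _ => ?_
            rw [← Finset.sum_mul]
            have := sum_overlap_right hV hW i
            unfold overlap at this
            rw [this, one_mul]
          simp only [hc, Finset.sum_add_distrib, e1, e2, Finset.sum_const, Finset.card_univ,
            nsmul_eq_mul]
          ring
        rw [h3] at h2
        refine le_trans ?_ (h1.trans h2)
        refine Finset.sum_le_sum fun i _ => Finset.sum_le_sum fun j _ => ?_
        rcases eq_or_ne (l i - m j) 0 with h0 | h0
        · rw [hR, hr, h0]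
          simp
        · refine mul_le_mul_of_nonneg_left ?_ (Complex.normSq_nonneg _)
          have hpos : 0 < l i ^ 2 + 2 * m j ^ 2 := by
            rcases (hl i).eq_or_lt with h4 | h4
            · rcases (hm j).eq_or_lt with h5 | h5
              · exact absurd (by rw [← h4, ← h5, sub_zero]) h0
              · positivity
            · positivity
          refine Real.log_le_log (by positivity) ?_
          simp only
          linarith
      have hlim : Filter.Tendsto (fun s : ℝ => L3 + Y * Real.log ((X + Y / 3 + Fintype.card ι * s) / Y))
          (nhdsWithin 0 (Set.Ioi 0)) (nhds (L3 + Y * Real.log ((X + Y / 3) / Y))) := by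
        have hcont : ContinuousAt (fun s : ℝ => L3 + Y * Real.log ((X + Y / 3 + Fintype.card ι * s) / Y)) 0 := by
          have h0 : (X + Y / 3 + Fintype.card ι * (0 : ℝ)) / Y ≠ 0 := by
            rw [mul_zero, add_zero]
            positivity
          have : ContinuousAt (fun s : ℝ => (X + Y / 3 + Fintype.card ι * s) / Y) 0 := by fun_prop
          exact ((this.log h0).const_mul Y).const_add L3
        have := hcont.tendsto.mono_left (nhdsWithin_le_nhds (s := Set.Ioi 0))
        simpa using this
      have h5 := ge_of_tendsto hlim (eventually_nhdsWithin_of_forall hgs)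
      rw [Real.log_div (by positivity) hYpos.ne'] at h5
      have h6 := entropy_split_aux hX0 hY0
      linarith
  rw [sumEnt_eq, sumEnt_eq, sumEnt_eq, hN, ← hX, ← hY, ← hL1, ← hL2, ← hL3]
  linarith

end Convexity

theorem trace_mul_re_nonneg {ι : Type*} [Fintype ι] [DecidableEq ι] {A B : Matrix ι ι ℂ}
    (hA : A.PosSemidef) (hB : B.PosSemidef) : 0 ≤ (A * B).trace.re := by
  obtain ⟨U, a, -, rfl, ha⟩ := exists_specMat_nonneg hA
  obtain ⟨V, b, -, rfl, hb⟩ := exists_specMat_nonneg hB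
  rw [trace_specMat_mul, Complex.ofReal_re]
  exact Finset.sum_nonneg fun i _ => Finset.sum_nonneg fun j _ =>
    mul_nonneg (overlap_nonneg _ _ _ _) (mul_nonneg (ha i) (hb j))

section Depol

variable {n : ℕ}

/-- The matrix unit `|a⟩⟨b|` acting on the `k`-th qubit. -/
def qubitUnit (k : Fin n) (a b : Fin 2) : Matrix (Fin n → Fin 2) (Fin n → Fin 2) ℂ :=
  Matrix.of fun x u => if x k = a ∧ u = Function.update x k b then 1 else 0

theorem qubitUnit_conjTranspose (k : Fin n) (a b : Fin 2) :
    (qubitUnit k a b)ᴴ = qubitUnit k b a := by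
  ext x u
  have h : (u k = a ∧ x = Function.update u k b) ↔ (x k = b ∧ u = Function.update x k a) := by
    constructor
    · rintro ⟨h1, h2⟩
      subst h2
      simp [← h1]
    · rintro ⟨h1, h2⟩
      subst h2
      simp [← h1]
  simp only [qubitUnit, conjTranspose_apply, of_apply]
  by_cases hc : x k = b ∧ u = Function.update x k a
  · rw [if_pos hc, if_pos (h.2 hc), star_one]
  · rw [if_neg hc, if_neg (fun h' => hc (h.1 h')), star_zero]

theorem qubitUnit_mul_apply (k : Fin n) (a b : Fin 2)
    (X : Matrix (Fin n → Fin 2) (Fin n → Fin 2) ℂ) (x y : Fin n → Fin 2) :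
    (qubitUnit k a b * X) x y = if x k = a then X (Function.update x k b) y else 0 := by
  simp only [qubitUnit, mul_apply, of_apply]
  by_cases h : x k = a
  · simp [h]
  · simp [h]

theorem qubitUnit_conj_apply (k : Fin n) (a b : Fin 2)
    (X : Matrix (Fin n → Fin 2) (Fin n → Fin 2) ℂ) (x y : Fin n → Fin 2) :
    (qubitUnit k a b * X * (qubitUnit k a b)ᴴ) x y =
      if x k = a ∧ y k = a then X (Function.update x k b) (Function.update y k b) else 0 := by
  have h : (qubitUnit k a b * X * (qubitUnit k a b)ᴴ) x y =
      ∑ u, (if x k = a then X (Function.update x k b) u else 0) *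
        star (if y k = a ∧ u = Function.update y k b then (1 : ℂ) else 0) := by
    rw [mul_apply]
    refine Finset.sum_congr rfl fun u _ => ?_
    rw [qubitUnit_mul_apply, conjTranspose_apply]
    rfl
  rw [h]
  by_cases hx : x k = a <;> by_cases hy : y k = a <;> simp [hx, hy]

theorem depolAt_zero_apply (k : Fin n) (X : Matrix (Fin n → Fin 2) (Fin n → Fin 2) ℂ)
    (x y : Fin n → Fin 2) : depolAt 0 k X x y = if x k = y k then
      (1 / 2) * ∑ b : Fin 2, X (Function.update x k b) (Function.update y k b) else 0 := by
  simp [depolAt]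

theorem depolAt_zero_eq_sum (k : Fin n) (X : Matrix (Fin n → Fin 2) (Fin n → Fin 2) ℂ) :
    depolAt 0 k X = (1 / 2 : ℝ) • ∑ a, ∑ b, qubitUnit k a b * X * (qubitUnit k a b)ᴴ := by
  ext x y
  rw [depolAt_zero_apply]
  simp only [Matrix.smul_apply, Matrix.sum_apply, qubitUnit_conj_apply]
  rw [Finset.sum_comm]
  by_cases h : x k = y k
  · rw [if_pos h, h]
    have : ∀ b, (∑ a, if y k = a ∧ y k = a then
        X (Function.update x k b) (Function.update y k b) else 0) =
        X (Function.update x k b) (Function.update y k b) := by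
      intro b
      simp
    simp only [this, Complex.real_smul]
    push_cast
    rfl
  · rw [if_neg h]
    have : ∀ a, ¬ (x k = a ∧ y k = a) := fun a ha => h (ha.1.trans ha.2.symm)
    simp [this]

theorem depolAt_eq (γ : ℝ) (k : Fin n) (X : Matrix (Fin n → Fin 2) (Fin n → Fin 2) ℂ) :
    depolAt γ k X = γ • X + (1 - γ) • depolAt 0 k X := by
  ext x y
  rw [Matrix.add_apply, Matrix.smul_apply, Matrix.smul_apply, depolAt_zero_apply]
  simp only [depolAt, of_apply, Complex.real_smul]

theorem depolAt_zero_conjTranspose (k : Fin n) (X : Matrix (Fin n → Fin 2) (Fin n → Fin 2) ℂ) :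
    depolAt 0 k Xᴴ = (depolAt 0 k X)ᴴ := by
  ext x y
  rw [conjTranspose_apply, depolAt_zero_apply, depolAt_zero_apply]
  by_cases h : x k = y k
  · rw [if_pos h, if_pos h.symm]
    simp [conjTranspose_apply]
  · rw [if_neg h, if_neg (Ne.symm h), star_zero]

theorem depolAt_zero_add (k : Fin n) (X Y : Matrix (Fin n → Fin 2) (Fin n → Fin 2) ℂ) :
    depolAt 0 k (X + Y) = depolAt 0 k X + depolAt 0 k Y := by
  simp only [depolAt_zero_eq_sum, Matrix.mul_add, Matrix.add_mul, Finset.sum_add_distrib, smul_add]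

theorem depolAt_zero_smul (k : Fin n) (c : ℝ) (X : Matrix (Fin n → Fin 2) (Fin n → Fin 2) ℂ) :
    depolAt 0 k (c • X) = c • depolAt 0 k X := by
  simp only [depolAt_zero_eq_sum, Matrix.mul_smul, Matrix.smul_mul, Finset.smul_sum]
  simp only [smul_comm c]

theorem depolAt_zero_one (k : Fin n) : depolAt 0 k (1 : Matrix (Fin n → Fin 2) (Fin n → Fin 2) ℂ) = 1 := by
  ext x y
  rw [depolAt_zero_apply]
  by_cases h : x = y
  · subst h
    simp
  · rw [one_apply_ne h]
    by_cases hk : x k = y k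
    · rw [if_pos hk]
      have : ∀ b, Function.update x k b ≠ Function.update y k b := by
        intro b hb
        apply h
        ext j
        by_cases hj : j = k
        · rw [hj, hk]
        · have := congrFun hb j
          simp only [Function.update_of_ne hj] at this
          rw [this]
      simp [one_apply_ne (this _)]
    · rw [if_neg hk]

theorem trace_mul_depolAt_zero (k : Fin n) (X Y : Matrix (Fin n → Fin 2) (Fin n → Fin 2) ℂ) :
    (X * depolAt 0 k Y).trace = (depolAt 0 k X * Y).trace := by
  rw [depolAt_zero_eq_sum, depolAt_zero_eq_sum, Matrix.mul_smul, Matrix.smul_mul, trace_smul,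
    trace_smul]
  congr 1
  simp only [Matrix.mul_sum, Matrix.sum_mul, trace_sum]
  rw [Finset.sum_comm]
  refine Finset.sum_congr rfl fun b _ => Finset.sum_congr rfl fun a _ => ?_
  rw [qubitUnit_conjTranspose, qubitUnit_conjTranspose]
  calc (X * (qubitUnit k a b * Y * qubitUnit k b a)).trace
      = ((X * (qubitUnit k a b * Y)) * qubitUnit k b a).trace := by simp only [Matrix.mul_assoc]
    _ = (qubitUnit k b a * (X * (qubitUnit k a b * Y))).trace := trace_mul_comm _ _
    _ = _ := by simp only [Matrix.mul_assoc]

theorem depolAt_zero_comm (j k : Fin n) (X : Matrix (Fin n → Fin 2) (Fin n → Fin 2) ℂ) :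
    depolAt 0 j (depolAt 0 k X) = depolAt 0 k (depolAt 0 j X) := by
  by_cases hjk : j = k
  · rw [hjk]
  ext x y
  simp only [depolAt_zero_apply, Function.update_of_ne hjk, Function.update_of_ne (Ne.symm hjk)]
  by_cases h1 : x j = y j <;> by_cases h2 : x k = y k <;>
    simp [h1, h2, Function.update_comm hjk]
  ring

theorem depolAt_zero_idem (k : Fin n) (X : Matrix (Fin n → Fin 2) (Fin n → Fin 2) ℂ) :
    depolAt 0 k (depolAt 0 k X) = depolAt 0 k X := by
  ext x y
  simp only [depolAt_zero_apply]
  by_cases h : x k = y k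
  · simp [h]
  · simp [h]

theorem depolAt_zero_posSemidef (k : Fin n) {X : Matrix (Fin n → Fin 2) (Fin n → Fin 2) ℂ}
    (hX : X.PosSemidef) : (depolAt 0 k X).PosSemidef := by
  rw [depolAt_zero_eq_sum]
  refine PosSemidef.smul (posSemidef_sum _ fun a _ => posSemidef_sum _ fun b _ =>
    hX.mul_mul_conjTranspose_same _) (by norm_num)

theorem fromBlocks_depolAt_zero_posSemidef (k : Fin n)
    {A B C D : Matrix (Fin n → Fin 2) (Fin n → Fin 2) ℂ} (h : (fromBlocks A B C D).PosSemidef) :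
    (fromBlocks (depolAt 0 k A) (depolAt 0 k B) (depolAt 0 k C) (depolAt 0 k D)).PosSemidef := by
  have h1 : fromBlocks (depolAt 0 k A) (depolAt 0 k B) (depolAt 0 k C) (depolAt 0 k D) =
      (1 / 2 : ℝ) • ∑ a, ∑ b, fromBlocks (qubitUnit k a b) 0 0 (qubitUnit k a b) *
        fromBlocks A B C D * (fromBlocks (qubitUnit k a b) 0 0 (qubitUnit k a b))ᴴ := by
    simp only [depolAt_zero_eq_sum, Fin.sum_univ_two, fromBlocks_conjTranspose,
      fromBlocks_multiply, fromBlocks_add, fromBlocks_smul]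
    simp
  rw [h1]
  refine PosSemidef.smul (posSemidef_sum _ fun a _ => posSemidef_sum _ fun b _ =>
    h.mul_mul_conjTranspose_same _) (by norm_num)

end Depol

section Blocks

variable {ι : Type*} [Fintype ι] [DecidableEq ι]

open scoped MatrixOrder Matrix.Norms.L2Operator in
theorem posSemidef_eq_of_mul_self_eq {A B : Matrix ι ι ℂ} (hA : A.PosSemidef) (hB : B.PosSemidef)
    (h : A * A = B * B) : A = B := by
  rw [← CFC.sqrt_unique h hA.nonneg, CFC.sqrt_unique rfl hB.nonneg]

theorem fromBlocks_isometry {U V : Matrix ι ι ℂ} (hU : Uᴴ * U = 1) (hV : Vᴴ * V = 1) :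
    (fromBlocks U 0 0 V)ᴴ * fromBlocks U 0 0 V = 1 := by
  rw [fromBlocks_conjTranspose, fromBlocks_multiply]
  simp [hU, hV]

theorem fromBlocks_specMat (U V : Matrix ι ι ℂ) (a b : ι → ℝ) :
    specMat (fromBlocks U 0 0 V) (Sum.elim a b) = fromBlocks (specMat U a) 0 0 (specMat V b) := by
  have h : diagonal (fun i => ((Sum.elim a b i : ℝ) : ℂ)) =
      fromBlocks (diagonal fun i => (a i : ℂ)) 0 0 (diagonal fun i => (b i : ℂ)) := by
    rw [fromBlocks_diagonal]
    congr 1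
    ext i
    cases i <;> rfl
  unfold specMat
  rw [h, fromBlocks_conjTranspose, fromBlocks_multiply, fromBlocks_multiply]
  simp

theorem trace_fromBlocks_eq {κ : Type*} [Fintype κ] (A B C D : Matrix κ κ ℂ) :
    (fromBlocks A B C D).trace = A.trace + D.trace := by
  simp [trace, Fintype.sum_sum_type]

theorem two_point_entropy_le (α β : ℝ) :
    α ^ 2 * Real.log (α ^ 2) + β ^ 2 * Real.log (β ^ 2) -
      (α ^ 2 + β ^ 2) * Real.log ((α ^ 2 + β ^ 2) / 2) ≤ (|α| - |β|) ^ 2 := by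
  have h1 : (1 : Matrix (Fin 2) (Fin 2) ℂ)ᴴ * 1 = 1 := by simp
  have h := sumEnt_sq_le_of_add h1 h1 h1 (l := ![|α|, |β|])
    (m := fun _ => (|α| + |β|) / 2) (w := ![(|α| - |β|) / 2, -((|α| - |β|) / 2)])
    (by simp [Fin.forall_fin_two]) (fun _ => by positivity)
    (by
      rw [specMat_add]
      congr 1
      ext i
      fin_cases i <;> simp <;> ring)
    (by
      intro ψ hψ
      rw [specMat_mul h1, trace_specMat h1, Fin.sum_univ_two, hψ 1 0 rfl]
      simp)
  simp only [sumEnt, Fin.sum_univ_two, Matrix.cons_val_zero, Matrix.cons_val_one, sq_abs, neg_sq,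
    Fintype.card_fin, Nat.cast_ofNat] at h
  have e : ∀ t : ℝ, (t + t) / 2 = t := fun t => by ring
  rw [e, e] at h
  linarith

theorem re_trace_mul_le {U V : Matrix ι ι ℂ} (hU : Uᴴ * U = 1) (hV : Vᴴ * V = 1) (a b : ι → ℝ) :
    (specMat U a * specMat V b).trace.re ≤ √(∑ i, a i ^ 2) * √(∑ i, b i ^ 2) := by
  rw [trace_specMat_mul, Complex.ofReal_re]
  have h := Real.sum_mul_le_sqrt_mul_sqrt (Finset.univ : Finset (ι × ι))
    (fun x => √(overlap U V x.1 x.2) * a x.1) (fun x => √(overlap U V x.1 x.2) * b x.2)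
  simp only [Fintype.sum_prod_type, mul_pow, Real.sq_sqrt (overlap_nonneg _ _ _ _)] at h
  have e1 : ∑ i, ∑ j, overlap U V i j * a i ^ 2 = ∑ i, a i ^ 2 := by
    simp only [← Finset.sum_mul, sum_overlap_right hU hV, one_mul]
  have e2 : ∑ i, ∑ j, overlap U V i j * b j ^ 2 = ∑ i, b i ^ 2 := by
    rw [Finset.sum_comm]
    simp only [← Finset.sum_mul, sum_overlap_left hU hV, one_mul]
  rw [e1, e2] at h
  refine le_trans (le_of_eq ?_) h
  refine Finset.sum_congr rfl fun i _ => Finset.sum_congr rfl fun j _ => ?_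
  have := Real.mul_self_sqrt (overlap_nonneg U V i j)
  calc overlap U V i j * (a i * b j) =
      (√(overlap U V i j) * √(overlap U V i j)) * (a i * b j) := by rw [this]
    _ = _ := by ring

theorem sumEnt_elim_le {U V : Matrix ι ι ℂ} (hU : Uᴴ * U = 1) (hV : Vᴴ * V = 1) (a b : ι → ℝ) :
    sumEnt (fun i => Sum.elim a b i ^ 2) ≤ sumEnt (fun i => a i ^ 2) + sumEnt (fun i => b i ^ 2) +
      ((specMat U a - specMat V b) * (specMat U a - specMat V b)).trace.re := by
  rcases isEmpty_or_nonempty ι with hι | hι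
  · simp [sumEnt, trace]
  rw [sumEnt_eq, sumEnt_eq, sumEnt_eq, Fintype.sum_sum_type, Fintype.sum_sum_type, Fintype.card_sum]
  simp only [Sum.elim_inl, Sum.elim_inr]
  have hX : 0 ≤ ∑ i, a i ^ 2 := Finset.sum_nonneg fun i _ => sq_nonneg _
  have hY : 0 ≤ ∑ i, b i ^ 2 := Finset.sum_nonneg fun i _ => sq_nonneg _
  have htr : ((specMat U a - specMat V b) * (specMat U a - specMat V b)).trace.re =
      ∑ i, a i ^ 2 + ∑ i, b i ^ 2 - 2 * (specMat U a * specMat V b).trace.re := by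
    rw [Matrix.sub_mul, Matrix.mul_sub, Matrix.mul_sub, trace_sub, trace_sub, trace_sub,
      trace_mul_comm (specMat V b) (specMat U a), specMat_mul hU, specMat_mul hV,
      trace_specMat hU, trace_specMat hV]
    simp only [Complex.sub_re, Complex.ofReal_re, pow_two]
    ring
  have hcs := re_trace_mul_le hU hV a b
  have h2 := two_point_entropy_le (√(∑ i, a i ^ 2)) (√(∑ i, b i ^ 2))
  rw [abs_of_nonneg (Real.sqrt_nonneg _), abs_of_nonneg (Real.sqrt_nonneg _), sub_sq,
    Real.sq_sqrt hX, Real.sq_sqrt hY] at h2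
  set X := ∑ i, a i ^ 2
  set Y := ∑ i, b i ^ 2
  have h3 : (X + Y) * Real.log ((X + Y) / 2) = (X + Y) * Real.log (X + Y) - (X + Y) * Real.log 2 := by
    by_cases h : X + Y = 0
    · simp [h]
    · rw [Real.log_div h (by norm_num)]
      ring
  have h4 : Real.log ((Fintype.card ι + Fintype.card ι : ℕ) : ℝ) =
      Real.log 2 + Real.log (Fintype.card ι) := by
    rw [← Real.log_mul (by norm_num) (by simp)]
    push_cast
    ring_nf
  rw [htr, h4]
  rw [h3] at h2
  linarith

theorem sumEnt_fromBlocks_le {U₁ U₂ : Matrix ι ι ℂ} {V W : Matrix (ι ⊕ ι) (ι ⊕ ι) ℂ}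
    (h₁ : U₁ᴴ * U₁ = 1) (h₂ : U₂ᴴ * U₂ = 1) (hV : Vᴴ * V = 1) (hW : Wᴴ * W = 1)
    {a b : ι → ℝ} {l w : ι ⊕ ι → ℝ} (ha : ∀ i, 0 ≤ a i) (hb : ∀ i, 0 ≤ b i) (hl : ∀ i, 0 ≤ l i)
    {C : Matrix ι ι ℂ} (hF : specMat V l = fromBlocks (specMat U₁ a) C Cᴴ (specMat U₂ b))
    (hO : specMat W w = fromBlocks 0 C Cᴴ 0) :
    sumEnt (fun i => l i ^ 2) ≤ sumEnt (fun i => a i ^ 2) + sumEnt (fun i => b i ^ 2) +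
      ((specMat U₁ a - specMat U₂ b) * (specMat U₁ a - specMat U₂ b)).trace.re +
      sumEnt (fun i => w i ^ 2) + 4 * (Cᴴ * C).trace.re := by
  have hE := fromBlocks_isometry h₁ h₂
  have h := sumEnt_sq_le_of_add (m := Sum.elim a b) hV hE hW hl
    (by rintro (i | i) <;> simp [ha, hb])
    (by rw [hF, hO, fromBlocks_specMat, fromBlocks_add]; simp)
    (by
      intro ψ _
      rw [← Sum.elim_comp_inl_inr ψ, fromBlocks_specMat, hO, fromBlocks_multiply, trace_fromBlocks_eq]
      simp)
  have h2 := sumEnt_elim_le h₁ h₂ a b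
  have h3 : ∑ i, w i ^ 2 = 2 * (Cᴴ * C).trace.re := by
    have h4 := trace_specMat hW (fun i => w i * w i)
    rw [← specMat_mul hW, hO, fromBlocks_multiply, trace_fromBlocks_eq] at h4
    simp only [zero_add, Matrix.mul_zero, add_zero] at h4
    rw [trace_mul_comm C] at h4
    have h5 := congrArg Complex.re h4
    rw [Complex.ofReal_re, Complex.add_re] at h5
    simp only [pow_two]
    linarith
  linarith

/-- The absolute value of an off-diagonal Hermitian block matrix is block diagonal. -/
theorem exists_abs_offDiagonal (C : Matrix ι ι ℂ) {W : Matrix (ι ⊕ ι) (ι ⊕ ι) ℂ} (hW : Wᴴ * W = 1)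
    {w : ι ⊕ ι → ℝ} (hO : specMat W w = fromBlocks 0 C Cᴴ 0) :
    ∃ (U₁ U₂ : Matrix ι ι ℂ) (p q : ι → ℝ), U₁ᴴ * U₁ = 1 ∧ U₂ᴴ * U₂ = 1 ∧ (∀ i, 0 ≤ p i) ∧
      (∀ i, 0 ≤ q i) ∧ specMat U₁ p * specMat U₁ p = C * Cᴴ ∧
      specMat U₂ q * specMat U₂ q = Cᴴ * C ∧
      (fromBlocks (specMat U₁ p) C Cᴴ (specMat U₂ q)).PosSemidef ∧
      (fromBlocks (specMat U₁ p) (-C) (-Cᴴ) (specMat U₂ q)).PosSemidef ∧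
      sumEnt (fun i => w i ^ 2) = sumEnt (fun i => p i ^ 2) + sumEnt (fun i => q i ^ 2) := by
  obtain ⟨U₁, p', h₁, hp, hp0⟩ := exists_specMat_nonneg (posSemidef_self_mul_conjTranspose C)
  obtain ⟨U₂, q', h₂, hq, hq0⟩ := exists_specMat_nonneg (posSemidef_conjTranspose_mul_self C)
  have hp2 : specMat U₁ (fun i => √(p' i)) * specMat U₁ (fun i => √(p' i)) = C * Cᴴ := by
    rw [specMat_mul h₁, hp]
    congr 1
    ext i
    exact Real.mul_self_sqrt (hp0 i)
  have hq2 : specMat U₂ (fun i => √(q' i)) * specMat U₂ (fun i => √(q' i)) = Cᴴ * C := by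
    rw [specMat_mul h₂, hq]
    congr 1
    ext i
    exact Real.mul_self_sqrt (hq0 i)
  have hE := fromBlocks_isometry h₁ h₂
  have hWsq : specMat W w * specMat W w = fromBlocks (C * Cᴴ) 0 0 (Cᴴ * C) := by
    rw [hO, fromBlocks_multiply]
    simp
  have habs : specMat W (fun i => |w i|) = fromBlocks (specMat U₁ (fun i => √(p' i))) 0 0
      (specMat U₂ (fun i => √(q' i))) := by
    apply posSemidef_eq_of_mul_self_eq (specMat_posSemidef _ fun i => abs_nonneg _)
    · rw [← fromBlocks_specMat]
      exact specMat_posSemidef _ (by rintro (i | i) <;> simp)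
    · rw [fromBlocks_multiply, hp2, hq2]
      simp only [Matrix.zero_mul, zero_add, Matrix.mul_zero, add_zero]
      rw [← hWsq, specMat_mul hW, specMat_mul hW]
      simp only [abs_mul_abs_self]
  refine ⟨U₁, U₂, fun i => √(p' i), fun i => √(q' i), h₁, h₂, fun i => Real.sqrt_nonneg _,
    fun i => Real.sqrt_nonneg _, hp2, hq2, ?_, ?_, ?_⟩
  · have h : fromBlocks (specMat U₁ (fun i => √(p' i))) C Cᴴ (specMat U₂ (fun i => √(q' i))) =
        specMat W (fun i => |w i| + w i) := by
      rw [← specMat_add W (fun i => |w i|) w, habs, hO, fromBlocks_add]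
      simp
    rw [h]
    exact specMat_posSemidef _ fun i => by linarith [neg_abs_le (w i)]
  · have h : fromBlocks (specMat U₁ (fun i => √(p' i))) (-C) (-Cᴴ) (specMat U₂ (fun i => √(q' i))) =
        specMat W (fun i => |w i| - w i) := by
      have h2 := specMat_add W (fun i => |w i| - w i) w
      simp only [sub_add_cancel] at h2
      rw [eq_sub_iff_add_eq.2 h2, habs, hO, sub_eq_add_neg, fromBlocks_neg, fromBlocks_add]
      simp
    rw [h]
    exact specMat_posSemidef _ fun i => by linarith [le_abs_self (w i)]
  · have hsum : ∀ φ : ℝ → ℝ, ∑ i, φ (w i ^ 2) = ∑ i, φ (p' i) + ∑ i, φ (q' i) := by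
      intro φ
      have h := sum_eq_of_charpoly_eq hW hE (a := fun i => w i ^ 2) (b := Sum.elim p' q')
        (by
          congr 1
          rw [fromBlocks_specMat, ← hp, ← hq, ← hWsq, specMat_mul hW]
          simp only [pow_two]) φ
      rw [h, Fintype.sum_sum_type]
      simp
    have hpq : ∀ φ : ℝ → ℝ, ∑ i, φ (p' i) = ∑ i, φ (q' i) := by
      intro φ
      refine sum_eq_of_charpoly_eq h₁ h₂ ?_ φ
      rw [← hp, ← hq, charpoly_mul_comm]
    simp only [Real.sq_sqrt (hp0 _), Real.sq_sqrt (hq0 _)]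
    have e1 := hsum (fun x => x * Real.log x)
    have e2 := hsum (fun x => x)
    have e3 := hpq (fun x => x * Real.log x)
    have e4 := hpq (fun x => x)
    unfold sumEnt
    rw [e1, e2, e3, e4, Fintype.card_sum]
    push_cast
    rw [← two_mul (∑ i, q' i), ← two_mul (Fintype.card ι : ℝ), mul_div_mul_left _ _ two_ne_zero]
    ring

end Blocks

section LogSobolev

variable {n : ℕ}

/-- The (unnormalized) Dirichlet form of the qubit depolarizing semigroup. -/
noncomputable def depolForm (C : Matrix (Fin n → Fin 2) (Fin n → Fin 2) ℂ) : ℝ :=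
  ∑ k, ((Cᴴ * C).trace.re - (Cᴴ * depolAt 0 k C).trace.re)

/-- Splitting the first qubit off. -/
def splitQubit (n : ℕ) : (Fin n → Fin 2) ⊕ (Fin n → Fin 2) ≃ (Fin (n + 1) → Fin 2) where
  toFun := Sum.elim (fun x => (Fin.cons 0 x : Fin (n + 1) → Fin 2))
    (fun x => (Fin.cons 1 x : Fin (n + 1) → Fin 2))
  invFun g := if g 0 = 0 then Sum.inl (Fin.tail g) else Sum.inr (Fin.tail g)
  left_inv := by rintro (x | x) <;> simp
  right_inv g := by
    by_cases h : g 0 = 0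
    · simp only [h, if_true, Sum.elim_inl]
      rw [← h, Fin.cons_self_tail]
    · have h1 : g 0 = 1 := by omega
      simp only [h, if_false, Sum.elim_inr]
      rw [← h1, Fin.cons_self_tail]

/-- The blocks of an operator with respect to the first qubit. -/
def qubitBlock (s t : Fin 2) (X : Matrix (Fin (n + 1) → Fin 2) (Fin (n + 1) → Fin 2) ℂ) :
    Matrix (Fin n → Fin 2) (Fin n → Fin 2) ℂ :=
  X.submatrix (fun x => (Fin.cons s x : Fin (n + 1) → Fin 2))
    (fun x => (Fin.cons t x : Fin (n + 1) → Fin 2))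

theorem submatrix_splitQubit (X : Matrix (Fin (n + 1) → Fin 2) (Fin (n + 1) → Fin 2) ℂ) :
    X.submatrix (splitQubit n) (splitQubit n) =
      fromBlocks (qubitBlock 0 0 X) (qubitBlock 0 1 X) (qubitBlock 1 0 X) (qubitBlock 1 1 X) := by
  ext (i | i) (j | j) <;> rfl

theorem trace_submatrix_splitQubit (X : Matrix (Fin (n + 1) → Fin 2) (Fin (n + 1) → Fin 2) ℂ) :
    (X.submatrix (splitQubit n) (splitQubit n)).trace = X.trace := by
  simp only [trace, diag_apply, submatrix_apply]
  exact (splitQubit n).sum_comp fun i => X i i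

theorem trace_conjTranspose_mul_eq_blocks
    (X Y : Matrix (Fin (n + 1) → Fin 2) (Fin (n + 1) → Fin 2) ℂ) :
    (Xᴴ * Y).trace = ∑ s, ∑ t, ((qubitBlock s t X)ᴴ * qubitBlock s t Y).trace := by
  rw [← trace_submatrix_splitQubit, submatrix_mul _ _ _ (splitQubit n) _ (splitQubit n).bijective,
    ← conjTranspose_submatrix, submatrix_splitQubit, submatrix_splitQubit, fromBlocks_conjTranspose,
    fromBlocks_multiply, trace_fromBlocks_eq, Fin.sum_univ_two, Fin.sum_univ_two, Fin.sum_univ_two,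
    trace_add, trace_add]
  ring

theorem qubitBlock_depolAt_succ (s t : Fin 2) (k : Fin n)
    (X : Matrix (Fin (n + 1) → Fin 2) (Fin (n + 1) → Fin 2) ℂ) :
    qubitBlock s t (depolAt 0 k.succ X) = depolAt 0 k (qubitBlock s t X) := by
  ext x y
  simp only [qubitBlock, submatrix_apply, depolAt_zero_apply, Fin.cons_succ, Fin.cons_update]

theorem qubitBlock_depolAt_zero (s t : Fin 2)
    (X : Matrix (Fin (n + 1) → Fin 2) (Fin (n + 1) → Fin 2) ℂ) :
    qubitBlock s t (depolAt 0 0 X) =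
      if s = t then (1 / 2 : ℝ) • (qubitBlock 0 0 X + qubitBlock 1 1 X) else 0 := by
  ext x y
  simp only [qubitBlock, submatrix_apply, depolAt_zero_apply, Fin.cons_zero, Fin.update_cons_zero,
    Fin.sum_univ_two]
  by_cases h : s = t
  · simp [h, mul_add]
  · simp [h]

theorem depolForm_conjTranspose (C : Matrix (Fin n → Fin 2) (Fin n → Fin 2) ℂ) :
    depolForm Cᴴ = depolForm C := by
  refine Finset.sum_congr rfl fun k _ => ?_
  rw [conjTranspose_conjTranspose, trace_mul_comm C, depolAt_zero_conjTranspose, trace_mul_comm C]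
  have h : (depolAt 0 k C)ᴴ * C = (Cᴴ * depolAt 0 k C)ᴴ := by
    rw [conjTranspose_mul, conjTranspose_conjTranspose]
  rw [h, trace_conjTranspose]
  simp

theorem depolForm_succ (X : Matrix (Fin (n + 1) → Fin 2) (Fin (n + 1) → Fin 2) ℂ) :
    depolForm X = ((qubitBlock 0 1 X)ᴴ * qubitBlock 0 1 X).trace.re +
      ((qubitBlock 1 0 X)ᴴ * qubitBlock 1 0 X).trace.re +
      1 / 2 * ((qubitBlock 0 0 X - qubitBlock 1 1 X)ᴴ *
        (qubitBlock 0 0 X - qubitBlock 1 1 X)).trace.re +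
      ∑ s, ∑ t, depolForm (qubitBlock s t X) := by
  have h1 : ∑ k : Fin n, ((Xᴴ * X).trace.re - (Xᴴ * depolAt 0 k.succ X).trace.re) =
      ∑ s, ∑ t, depolForm (qubitBlock s t X) := by
    simp only [trace_conjTranspose_mul_eq_blocks, qubitBlock_depolAt_succ, Complex.re_sum, depolForm]
    simp only [Finset.sum_sub_distrib, Fin.sum_univ_two, Finset.sum_add_distrib]
  have h2 : (Xᴴ * X).trace.re - (Xᴴ * depolAt 0 0 X).trace.re =
      ((qubitBlock 0 1 X)ᴴ * qubitBlock 0 1 X).trace.re +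
      ((qubitBlock 1 0 X)ᴴ * qubitBlock 1 0 X).trace.re +
      1 / 2 * ((qubitBlock 0 0 X - qubitBlock 1 1 X)ᴴ *
        (qubitBlock 0 0 X - qubitBlock 1 1 X)).trace.re := by
    simp only [trace_conjTranspose_mul_eq_blocks, qubitBlock_depolAt_zero, Fin.sum_univ_two]
    simp [Matrix.mul_add, Matrix.mul_sub, Matrix.sub_mul, trace_add, trace_sub]
    ring
  rw [depolForm, Fin.sum_univ_succ, h1, h2]

/-- Logarithmic Sobolev inequality for the qubit depolarizing semigroup. -/
theorem sumEnt_sq_le_depolForm : ∀ {n : ℕ} {U : Matrix (Fin n → Fin 2) (Fin n → Fin 2) ℂ}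
    (_ : Uᴴ * U = 1) {a : (Fin n → Fin 2) → ℝ} (_ : ∀ i, 0 ≤ a i),
    sumEnt (fun i => a i ^ 2) ≤ 2 * depolForm (specMat U a) := by
  intro n
  induction n with
  | zero =>
    intro U hU a ha
    simp [sumEnt, depolForm]
  | succ n ih =>
    intro U hU a ha
    set X := specMat U a with hX
    set V := U.submatrix (splitQubit n) (splitQubit n) with hVdef
    have hV : Vᴴ * V = 1 := by
      rw [hVdef, conjTranspose_submatrix, submatrix_mul_equiv, hU, submatrix_one_equiv]
    have hF : specMat V (a ∘ splitQubit n) = X.submatrix (splitQubit n) (splitQubit n) := by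
      have hd : diagonal (fun i => ((a ∘ splitQubit n) i : ℂ)) =
          (diagonal fun i => (a i : ℂ)).submatrix (splitQubit n) (splitQubit n) := by
        rw [submatrix_diagonal_equiv]
        rfl
      rw [hX]
      unfold specMat
      rw [hd, hVdef, conjTranspose_submatrix, submatrix_mul_equiv, submatrix_mul_equiv]
    have hpsd : X.PosSemidef := specMat_posSemidef U ha
    have hA : (qubitBlock 0 0 X).PosSemidef := hpsd.submatrix _
    have hB : (qubitBlock 1 1 X).PosSemidef := hpsd.submatrix _
    have hC : qubitBlock 1 0 X = (qubitBlock 0 1 X)ᴴ := by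
      have := hpsd.isHermitian
      conv_lhs => rw [← this.eq]
      rfl
    rw [submatrix_splitQubit, hC] at hF
    obtain ⟨U₁, b, h₁, hb, hb0⟩ := exists_specMat_nonneg hA
    obtain ⟨U₂, c, h₂, hc, hc0⟩ := exists_specMat_nonneg hB
    set C := qubitBlock 0 1 X with hCdef
    obtain ⟨W, w, hW, hO⟩ := exists_specMat (A := fromBlocks 0 C Cᴴ 0)
      (by rw [IsHermitian, fromBlocks_conjTranspose]; simp)
    rw [hb, hc] at hF
    have hstep := sumEnt_fromBlocks_le h₁ h₂ hV hW hb0 hc0 (fun i => ha _) hF hO.symm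
    obtain ⟨P₁, P₂, p, q, hP₁, hP₂, hp0, hq0, hp, hq, hpos, hneg, hent⟩ :=
      exists_abs_offDiagonal C hW hO.symm
    have hsum : sumEnt (fun i => a (splitQubit n i) ^ 2) = sumEnt (fun i => a i ^ 2) := by
      unfold sumEnt
      have e1 := (splitQubit n).sum_comp fun i => a i ^ 2 * Real.log (a i ^ 2)
      have e2 := (splitQubit n).sum_comp fun i => a i ^ 2
      simp only [e1, e2, Fintype.card_congr (splitQubit n)]
    have hCC : depolForm (specMat P₁ p) + depolForm (specMat P₂ q) ≤ 2 * depolForm C := by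
      rw [depolForm, depolForm, depolForm, ← Finset.sum_add_distrib, Finset.mul_sum]
      refine Finset.sum_le_sum fun k _ => ?_
      have h := trace_mul_re_nonneg hneg (fromBlocks_depolAt_zero_posSemidef k hpos)
      rw [fromBlocks_multiply, trace_fromBlocks_eq, depolAt_zero_conjTranspose] at h
      have h3 : (C * (depolAt 0 k C)ᴴ).trace.re = (Cᴴ * depolAt 0 k C).trace.re := by
        have h4 : C * (depolAt 0 k C)ᴴ = (depolAt 0 k C * Cᴴ)ᴴ := by
          rw [conjTranspose_mul, conjTranspose_conjTranspose]
        rw [h4, trace_conjTranspose, trace_mul_comm]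
        simp
      rw [(specMat_isHermitian P₁ p).eq, (specMat_isHermitian P₂ q).eq, hp, hq, trace_mul_comm C]
      simp only [Matrix.neg_mul, trace_add, trace_neg, Complex.add_re, Complex.neg_re, h3] at h
      linarith
    rw [hsum, hent] at hstep
    have i1 := ih h₁ hb0
    have i2 := ih h₂ hc0
    have i3 := ih hP₁ hp0
    have i4 := ih hP₂ hq0
    rw [depolForm_succ, hC, Fin.sum_univ_two, Fin.sum_univ_two, Fin.sum_univ_two, hC,
      depolForm_conjTranspose, conjTranspose_conjTranspose, trace_mul_comm C, ← hCdef, hb, hc]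
    have hH : (specMat U₁ b - specMat U₂ c)ᴴ = specMat U₁ b - specMat U₂ c := by
      rw [conjTranspose_sub, (specMat_isHermitian U₁ b).eq, (specMat_isHermitian U₂ c).eq]
    rw [hH]
    linarith

end LogSobolev

section Channel

variable {n : ℕ}

theorem depolAt_add (γ : ℝ) (k : Fin n) (X Y : Matrix (Fin n → Fin 2) (Fin n → Fin 2) ℂ) :
    depolAt γ k (X + Y) = depolAt γ k X + depolAt γ k Y := by
  rw [depolAt_eq, depolAt_eq γ k X, depolAt_eq γ k Y, depolAt_zero_add, smul_add, smul_add]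
  abel

theorem depolAt_smul (γ : ℝ) (k : Fin n) (c : ℝ) (X : Matrix (Fin n → Fin 2) (Fin n → Fin 2) ℂ) :
    depolAt γ k (c • X) = c • depolAt γ k X := by
  rw [depolAt_eq, depolAt_eq γ k X, depolAt_zero_smul, smul_add, smul_comm c, smul_comm c]

theorem depolAt_comm (γ δ : ℝ) (j k : Fin n) (X : Matrix (Fin n → Fin 2) (Fin n → Fin 2) ℂ) :
    depolAt γ j (depolAt δ k X) = depolAt δ k (depolAt γ j X) := by
  rw [depolAt_eq δ k X, depolAt_eq γ j X]
  simp only [depolAt_add, depolAt_smul]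
  rw [depolAt_eq γ j X, depolAt_eq δ k X, depolAt_eq γ j (depolAt 0 k X),
    depolAt_eq δ k (depolAt 0 j X), depolAt_zero_comm j k]
  module

theorem depolAt_depolAt (γ δ : ℝ) (k : Fin n) (X : Matrix (Fin n → Fin 2) (Fin n → Fin 2) ℂ) :
    depolAt γ k (depolAt δ k X) = depolAt (γ * δ) k X := by
  rw [depolAt_eq δ k X, depolAt_add, depolAt_smul, depolAt_smul, depolAt_eq γ k X,
    depolAt_eq γ k (depolAt 0 k X), depolAt_zero_idem, depolAt_eq (γ * δ) k X]
  module

theorem foldl_depolAt_comm (γ δ : ℝ) (j : Fin n) (l : List (Fin n))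
    (X : Matrix (Fin n → Fin 2) (Fin n → Fin 2) ℂ) :
    l.foldl (fun g k => depolAt γ k g) (depolAt δ j X) =
      depolAt δ j (l.foldl (fun g k => depolAt γ k g) X) := by
  induction l generalizing X with
  | nil => rfl
  | cons k l ih => rw [List.foldl_cons, List.foldl_cons, depolAt_comm, ih]

theorem depolChannel_depolChannel (γ δ : ℝ) (X : Matrix (Fin n → Fin 2) (Fin n → Fin 2) ℂ) :
    depolChannel γ (depolChannel δ X) = depolChannel (γ * δ) X := by
  unfold depolChannel
  generalize List.finRange n = l
  induction l generalizing X with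
  | nil => rfl
  | cons k l ih =>
    rw [List.foldl_cons, List.foldl_cons, List.foldl_cons, foldl_depolAt_comm, foldl_depolAt_comm,
      foldl_depolAt_comm, foldl_depolAt_comm, ih, depolAt_depolAt]

theorem depolChannel_add (γ : ℝ) (X Y : Matrix (Fin n → Fin 2) (Fin n → Fin 2) ℂ) :
    depolChannel γ (X + Y) = depolChannel γ X + depolChannel γ Y := by
  unfold depolChannel
  generalize List.finRange n = l
  induction l generalizing X Y with
  | nil => rfl
  | cons k l ih => simp only [List.foldl_cons, depolAt_add, ih]

theorem depolChannel_smul (γ c : ℝ) (X : Matrix (Fin n → Fin 2) (Fin n → Fin 2) ℂ) :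
    depolChannel γ (c • X) = c • depolChannel γ X := by
  unfold depolChannel
  generalize List.finRange n = l
  induction l generalizing X with
  | nil => rfl
  | cons k l ih => simp only [List.foldl_cons, depolAt_smul, ih]

theorem depolChannel_one (γ : ℝ) :
    depolChannel γ (1 : Matrix (Fin n → Fin 2) (Fin n → Fin 2) ℂ) = 1 := by
  unfold depolChannel
  generalize List.finRange n = l
  induction l with
  | nil => rfl
  | cons k l ih =>
    rw [List.foldl_cons, depolAt_eq, depolAt_zero_one, ← add_smul, add_sub_cancel, one_smul, ih]

theorem trace_mul_depolAt (γ : ℝ) (k : Fin n) (X Y : Matrix (Fin n → Fin 2) (Fin n → Fin 2) ℂ) :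
    (X * depolAt γ k Y).trace = (depolAt γ k X * Y).trace := by
  rw [depolAt_eq γ k Y, depolAt_eq γ k X, Matrix.mul_add, Matrix.add_mul, trace_add, trace_add,
    Matrix.mul_smul, Matrix.mul_smul, Matrix.smul_mul, Matrix.smul_mul, trace_smul, trace_smul,
    trace_smul, trace_mul_depolAt_zero]

theorem trace_mul_depolChannel (γ : ℝ) (X Y : Matrix (Fin n → Fin 2) (Fin n → Fin 2) ℂ) :
    (X * depolChannel γ Y).trace = (depolChannel γ X * Y).trace := by
  unfold depolChannel
  generalize List.finRange n = l
  induction l generalizing X Y with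
  | nil => rfl
  | cons k l ih =>
    rw [List.foldl_cons, List.foldl_cons, ih, trace_mul_depolAt, foldl_depolAt_comm]

theorem trace_depolChannel (γ : ℝ) (X : Matrix (Fin n → Fin 2) (Fin n → Fin 2) ℂ) :
    (depolChannel γ X).trace = X.trace := by
  have h := trace_mul_depolChannel γ 1 X
  rwa [depolChannel_one, Matrix.one_mul, Matrix.one_mul] at h

theorem depolAt_posSemidef {γ : ℝ} (h0 : 0 ≤ γ) (h1 : γ ≤ 1) (k : Fin n)
    {X : Matrix (Fin n → Fin 2) (Fin n → Fin 2) ℂ} (hX : X.PosSemidef) :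
    (depolAt γ k X).PosSemidef := by
  rw [depolAt_eq]
  exact (hX.smul h0).add ((depolAt_zero_posSemidef k hX).smul (sub_nonneg.2 h1))

theorem depolChannel_posSemidef {γ : ℝ} (h0 : 0 ≤ γ) (h1 : γ ≤ 1)
    {X : Matrix (Fin n → Fin 2) (Fin n → Fin 2) ℂ} (hX : X.PosSemidef) :
    (depolChannel γ X).PosSemidef := by
  unfold depolChannel
  generalize List.finRange n = l
  induction l generalizing X with
  | nil => exact hX
  | cons k l ih => exact ih (depolAt_posSemidef h0 h1 k hX)

theorem depolChannel_one_apply (X : Matrix (Fin n → Fin 2) (Fin n → Fin 2) ℂ) :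
    depolChannel 1 X = X := by
  unfold depolChannel
  generalize List.finRange n = l
  induction l generalizing X with
  | nil => rfl
  | cons k l ih =>
    rw [List.foldl_cons, ih, depolAt_eq]
    simp

theorem depolAt_zero_depolChannel_zero (k : Fin n)
    (X : Matrix (Fin n → Fin 2) (Fin n → Fin 2) ℂ) :
    depolAt 0 k (depolChannel 0 X) = depolChannel 0 X := by
  have h : ∀ l : List (Fin n), k ∈ l → depolAt 0 k (l.foldl (fun g k => depolAt 0 k g) X) =
      l.foldl (fun g k => depolAt 0 k g) X := by
    intro l
    induction l with
    | nil => simp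
    | cons j l ih =>
      intro hk
      rw [List.foldl_cons, foldl_depolAt_comm]
      rcases List.mem_cons.1 hk with rfl | hk
      · rw [depolAt_zero_idem]
      · rw [depolAt_zero_comm, ih hk]
  exact h _ (List.mem_finRange k)

theorem depolChannel_zero_apply (X : Matrix (Fin n → Fin 2) (Fin n → Fin 2) ℂ) :
    depolChannel 0 X = (X.trace / Fintype.card (Fin n → Fin 2)) • 1 := by
  set Y := depolChannel 0 X with hY
  have hk : ∀ k, depolAt 0 k Y = Y := fun k => depolAt_zero_depolChannel_zero k X
  have hoff : ∀ x y, x ≠ y → Y x y = 0 := by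
    intro x y hxy
    obtain ⟨k, hk'⟩ := Function.ne_iff.1 hxy
    rw [← hk k, depolAt_zero_apply, if_neg hk']
  have hup : ∀ k b x, Y (Function.update x k b) (Function.update x k b) = Y x x := by
    intro k b x
    rw [← hk k, depolAt_zero_apply, depolAt_zero_apply]
    simp
  have hconst : ∀ x y, Y x x = Y y y := by
    intro x y
    have h : ∀ s : Finset (Fin n), Y (s.piecewise x y) (s.piecewise x y) = Y y y := by
      intro s
      induction s using Finset.induction_on with
      | empty => simp
      | insert j s hj ih => rw [Finset.piecewise_insert, hup, ih]
    have := h Finset.univ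
    simpa using this
  ext x y
  by_cases hxy : x = y
  · subst hxy
    have ht : (Fintype.card (Fin n → Fin 2) : ℂ) * Y x x = X.trace := by
      rw [← trace_depolChannel 0 X, ← hY, trace]
      simp only [diag_apply, fun z => hconst z x, Finset.sum_const, Finset.card_univ, nsmul_eq_mul]
    rw [Matrix.smul_apply, one_apply_eq, ← ht, smul_eq_mul, mul_one, mul_div_cancel_left₀]
    simp
  · rw [hoff x y hxy, Matrix.smul_apply, one_apply_ne hxy, smul_zero]

/-- The generator of the qubit depolarizing semigroup. -/
noncomputable def depolGen (X : Matrix (Fin n → Fin 2) (Fin n → Fin 2) ℂ) :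
    Matrix (Fin n → Fin 2) (Fin n → Fin 2) ℂ :=
  ∑ k, (X - depolAt 0 k X)

theorem norm_depolAt_zero_apply_le {X : Matrix (Fin n → Fin 2) (Fin n → Fin 2) ℂ} {B : ℝ}
    (hX : ∀ x y, ‖X x y‖ ≤ B) (k : Fin n) (x y : Fin n → Fin 2) : ‖depolAt 0 k X x y‖ ≤ B := by
  have hB : 0 ≤ B := (norm_nonneg _).trans (hX x y)
  rw [depolAt_zero_apply]
  split_ifs with h
  · rw [Fin.sum_univ_two, norm_mul]
    have h1 := norm_add_le (X (Function.update x k 0) (Function.update y k 0))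
      (X (Function.update x k 1) (Function.update y k 1))
    have h2 := hX (Function.update x k 0) (Function.update y k 0)
    have h3 := hX (Function.update x k 1) (Function.update y k 1)
    have h4 : ‖(1 / 2 : ℂ)‖ = 1 / 2 := by norm_num
    rw [h4]
    linarith
  · simpa using hB

theorem norm_sub_depolAt_zero_apply_le {X : Matrix (Fin n → Fin 2) (Fin n → Fin 2) ℂ} {B : ℝ}
    (hX : ∀ x y, ‖X x y‖ ≤ B) (k : Fin n) (x y : Fin n → Fin 2) :
    ‖(X - depolAt 0 k X) x y‖ ≤ 2 * B := by
  rw [Matrix.sub_apply]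
  linarith [norm_sub_le (X x y) (depolAt 0 k X x y), hX x y, norm_depolAt_zero_apply_le hX k x y]

theorem norm_depolGen_apply_le {X : Matrix (Fin n → Fin 2) (Fin n → Fin 2) ℂ} {B : ℝ}
    (hX : ∀ x y, ‖X x y‖ ≤ B) (x y : Fin n → Fin 2) : ‖depolGen X x y‖ ≤ 2 * n * B := by
  unfold depolGen
  rw [Matrix.sum_apply]
  refine (norm_sum_le _ _).trans ?_
  refine (Finset.sum_le_sum fun k _ => norm_sub_depolAt_zero_apply_le hX k x y).trans_eq ?_
  simp
  ring

theorem exists_norm_depolChannel_sub_le (n : ℕ) : ∃ C : ℝ, 0 ≤ C ∧ ∀ κ : ℝ, 0 ≤ κ → κ ≤ 1 →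
    ∀ (X : Matrix (Fin n → Fin 2) (Fin n → Fin 2) ℂ) (B : ℝ), (∀ x y, ‖X x y‖ ≤ B) →
      ∀ x y, ‖(depolChannel (1 + κ) X - X - κ • depolGen X) x y‖ ≤ C * κ ^ 2 * B := by
  have h : ∀ l : List (Fin n), ∃ C D : ℝ, 0 ≤ C ∧ 0 ≤ D ∧ ∀ κ : ℝ, 0 ≤ κ → κ ≤ 1 →
      ∀ (X : Matrix (Fin n → Fin 2) (Fin n → Fin 2) ℂ) (B : ℝ), (∀ x y, ‖X x y‖ ≤ B) → ∀ x y,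
      ‖(l.map fun k => X - depolAt 0 k X).sum x y‖ ≤ D * B ∧
      ‖(l.foldl (fun g k => depolAt (1 + κ) k g) X - X -
        κ • (l.map fun k => X - depolAt 0 k X).sum) x y‖ ≤ C * κ ^ 2 * B := by
    intro l
    induction l with
    | nil => exact ⟨0, 0, le_rfl, le_rfl, fun κ h0 h1 X B hX x y => by simp⟩
    | cons j l ih =>
      obtain ⟨C, D, hC, hD, ih⟩ := ih
      refine ⟨C + 2 * C + 2 * D, 2 + D, by positivity, by positivity, ?_⟩
      intro κ h0 h1 X B hX x y
      have hB : 0 ≤ B := (norm_nonneg _).trans (hX x y)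
      set S := (l.map fun k => X - depolAt 0 k X).sum with hS
      set Z := l.foldl (fun g k => depolAt (1 + κ) k g) X with hZ
      have hS1 : ∀ x y, ‖S x y‖ ≤ D * B := fun x y => (ih κ h0 h1 X B hX x y).1
      have hR1 : ∀ x y, ‖(Z - X - κ • S) x y‖ ≤ C * κ ^ 2 * B := fun x y => (ih κ h0 h1 X B hX x y).2
      set R := Z - X - κ • S with hR
      have hcons : ((j :: l).map fun k => X - depolAt 0 k X).sum = (X - depolAt 0 j X) + S := by
        rw [List.map_cons, List.sum_cons]
      rw [hcons, List.foldl_cons, foldl_depolAt_comm, ← hZ]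
      have e1 := norm_sub_depolAt_zero_apply_le hX j x y
      have e2 := norm_sub_depolAt_zero_apply_le hS1 j x y
      have e3 := norm_sub_depolAt_zero_apply_le hR1 j x y
      constructor
      · rw [Matrix.add_apply]
        linarith [norm_add_le ((X - depolAt 0 j X) x y) (S x y), hS1 x y]
      · have hZ2 : Z = R + X + κ • S := by rw [hR]; abel
        have key : depolAt (1 + κ) j Z - X - κ • ((X - depolAt 0 j X) + S) =
            R + (κ ^ 2) • (S - depolAt 0 j S) + κ • (R - depolAt 0 j R) := by
          rw [depolAt_eq, hZ2, depolAt_zero_add, depolAt_zero_add, depolAt_zero_smul]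
          module
        rw [key, Matrix.add_apply, Matrix.add_apply, Matrix.smul_apply, Matrix.smul_apply]
        refine (norm_add_le _ _).trans ?_
        have e4 := norm_add_le (R x y) ((κ ^ 2) • (S - depolAt 0 j S) x y)
        rw [norm_smul, Real.norm_of_nonneg (by positivity)] at e4
        rw [norm_smul, Real.norm_of_nonneg h0]
        have e5 := mul_le_mul_of_nonneg_left e2 (by positivity : 0 ≤ κ ^ 2)
        have e6 : κ * ‖(R - depolAt 0 j R) x y‖ ≤ 2 * (C * κ ^ 2 * B) := by
          refine (mul_le_of_le_one_left (norm_nonneg _) h1).trans e3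
        have e7 := hR1 x y
        linarith
  obtain ⟨C, D, hC, -, h⟩ := h (List.finRange n)
  refine ⟨C, hC, fun κ h0 h1 X B hX x y => ?_⟩
  have := (h κ h0 h1 X B hX x y).2
  have hs : ((List.finRange n).map fun k => X - depolAt 0 k X).sum = depolGen X := by
    rw [depolGen, ← List.ofFn_eq_map, List.sum_ofFn]
  rwa [hs] at this

end Channel

section StroockVaropoulos

variable {n : ℕ}

/-- The transition rates of the depolarizing channel at the `k`-th qubit in the basis `U`. -/
noncomputable def qubitRate (U : Matrix (Fin n → Fin 2) (Fin n → Fin 2) ℂ) (k : Fin n)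
    (i j : Fin n → Fin 2) : ℝ :=
  1 / 2 * ∑ a, ∑ b, overlap U (qubitUnit k a b * U) i j

theorem qubitRate_nonneg (U : Matrix (Fin n → Fin 2) (Fin n → Fin 2) ℂ) (k : Fin n)
    (i j : Fin n → Fin 2) : 0 ≤ qubitRate U k i j :=
  mul_nonneg (by norm_num) (Finset.sum_nonneg fun _ _ => Finset.sum_nonneg fun _ _ =>
    overlap_nonneg _ _ _ _)

theorem qubitRate_comm (U : Matrix (Fin n → Fin 2) (Fin n → Fin 2) ℂ) (k : Fin n)
    (i j : Fin n → Fin 2) : qubitRate U k i j = qubitRate U k j i := by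
  unfold qubitRate
  congr 1
  rw [Finset.sum_comm]
  refine Finset.sum_congr rfl fun a _ => Finset.sum_congr rfl fun b _ => ?_
  have h : Uᴴ * (qubitUnit k b a * U) = (Uᴴ * (qubitUnit k a b * U))ᴴ := by
    rw [conjTranspose_mul, conjTranspose_mul, conjTranspose_conjTranspose,
      qubitUnit_conjTranspose, Matrix.mul_assoc]
  rw [overlap, overlap, h, conjTranspose_apply, Complex.star_def, Complex.normSq_conj]

theorem trace_specMat_mul_depolAt_zero (U : Matrix (Fin n → Fin 2) (Fin n → Fin 2) ℂ) (k : Fin n)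
    (x y : (Fin n → Fin 2) → ℝ) : (specMat U x * depolAt 0 k (specMat U y)).trace.re =
      ∑ i, ∑ j, qubitRate U k i j * (x i * y j) := by
  have h : ∀ a b, qubitUnit k a b * specMat U y * (qubitUnit k a b)ᴴ =
      specMat (qubitUnit k a b * U) y := by
    intro a b
    simp only [specMat, conjTranspose_mul, Matrix.mul_assoc]
  have h2 : (specMat U x * depolAt 0 k (specMat U y)).trace.re =
      1 / 2 * ∑ a, ∑ b, ∑ i, ∑ j, overlap U (qubitUnit k a b * U) i j * (x i * y j) := by
    simp only [depolAt_zero_eq_sum, h, Matrix.mul_smul, Matrix.mul_sum, trace_smul, trace_sum,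
      trace_specMat_mul, Complex.smul_re, smul_eq_mul, Complex.re_sum, Complex.ofReal_re]
  rw [h2]
  simp only [qubitRate, Fin.sum_univ_two, ← Finset.sum_add_distrib, Finset.mul_sum]
  refine Finset.sum_congr rfl fun i _ => Finset.sum_congr rfl fun j _ => ?_
  ring

theorem sum_qubitRate {U : Matrix (Fin n → Fin 2) (Fin n → Fin 2) ℂ} (hU : Uᴴ * U = 1)
    (k : Fin n) (i : Fin n → Fin 2) : ∑ j, qubitRate U k i j = 1 := by
  have h := trace_specMat_mul_depolAt_zero U k (Pi.single i 1) (fun _ => 1)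
  rw [specMat_const hU, Complex.ofReal_one, one_smul, depolAt_zero_one, Matrix.mul_one,
    trace_specMat hU, Complex.ofReal_re] at h
  simpa [Pi.single_apply] using h.symm

theorem trace_specMat_mul_depolGen {U : Matrix (Fin n → Fin 2) (Fin n → Fin 2) ℂ}
    (hU : Uᴴ * U = 1) (x y : (Fin n → Fin 2) → ℝ) :
    (specMat U x * depolGen (specMat U y)).trace.re =
      1 / 2 * ∑ k, ∑ i, ∑ j, qubitRate U k i j * ((x i - x j) * (y i - y j)) := by
  rw [depolGen, Matrix.mul_sum, trace_sum, Complex.re_sum, Finset.mul_sum]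
  refine Finset.sum_congr rfl fun k _ => ?_
  rw [Matrix.mul_sub, trace_sub, Complex.sub_re, specMat_mul hU, trace_specMat hU,
    Complex.ofReal_re, trace_specMat_mul_depolAt_zero]
  have h1 : ∑ i, x i * y i = ∑ i, ∑ j, qubitRate U k i j * (x i * y i) := by
    simp only [← Finset.sum_mul, sum_qubitRate hU, one_mul]
  have h2 : ∑ i, x i * y i = ∑ i, ∑ j, qubitRate U k i j * (x j * y j) := by
    rw [Finset.sum_comm]
    simp only [qubitRate_comm U k, ← Finset.sum_mul, sum_qubitRate hU, one_mul]
  have h3 : ∑ i, ∑ j, qubitRate U k i j * (x i * y j) =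
      ∑ i, ∑ j, qubitRate U k i j * (x j * y i) := by
    rw [Finset.sum_comm]
    simp only [qubitRate_comm U k]
  have h4 : ∑ i, ∑ j, qubitRate U k i j * ((x i - x j) * (y i - y j)) =
      ∑ i, ∑ j, qubitRate U k i j * (x i * y i) + ∑ i, ∑ j, qubitRate U k i j * (x j * y j) -
      ∑ i, ∑ j, qubitRate U k i j * (x i * y j) - ∑ i, ∑ j, qubitRate U k i j * (x j * y i) := by
    simp only [← Finset.sum_add_distrib, ← Finset.sum_sub_distrib]
    refine Finset.sum_congr rfl fun i _ => Finset.sum_congr rfl fun j _ => ?_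
    ring
  rw [h4, ← h1, ← h2, ← h3]
  ring

theorem depolForm_specMat {U : Matrix (Fin n → Fin 2) (Fin n → Fin 2) ℂ}
    (hU : Uᴴ * U = 1) (x : (Fin n → Fin 2) → ℝ) :
    depolForm (specMat U x) = 1 / 2 * ∑ k, ∑ i, ∑ j, qubitRate U k i j * (x i - x j) ^ 2 := by
  simp only [sq]
  rw [← trace_specMat_mul_depolGen hU, depolForm, depolGen, (specMat_isHermitian U x).eq,
    Matrix.mul_sum, trace_sum, Complex.re_sum]
  refine Finset.sum_congr rfl fun k _ => ?_
  rw [Matrix.mul_sub, trace_sub, Complex.sub_re]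

theorem sinh_mul_le {θ x : ℝ} (h0 : 0 ≤ θ) (h1 : θ ≤ 1) (hx : 0 ≤ x) :
    Real.sinh (θ * x) ≤ θ * Real.sinh x := by
  have hd : ∀ y, HasDerivAt (fun y => θ * Real.sinh y - Real.sinh (θ * y))
      (θ * (Real.cosh y - Real.cosh (θ * y))) y := by
    intro y
    have := ((Real.hasDerivAt_sinh y).const_mul θ).sub
      ((Real.hasDerivAt_sinh (θ * y)).comp y ((hasDerivAt_id y).const_mul θ))
    refine HasDerivAt.congr_deriv this ?_
    ring
  have hm : MonotoneOn (fun y => θ * Real.sinh y - Real.sinh (θ * y)) (Set.Ici 0) := by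
    refine monotoneOn_of_deriv_nonneg (convex_Ici 0) ?_ ?_ ?_
    · exact fun y _ => (hd y).continuousAt.continuousWithinAt
    · exact fun y _ => (hd y).differentiableAt.differentiableWithinAt
    · intro y hy
      rw [interior_Ici] at hy
      rw [(hd y).deriv]
      refine mul_nonneg h0 (sub_nonneg.2 (Real.cosh_le_cosh.2 ?_))
      have hy' : (0 : ℝ) < y := hy
      rw [abs_of_nonneg (mul_nonneg h0 hy'.le), abs_of_pos hy']
      exact mul_le_of_le_one_left hy'.le h1
  have := hm (Set.mem_Ici.2 le_rfl) (Set.mem_Ici.2 hx) hx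
  simp only [mul_zero, Real.sinh_zero, sub_zero] at this
  linarith

theorem stroockVaropoulos_exp {q : ℝ} (h0 : 0 < q) (h1 : q < 1) (m t : ℝ) :
    4 * (1 - q) * (Real.exp (q / 2 * (m + t)) - Real.exp (q / 2 * (m - t))) ^ 2 ≤
      q ^ 2 * -((Real.exp ((q - 1) * (m + t)) - Real.exp ((q - 1) * (m - t))) *
        (Real.exp (m + t) - Real.exp (m - t))) := by
  have hA : (Real.exp (q / 2 * (m + t)) - Real.exp (q / 2 * (m - t))) ^ 2 =
      Real.exp (q * m) * (2 * Real.sinh (q / 2 * t)) ^ 2 := by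
    have e1 : Real.exp (q / 2 * (m + t)) = Real.exp (q / 2 * m) * Real.exp (q / 2 * t) := by
      rw [← Real.exp_add]; ring_nf
    have e2 : Real.exp (q / 2 * (m - t)) = Real.exp (q / 2 * m) * Real.exp (-(q / 2 * t)) := by
      rw [← Real.exp_add]; ring_nf
    have e3 : Real.exp (q * m) = Real.exp (q / 2 * m) ^ 2 := by
      rw [← Real.exp_nat_mul]; push_cast; ring_nf
    rw [e1, e2, e3, Real.sinh_eq]
    ring
  have hB : -((Real.exp ((q - 1) * (m + t)) - Real.exp ((q - 1) * (m - t))) *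
        (Real.exp (m + t) - Real.exp (m - t))) =
      Real.exp (q * m) * ((2 * Real.sinh ((2 - q) / 2 * t)) ^ 2 -
        (2 * Real.sinh (q / 2 * t)) ^ 2) := by
    have h : -((Real.exp ((q - 1) * (m + t)) - Real.exp ((q - 1) * (m - t))) *
        (Real.exp (m + t) - Real.exp (m - t))) = Real.exp (q * m) *
        (Real.exp ((2 - q) * t) + Real.exp (-((2 - q) * t)) - Real.exp (q * t) -
          Real.exp (-(q * t))) := by
      have f1 : Real.exp (q * m) * Real.exp ((2 - q) * t) =
          Real.exp ((q - 1) * (m - t)) * Real.exp (m + t) := by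
        rw [← Real.exp_add, ← Real.exp_add]; ring_nf
      have f2 : Real.exp (q * m) * Real.exp (-((2 - q) * t)) =
          Real.exp ((q - 1) * (m + t)) * Real.exp (m - t) := by
        rw [← Real.exp_add, ← Real.exp_add]; ring_nf
      have f3 : Real.exp (q * m) * Real.exp (q * t) =
          Real.exp ((q - 1) * (m + t)) * Real.exp (m + t) := by
        rw [← Real.exp_add, ← Real.exp_add]; ring_nf
      have f4 : Real.exp (q * m) * Real.exp (-(q * t)) =
          Real.exp ((q - 1) * (m - t)) * Real.exp (m - t) := by
        rw [← Real.exp_add, ← Real.exp_add]; ring_nf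
      linear_combination -f1 - f2 + f3 + f4
    rw [h]
    have hs : ∀ z, (2 * Real.sinh (z / 2 * t)) ^ 2 =
        Real.exp (z * t) + Real.exp (-(z * t)) - 2 := by
      intro z
      have e1 : Real.exp (z * t) = Real.exp (z / 2 * t) ^ 2 := by
        rw [← Real.exp_nat_mul]; push_cast; ring_nf
      have e2 : Real.exp (-(z * t)) = Real.exp (-(z / 2 * t)) ^ 2 := by
        rw [← Real.exp_nat_mul]; push_cast; ring_nf
      have e3 : Real.exp (z / 2 * t) * Real.exp (-(z / 2 * t)) = 1 := by
        rw [← Real.exp_add, add_neg_cancel, Real.exp_zero]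
      rw [e1, e2, Real.sinh_eq]
      linear_combination -2 * e3
    rw [hs, hs]
    ring
  have hS : (2 - q) ^ 2 * Real.sinh (q / 2 * t) ^ 2 ≤ q ^ 2 * Real.sinh ((2 - q) / 2 * t) ^ 2 := by
    have key : ∀ t, 0 ≤ t → (2 - q) ^ 2 * Real.sinh (q / 2 * t) ^ 2 ≤
        q ^ 2 * Real.sinh ((2 - q) / 2 * t) ^ 2 := by
      intro t ht
      have h := sinh_mul_le (θ := q / (2 - q)) (x := (2 - q) / 2 * t)
        (div_nonneg h0.le (by linarith)) ((div_le_one (by linarith)).2 (by linarith))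
        (mul_nonneg (by linarith) ht)
      have hne : 2 - q ≠ 0 := by linarith
      have e : q / (2 - q) * ((2 - q) / 2 * t) = q / 2 * t := by field_simp
      rw [e, div_mul_eq_mul_div q (2 - q), le_div_iff₀ (by linarith)] at h
      rw [← mul_pow, ← mul_pow]
      refine pow_le_pow_left₀ (mul_nonneg (by linarith) (Real.sinh_nonneg_iff.2 (by positivity))) ?_ 2
      linarith
    rcases le_total 0 t with ht | ht
    · exact key t ht
    · have := key (-t) (by linarith)
      simpa only [mul_neg, Real.sinh_neg, neg_sq] using this
  rw [hA, hB]
  have := mul_le_mul_of_nonneg_left hS (Real.exp_pos (q * m)).le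
  linarith

theorem stroockVaropoulos_real {q x y : ℝ} (h0 : 0 < q) (h1 : q < 1) (hx : 0 < x) (hy : 0 < y) :
    4 * (1 - q) * (x ^ (q / 2) - y ^ (q / 2)) ^ 2 ≤
      q ^ 2 * -((x ^ (q - 1) - y ^ (q - 1)) * (x - y)) := by
  have h := stroockVaropoulos_exp h0 h1 ((Real.log x + Real.log y) / 2)
    ((Real.log x - Real.log y) / 2)
  have e1 : (Real.log x + Real.log y) / 2 + (Real.log x - Real.log y) / 2 = Real.log x := by ring
  have e2 : (Real.log x + Real.log y) / 2 - (Real.log x - Real.log y) / 2 = Real.log y := by ring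
  rw [e1, e2, Real.exp_log hx, Real.exp_log hy] at h
  simp only [Real.rpow_def_of_pos hx, Real.rpow_def_of_pos hy]
  simpa only [mul_comm (Real.log _)] using h

/-- The reverse Dirichlet form `-τ(g^{q-1} L g)` of `g = U diag(a) Uᴴ`, without normalization. -/
noncomputable def revForm (q : ℝ) (U : Matrix (Fin n → Fin 2) (Fin n → Fin 2) ℂ)
    (a : (Fin n → Fin 2) → ℝ) : ℝ :=
  -(specMat U (fun i => a i ^ (q - 1)) * depolGen (specMat U a)).trace.re

theorem revForm_eq {q : ℝ} {U : Matrix (Fin n → Fin 2) (Fin n → Fin 2) ℂ} (hU : Uᴴ * U = 1)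
    (a : (Fin n → Fin 2) → ℝ) : revForm q U a = 1 / 2 * ∑ k, ∑ i, ∑ j, qubitRate U k i j *
      -((a i ^ (q - 1) - a j ^ (q - 1)) * (a i - a j)) := by
  rw [revForm, trace_specMat_mul_depolGen hU]
  simp only [mul_neg, Finset.sum_neg_distrib]

theorem depolForm_rpow_le_revForm {q : ℝ} (h0 : 0 < q) (h1 : q < 1)
    {U : Matrix (Fin n → Fin 2) (Fin n → Fin 2) ℂ} (hU : Uᴴ * U = 1)
    {a : (Fin n → Fin 2) → ℝ} (ha : ∀ i, 0 < a i) :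
    4 * (1 - q) * depolForm (specMat U (fun i => a i ^ (q / 2))) ≤ q ^ 2 * revForm q U a := by
  rw [revForm_eq hU, depolForm_specMat hU, mul_left_comm, mul_left_comm (q ^ 2)]
  refine mul_le_mul_of_nonneg_left ?_ (by norm_num)
  simp only [Finset.mul_sum]
  refine Finset.sum_le_sum fun k _ => Finset.sum_le_sum fun i _ => Finset.sum_le_sum fun j _ => ?_
  rw [mul_left_comm, mul_left_comm (q ^ 2)]
  exact mul_le_mul_of_nonneg_left (stroockVaropoulos_real h0 h1 (ha i) (ha j))
    (qubitRate_nonneg U k i j)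

theorem sumEnt_rpow_le_revForm {q : ℝ} (h0 : 0 < q) (h1 : q < 1)
    {U : Matrix (Fin n → Fin 2) (Fin n → Fin 2) ℂ} (hU : Uᴴ * U = 1)
    {a : (Fin n → Fin 2) → ℝ} (ha : ∀ i, 0 < a i) :
    2 * (1 - q) * sumEnt (fun i => a i ^ q) ≤ q ^ 2 * revForm q U a := by
  refine le_trans ?_ (depolForm_rpow_le_revForm h0 h1 hU ha)
  have h := sumEnt_sq_le_depolForm hU (a := fun i => a i ^ (q / 2))
    (fun i => (Real.rpow_pos_of_pos (ha i) _).le)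
  have e : (fun i => (a i ^ (q / 2)) ^ 2) = fun i => a i ^ q := by
    funext i
    rw [← Real.rpow_natCast, ← Real.rpow_mul (ha i).le]
    norm_num
  rw [e] at h
  have := mul_le_mul_of_nonneg_left h (by linarith : 0 ≤ 2 * (1 - q))
  linarith

theorem revForm_nonneg {q : ℝ} (h0 : 0 < q) (h1 : q < 1)
    {U : Matrix (Fin n → Fin 2) (Fin n → Fin 2) ℂ} (hU : Uᴴ * U = 1)
    {a : (Fin n → Fin 2) → ℝ} (ha : ∀ i, 0 < a i) : 0 ≤ revForm q U a := by
  rw [revForm_eq hU]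
  refine mul_nonneg (by norm_num) (Finset.sum_nonneg fun k _ => Finset.sum_nonneg fun i _ =>
    Finset.sum_nonneg fun j _ => mul_nonneg (qubitRate_nonneg U k i j) ?_)
  have h := stroockVaropoulos_real h0 h1 (ha i) (ha j)
  have h2 : 0 ≤ 4 * (1 - q) * (a i ^ (q / 2) - a j ^ (q / 2)) ^ 2 :=
    mul_nonneg (by linarith) (sq_nonneg _)
  exact nonneg_of_mul_nonneg_right (h2.trans h) (by positivity)

end StroockVaropoulos

section LogNorm

variable {ι : Type*} [Fintype ι] [DecidableEq ι]

/-- The logarithm `log ‖X‖_q` for positive `X`. -/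
noncomputable def logNorm (q : ℝ) (X : Matrix ι ι ℂ) : ℝ :=
  1 / q * Real.log (ntrace (mpow X q))

theorem logNorm_specMat {U : Matrix ι ι ℂ} (hU : Uᴴ * U = 1) (a : ι → ℝ) (q : ℝ) :
    logNorm q (specMat U a) = 1 / q * Real.log ((∑ i, a i ^ q) / Fintype.card ι) := by
  rw [logNorm, ntrace, mpow, trace_hermFC hU]

/-- The spectrum of the Hermitian matrix `X` lies in `[m, M]`. -/
def SpectrumIn (m M : ℝ) (X : Matrix ι ι ℂ) : Prop :=
  (X - m • (1 : Matrix ι ι ℂ)).PosSemidef ∧ (M • (1 : Matrix ι ι ℂ) - X).PosSemidef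

theorem specMat_sub_const {U : Matrix ι ι ℂ} (hU : Uᴴ * U = 1) (a : ι → ℝ) (c : ℝ) :
    specMat U a - c • (1 : Matrix ι ι ℂ) = specMat U (fun i => a i - c) := by
  have h : c • (1 : Matrix ι ι ℂ) = specMat U (fun _ => c) := by
    rw [specMat_const hU]
    rfl
  rw [h, sub_eq_iff_eq_add, specMat_add]
  simp

theorem const_sub_specMat {U : Matrix ι ι ℂ} (hU : Uᴴ * U = 1) (a : ι → ℝ) (c : ℝ) :
    c • (1 : Matrix ι ι ℂ) - specMat U a = specMat U (fun i => c - a i) := by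
  have h : c • (1 : Matrix ι ι ℂ) = specMat U (fun _ => c) := by
    rw [specMat_const hU]
    rfl
  rw [h, sub_eq_iff_eq_add, specMat_add]
  simp

theorem spectrumIn_specMat {U : Matrix ι ι ℂ} (hU : Uᴴ * U = 1) {a : ι → ℝ} {m M : ℝ} :
    SpectrumIn m M (specMat U a) ↔ ∀ i, m ≤ a i ∧ a i ≤ M := by
  rw [SpectrumIn, specMat_sub_const hU, const_sub_specMat hU, specMat_posSemidef_iff hU,
    specMat_posSemidef_iff hU, ← forall_and]
  simp only [sub_nonneg]

theorem SpectrumIn.exists_specMat {m M : ℝ} {X : Matrix ι ι ℂ} (hX : SpectrumIn m M X) :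
    ∃ (U : Matrix ι ι ℂ) (a : ι → ℝ), Uᴴ * U = 1 ∧ X = specMat U a ∧ ∀ i, m ≤ a i ∧ a i ≤ M := by
  have h : X.IsHermitian := by
    have h1 := hX.1.1.add (isHermitian_one.smul (IsSelfAdjoint.all m) : (m • (1 : Matrix ι ι ℂ)).IsHermitian)
    rwa [sub_add_cancel] at h1
  obtain ⟨U, a, hU, rfl⟩ := _root_.exists_specMat h
  exact ⟨U, a, hU, rfl, (spectrumIn_specMat hU).1 hX⟩

theorem exists_specMat_pos {X : Matrix ι ι ℂ} (hX : X.PosDef) :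
    ∃ (U : Matrix ι ι ℂ) (a : ι → ℝ), Uᴴ * U = 1 ∧ X = specMat U a ∧ ∀ i, 0 < a i :=
  ⟨hX.1.eigenvectorUnitary, hX.1.eigenvalues, Unitary.coe_star_mul_self hX.1.eigenvectorUnitary, by
    conv_lhs => rw [hX.1.spectral_theorem, Unitary.conjStarAlgAut_apply]
    rfl, hX.eigenvalues_pos⟩

theorem exists_spectrumIn {X : Matrix ι ι ℂ} (hX : X.PosDef) :
    ∃ m M : ℝ, 0 < m ∧ m ≤ 1 ∧ 1 ≤ M ∧ SpectrumIn m M X := by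
  obtain ⟨U, a, hU, rfl, ha⟩ := exists_specMat_pos hX
  obtain ⟨M, hM⟩ := (Set.finite_range a).bddAbove
  obtain ⟨K, hK⟩ := (Set.finite_range fun i => (a i)⁻¹).bddAbove
  refine ⟨(max K 1)⁻¹, max M 1, by positivity, inv_le_one_of_one_le₀ (le_max_right _ _),
    le_max_right _ _, (spectrumIn_specMat hU).2 fun i =>
      ⟨?_, (hM (Set.mem_range_self i)).trans (le_max_left _ _)⟩⟩
  rw [inv_le_comm₀ (by positivity) (ha i)]
  exact (hK (Set.mem_range_self i)).trans (le_max_left _ _)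

theorem norm_specMat_apply_le {U : Matrix ι ι ℂ} (hU : Uᴴ * U = 1) {a : ι → ℝ} {B : ℝ}
    (ha : ∀ i, |a i| ≤ B) (x y : ι) : ‖specMat U a x y‖ ≤ Fintype.card ι * B := by
  have hB : ∀ i j, ‖U i j‖ ≤ 1 := by
    intro i j
    have h := sum_normSq_col U j
    rw [hU, one_apply_eq] at h
    have h2 : ∑ i, Complex.normSq (U i j) = 1 := by exact_mod_cast h.symm
    have h3 := Finset.single_le_sum (f := fun i => Complex.normSq (U i j))
      (fun i _ => Complex.normSq_nonneg _) (Finset.mem_univ i)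
    rw [h2, Complex.normSq_eq_norm_sq] at h3
    exact (sq_le_one_iff₀ (norm_nonneg _)).1 h3
  rw [specMat, mul_apply]
  refine (norm_sum_le _ _).trans ?_
  rw [← nsmul_eq_mul, ← Finset.card_univ, ← Finset.sum_const]
  refine Finset.sum_le_sum fun i _ => ?_
  rw [mul_diagonal, conjTranspose_apply, norm_mul, norm_mul, norm_star, Complex.norm_real,
    Real.norm_eq_abs]
  have h1 : ‖U x i‖ * |a i| ≤ B :=
    (mul_le_of_le_one_left (abs_nonneg _) (hB x i)).trans (ha i)
  exact (mul_le_of_le_one_right (by positivity) (hB y i)).trans h1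

theorem abs_trace_mul_re_le {κ : Type*} [Fintype κ] {X Y : Matrix κ κ ℂ} {A B : ℝ} (hX : ∀ x y, ‖X x y‖ ≤ A)
    (hY : ∀ x y, ‖Y x y‖ ≤ B) : |(X * Y).trace.re| ≤ Fintype.card κ ^ 2 * (A * B) := by
  refine (Complex.abs_re_le_norm _).trans ?_
  rw [trace]
  refine (norm_sum_le _ _).trans ?_
  have h : ∀ i, ‖(X * Y).diag i‖ ≤ Fintype.card κ * (A * B) := by
    intro i
    rw [diag_apply, mul_apply]
    refine (norm_sum_le _ _).trans ?_
    rw [← nsmul_eq_mul, ← Finset.card_univ, ← Finset.sum_const]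
    refine Finset.sum_le_sum fun j _ => ?_
    rw [norm_mul]
    exact mul_le_mul (hX _ _) (hY _ _) (norm_nonneg _) ((norm_nonneg _).trans (hX i j))
  refine (Finset.sum_le_sum fun i _ => h i).trans_eq ?_
  rw [Finset.sum_const, Finset.card_univ, nsmul_eq_mul]
  ring

theorem rpow_le_tangent {q x y : ℝ} (h0 : 0 ≤ q) (h1 : q ≤ 1) (hx : 0 < x) (hy : 0 ≤ y) :
    y ^ q ≤ x ^ q + q * (x ^ (q - 1) * (y - x)) := by
  have h := rpow_one_add_le_one_add_mul_self (s := y / x - 1)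
    (by linarith [div_nonneg hy hx.le]) h0 h1
  have e : y ^ q = x ^ q * (y / x) ^ q := by
    rw [← Real.mul_rpow hx.le (div_nonneg hy hx.le), mul_div_cancel₀ _ hx.ne']
  rw [add_sub_cancel] at h
  rw [e, Real.rpow_sub_one hx.ne']
  refine (mul_le_mul_of_nonneg_left h (Real.rpow_pos_of_pos hx q).le).trans_eq ?_
  field_simp

theorem sum_rpow_le_tangent {U V : Matrix ι ι ℂ} (hU : Uᴴ * U = 1) (hV : Vᴴ * V = 1) {a b : ι → ℝ}
    {q : ℝ} (h0 : 0 ≤ q) (h1 : q ≤ 1) (ha : ∀ i, 0 < a i) (hb : ∀ i, 0 ≤ b i) :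
    ∑ i, b i ^ q ≤ ∑ i, a i ^ q +
      q * (specMat U (fun i => a i ^ (q - 1)) * (specMat V b - specMat U a)).trace.re := by
  have e1 : ∑ j, b j ^ q = ∑ i, ∑ j, overlap U V i j * b j ^ q := by
    rw [Finset.sum_comm]
    simp only [← Finset.sum_mul, sum_overlap_left hU hV, one_mul]
  have e2 : ∀ φ : ι → ℝ, ∑ i, φ i = ∑ i, ∑ j, overlap U V i j * φ i := by
    intro φ
    simp only [← Finset.sum_mul, sum_overlap_right hU hV, one_mul]
  rw [Matrix.mul_sub, trace_sub, Complex.sub_re, specMat_mul hU, trace_specMat hU, trace_specMat_mul,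
    Complex.ofReal_re, Complex.ofReal_re, e1, e2 fun i => a i ^ q, e2 fun i => a i ^ (q - 1) * a i,
    ← Finset.sum_sub_distrib, Finset.mul_sum, ← Finset.sum_add_distrib]
  refine Finset.sum_le_sum fun i _ => ?_
  rw [← Finset.sum_sub_distrib, Finset.mul_sum, ← Finset.sum_add_distrib]
  refine Finset.sum_le_sum fun j _ => ?_
  have h := mul_le_mul_of_nonneg_left (rpow_le_tangent h0 h1 (ha i) (hb j)) (overlap_nonneg U V i j)
  linarith

theorem logNorm_tangent_le {κ : Type*} [Fintype κ] [Nonempty κ] {a : κ → ℝ} (ha : ∀ i, 0 < a i) {s t : ℝ} (hs : 0 < s)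
    (ht : 0 < t) : 1 / s * Real.log ((∑ i, a i ^ s) / Fintype.card κ) -
      (s - t) / (s * t) * (sumEnt (fun i => a i ^ s) / ∑ i, a i ^ s) ≤
      1 / t * Real.log ((∑ i, a i ^ t) / Fintype.card κ) := by
  have hpos : ∀ r : ℝ, 0 < ∑ i, a i ^ r := fun r =>
    Finset.sum_pos (fun i _ => Real.rpow_pos_of_pos (ha i) r) Finset.univ_nonempty
  have hd : (0 : ℝ) < Fintype.card κ := by exact_mod_cast Fintype.card_pos
  set Z := ∑ i, a i ^ s with hZ
  have hZ0 : 0 < Z := hpos s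
  set L := (∑ i, a i ^ s * Real.log (a i)) / Z with hL
  have hE : sumEnt (fun i => a i ^ s) / Z = s * L - Real.log (Z / Fintype.card κ) := by
    unfold sumEnt
    rw [← hZ, sub_div, mul_div_cancel_left₀ _ hZ0.ne', hL, ← mul_div_assoc, Finset.mul_sum]
    congr 2
    refine Finset.sum_congr rfl fun i _ => ?_
    rw [Real.log_rpow (ha i)]
    ring
  have hj : Real.exp (-(s - t) * L) ≤ (∑ i, a i ^ t) / Z := by
    have h := convexOn_exp.map_sum_le (t := Finset.univ) (w := fun i => a i ^ s / Z)
      (p := fun i => -(s - t) * Real.log (a i)) (fun i _ => (div_pos (Real.rpow_pos_of_pos (ha i) s) hZ0).le)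
      (by rw [← Finset.sum_div, div_self hZ0.ne']) (fun i _ => Set.mem_univ _)
    have e1 : ∑ i, (a i ^ s / Z) • (-(s - t) * Real.log (a i)) = -(s - t) * L := by
      rw [hL, Finset.sum_div, Finset.mul_sum]
      refine Finset.sum_congr rfl fun i _ => ?_
      rw [smul_eq_mul]
      ring
    have e2 : ∑ i, (a i ^ s / Z) • Real.exp (-(s - t) * Real.log (a i)) = (∑ i, a i ^ t) / Z := by
      rw [Finset.sum_div]
      refine Finset.sum_congr rfl fun i _ => ?_
      rw [smul_eq_mul, div_mul_eq_mul_div, mul_comm (-(s - t)), ← Real.rpow_def_of_pos (ha i),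
        ← Real.rpow_add (ha i)]
      ring_nf
    rwa [e1, e2] at h
  have hlog := (Real.le_log_iff_exp_le (div_pos (hpos t) hZ0)).2 hj
  rw [Real.log_div (hpos t).ne' hZ0.ne'] at hlog
  rw [hE, Real.log_div hZ0.ne' hd.ne', Real.log_div (hpos t).ne' hd.ne']
  have e : 1 / s * (Real.log Z - Real.log (Fintype.card κ)) -
      (s - t) / (s * t) * (s * L - (Real.log Z - Real.log (Fintype.card κ))) =
      1 / t * (Real.log Z + -(s - t) * L - Real.log (Fintype.card κ)) := by
    field_simp
    ring
  rw [e]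
  refine mul_le_mul_of_nonneg_left ?_ (by positivity)
  linarith

end LogNorm

theorem mul_entropy_div_le {s t q₀ κ E F : ℝ} (hq₀ : 0 < q₀) (ht : q₀ ≤ t) (hts : t ≤ s) (hs : s < 1)
    (hκ : 0 ≤ κ) (hκ1 : κ ≤ 1) (hst : 1 - t ≤ (1 - s) * (1 + κ) ^ 2) (hF : 0 ≤ F)
    (hE : 2 * (1 - s) * E ≤ s ^ 2 * F) :
    (s - t) / (s * t) * E ≤ κ * F + (1 / 2 + 9 / (2 * q₀)) * κ ^ 2 * F := by
  have ht0 : 0 < t := hq₀.trans_le ht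
  have hs0 : 0 < s := ht0.trans_le hts
  have h1 : (s - t) * E ≤ (κ + κ ^ 2 / 2) * s ^ 2 * F := by
    have h2 : (s - t) * (2 * (1 - s) * E) ≤ (s - t) * (s ^ 2 * F) :=
      mul_le_mul_of_nonneg_left hE (by linarith)
    have h3 : (s - t) * (s ^ 2 * F) ≤ ((1 - s) * (2 * κ + κ ^ 2)) * (s ^ 2 * F) :=
      mul_le_mul_of_nonneg_right (by nlinarith) (by positivity)
    have h4 : (1 - s) * ((s - t) * E) ≤ (1 - s) * ((κ + κ ^ 2 / 2) * s ^ 2 * F) := by nlinarith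
    exact le_of_mul_le_mul_left h4 (by linarith)
  have h5 : s ≤ (1 + 3 * κ / q₀) * t := by
    have h6 : s - t ≤ 3 * κ := by nlinarith
    have h7 : 3 * κ ≤ 3 * κ / q₀ * t := by
      rw [div_mul_eq_mul_div, le_div_iff₀ hq₀]
      exact mul_le_mul_of_nonneg_left ht (by linarith)
    linarith
  rw [div_mul_eq_mul_div, div_le_iff₀ (by positivity)]
  have h8 : (κ + κ ^ 2 / 2) * s ^ 2 * F ≤
      (κ + κ ^ 2 / 2) * (s * ((1 + 3 * κ / q₀) * t)) * F := by
    rw [sq s]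
    gcongr
  refine h1.trans (h8.trans ?_)
  have h9 : (κ + κ ^ 2 / 2) * (1 + 3 * κ / q₀) ≤ κ + (1 / 2 + 9 / (2 * q₀)) * κ ^ 2 := by
    have h10 : κ ^ 2 * (1 - κ) * (3 / (2 * q₀)) ≥ 0 :=
      mul_nonneg (mul_nonneg (sq_nonneg _) (by linarith)) (by positivity)
    have e : κ + (1 / 2 + 9 / (2 * q₀)) * κ ^ 2 - (κ + κ ^ 2 / 2) * (1 + 3 * κ / q₀) =
        κ ^ 2 * (1 - κ) * (3 / (2 * q₀)) := by
      field_simp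
      ring
    linarith
  have h11 := mul_le_mul_of_nonneg_right h9 (by positivity : 0 ≤ F * (s * t))
  linarith

section Evolution

variable {n : ℕ}

theorem exists_logNorm_step_le (n : ℕ) {q₀ m M : ℝ} (hq₀ : 0 < q₀) (hm : 0 < m) (hm1 : m ≤ 1)
    (hM : 1 ≤ M) : ∃ C : ℝ, ∀ κ s t : ℝ, 0 ≤ κ → κ ≤ 1 → q₀ ≤ t → t ≤ s → s < 1 →
      1 - t ≤ (1 - s) * (1 + κ) ^ 2 → ∀ X : Matrix (Fin n → Fin 2) (Fin n → Fin 2) ℂ,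
      SpectrumIn m M X → SpectrumIn m M (depolChannel (1 + κ) X) →
      logNorm s (depolChannel (1 + κ) X) - C * κ ^ 2 ≤ logNorm t X := by
  obtain ⟨C₀, hC₀, hR⟩ := exists_norm_depolChannel_sub_le n
  set d : ℝ := ((Fintype.card (Fin n → Fin 2) : ℕ) : ℝ) with hd
  have hd0 : 0 < d := by rw [hd]; exact_mod_cast Fintype.card_pos
  set K₁ : ℝ := d ^ 2 * (d * m⁻¹ * (C₀ * (d * M))) with hK₁
  set K₂ : ℝ := d ^ 2 * (d * m⁻¹ * (2 * n * (d * M))) with hK₂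
  have hK₁0 : 0 ≤ K₁ := by positivity
  have hK₂0 : 0 ≤ K₂ := by positivity
  refine ⟨(K₁ + (1 / 2 + 9 / (2 * q₀)) * K₂) / m, ?_⟩
  intro κ s t hκ hκ1 ht hts hs hst X hX hY
  have ht0 : 0 < t := hq₀.trans_le ht
  have hs0 : 0 < s := ht0.trans_le hts
  obtain ⟨U, a, hU, rfl, ha⟩ := hX.exists_specMat
  obtain ⟨V, b, hV, hb', hb⟩ := hY.exists_specMat
  have ha0 : ∀ i, 0 < a i := fun i => hm.trans_le (ha i).1
  have hent : ∀ x y, ‖specMat U a x y‖ ≤ d * M :=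
    norm_specMat_apply_le hU fun i => by rw [abs_of_pos (ha0 i)]; exact (ha i).2
  have hpw : ∀ x y, ‖specMat U (fun i => a i ^ (s - 1)) x y‖ ≤ d * m⁻¹ := by
    refine norm_specMat_apply_le hU fun i => ?_
    rw [abs_of_pos (Real.rpow_pos_of_pos (ha0 i) _), ← Real.rpow_neg_one]
    exact (Real.rpow_le_rpow_of_nonpos hm (ha i).1 (by linarith)).trans
      (Real.rpow_le_rpow_of_exponent_ge hm hm1 (by linarith))
  set Z := ∑ i, a i ^ s with hZ
  have hmZ : m ≤ Z := by
    obtain ⟨i⟩ : Nonempty (Fin n → Fin 2) := inferInstance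
    have h1 : m ≤ a i ^ s := by
      refine le_trans ?_ (Real.rpow_le_rpow hm.le (ha i).1 hs0.le)
      conv_lhs => rw [← Real.rpow_one m]
      exact Real.rpow_le_rpow_of_exponent_ge hm hm1 hs.le
    exact h1.trans (Finset.single_le_sum (f := fun i => a i ^ s)
      (fun i _ => (Real.rpow_pos_of_pos (ha0 i) s).le) (Finset.mem_univ i))
  have hZ0 : 0 < Z := hm.trans_le hmZ
  set F := revForm s U a with hF
  have hF0 : 0 ≤ F := revForm_nonneg hs0 hs hU ha0
  have hF2 : F ≤ K₂ := by
    rw [hF, revForm]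
    exact (neg_le_abs _).trans (abs_trace_mul_re_le hpw (norm_depolGen_apply_le hent))
  set R := depolChannel (1 + κ) (specMat U a) - specMat U a - κ • depolGen (specMat U a) with hRdef
  set ρ := (specMat U (fun i => a i ^ (s - 1)) * R).trace.re with hρ
  have hρ1 : ρ ≤ K₁ * κ ^ 2 := by
    refine (le_abs_self _).trans ((abs_trace_mul_re_le hpw (hR κ hκ hκ1 _ _ hent)).trans_eq ?_)
    rw [hK₁]
    ring
  have hklein := sum_rpow_le_tangent hU hV hs0.le hs.le ha0
    (fun i => hm.le.trans (hb i).1)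
  have hT : (specMat U (fun i => a i ^ (s - 1)) * (specMat V b - specMat U a)).trace.re =
      -κ * F + ρ := by
    have e : specMat V b - specMat U a = κ • depolGen (specMat U a) + R := by
      rw [hRdef, ← hb']
      abel
    rw [e, Matrix.mul_add, trace_add, Complex.add_re, Matrix.mul_smul, trace_smul, Complex.smul_re,
      hF, revForm, hρ, smul_eq_mul]
    ring
  rw [hT, ← hZ] at hklein
  have hZ' : 0 < ∑ i, b i ^ s :=
    Finset.sum_pos (fun i _ => Real.rpow_pos_of_pos (hm.trans_le (hb i).1) s) Finset.univ_nonempty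
  have hup : logNorm s (specMat V b) ≤ 1 / s * Real.log (Z / d) + (-κ * F + ρ) / Z := by
    rw [logNorm_specMat hV, ← hd]
    have e1 : (∑ i, b i ^ s) / d = (Z / d) * ((∑ i, b i ^ s) / Z) := by field_simp
    rw [e1, Real.log_mul (by positivity) (by positivity), mul_add, add_le_add_iff_left]
    have h1 := Real.log_le_sub_one_of_pos (div_pos hZ' hZ0)
    have h2 : (∑ i, b i ^ s) / Z ≤ 1 + s * ((-κ * F + ρ) / Z) := by
      rw [div_le_iff₀ hZ0, add_mul, one_mul, mul_assoc, div_mul_cancel₀ _ hZ0.ne']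
      exact hklein
    rw [one_div, inv_mul_le_iff₀ hs0]
    linarith
  have hdown := logNorm_tangent_le ha0 hs0 ht0
  rw [← hZ, ← hd] at hdown
  rw [hb', logNorm_specMat hU, ← hd]
  refine le_trans ?_ hdown
  have hE := mul_entropy_div_le hq₀ ht hts hs hκ hκ1 hst hF0 (sumEnt_rpow_le_revForm hs0 hs hU ha0)
  have hfin : (-κ * F + ρ) / Z - (K₁ + (1 / 2 + 9 / (2 * q₀)) * K₂) / m * κ ^ 2 ≤
      -((s - t) / (s * t) * (sumEnt (fun i => a i ^ s) / Z)) := by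
    have h1 : (-κ * F + ρ) + (s - t) / (s * t) * sumEnt (fun i => a i ^ s) ≤
        (K₁ + (1 / 2 + 9 / (2 * q₀)) * K₂) * κ ^ 2 := by
      have : (1 / 2 + 9 / (2 * q₀)) * κ ^ 2 * F ≤ (1 / 2 + 9 / (2 * q₀)) * κ ^ 2 * K₂ := by gcongr
      linarith
    have h2 := div_le_div_of_nonneg_right h1 hZ0.le
    have h3 : (K₁ + (1 / 2 + 9 / (2 * q₀)) * K₂) * κ ^ 2 / Z ≤
        (K₁ + (1 / 2 + 9 / (2 * q₀)) * K₂) * κ ^ 2 / m :=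
      div_le_div_of_nonneg_left (by positivity) hm hmZ
    rw [add_div, mul_div_assoc] at h2
    rw [div_mul_eq_mul_div]
    linarith
  linarith

theorem SpectrumIn.depolChannel {m M γ : ℝ} (h0 : 0 ≤ γ) (h1 : γ ≤ 1)
    {X : Matrix (Fin n → Fin 2) (Fin n → Fin 2) ℂ} (hX : SpectrumIn m M X) :
    SpectrumIn m M (depolChannel γ X) := by
  have hsub : ∀ A B : Matrix (Fin n → Fin 2) (Fin n → Fin 2) ℂ,
      _root_.depolChannel γ (A - B) = _root_.depolChannel γ A - _root_.depolChannel γ B := by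
    intro A B
    rw [eq_sub_iff_add_eq, ← depolChannel_add, sub_add_cancel]
  constructor
  · have := depolChannel_posSemidef h0 h1 hX.1
    rwa [hsub, depolChannel_smul, depolChannel_one] at this
  · have := depolChannel_posSemidef h0 h1 hX.2
    rwa [hsub, depolChannel_smul, depolChannel_one] at this

theorem logNorm_le_depolChannel_of_pos {p q γ : ℝ} (hq : 0 < q) (hqp : q ≤ p) (hp : p < 1)
    (h0 : 0 < γ) (h1 : γ ≤ 1) (hγ : γ ^ 2 * (1 - q) ≤ 1 - p)
    {X : Matrix (Fin n → Fin 2) (Fin n → Fin 2) ℂ} (hX : X.PosDef) :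
    logNorm p X ≤ logNorm q (depolChannel γ X) := by
  obtain ⟨m, M, hm, hm1, hM, hmM⟩ := exists_spectrumIn hX
  obtain ⟨C, hC⟩ := exists_logNorm_step_le n hq hm hm1 hM
  set c := γ⁻¹ - 1 with hc
  have hc0 : 0 ≤ c := sub_nonneg.2 ((one_le_inv₀ h0).2 h1)
  have key : ∀ N : ℕ, 0 < N → c ≤ N →
      logNorm p X ≤ logNorm q (depolChannel γ X) + |C| * c ^ 2 * (1 / (N : ℝ)) := by
    intro N hN hcN
    have hN0 : (0 : ℝ) < N := by exact_mod_cast hN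
    set κ := γ⁻¹ ^ (1 / (N : ℝ)) - 1 with hκdef
    have hκ : 0 ≤ κ := sub_nonneg.2 (Real.one_le_rpow ((one_le_inv₀ h0).2 h1) (by positivity))
    have hpow : (1 + κ) ^ N = γ⁻¹ := by
      rw [hκdef, add_sub_cancel, ← Real.rpow_natCast, ← Real.rpow_mul (by positivity),
        one_div_mul_cancel hN0.ne', Real.rpow_one]
    have hκc : κ ≤ c / N := by
      rw [le_div_iff₀ hN0]
      have := one_add_mul_le_pow (a := κ) (by linarith) N
      rw [hpow] at this
      linarith
    have hκ1 : κ ≤ 1 := hκc.trans ((div_le_one hN0).2 hcN)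
    set r := ((1 - q) / (1 - p)) ^ (1 / (N : ℝ)) with hr
    have h1p : 0 < 1 - p := by linarith
    have h1q : 0 < 1 - q := by linarith
    have hratio : 1 ≤ (1 - q) / (1 - p) := (one_le_div h1p).2 (by linarith)
    have hr1 : 1 ≤ r := Real.one_le_rpow hratio (by positivity)
    have hrN : r ^ N = (1 - q) / (1 - p) := by
      rw [hr, ← Real.rpow_natCast, ← Real.rpow_mul (by positivity),
        one_div_mul_cancel hN0.ne', Real.rpow_one]
    have hr2 : r ≤ (1 + κ) ^ 2 := by
      refine le_of_pow_le_pow_left₀ hN.ne' (by positivity) ?_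
      rw [hrN, ← pow_mul, mul_comm, pow_mul, hpow, div_le_iff₀ h1p, inv_pow, inv_mul_eq_div,
        le_div_iff₀ (by positivity)]
      linarith
    have hchain : ∀ j : ℕ, j ≤ N → logNorm p X - j * (C * κ ^ 2) ≤
        logNorm (1 - (1 - p) * r ^ j) (depolChannel (((1 + κ) ^ j)⁻¹) X) := by
      intro j
      induction j with
      | zero =>
        intro _
        simp [depolChannel_one_apply]
      | succ j ih =>
        intro hj
        have ih := ih (by omega)
        have hle : ∀ i : ℕ, ((1 + κ) ^ i)⁻¹ ≤ 1 := fun i =>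
          inv_le_one_of_one_le₀ (one_le_pow₀ (by linarith))
        have hge : ∀ i : ℕ, 0 ≤ ((1 + κ) ^ i)⁻¹ := fun i => by positivity
        have hcomp : depolChannel (1 + κ) (depolChannel (((1 + κ) ^ (j + 1))⁻¹) X) =
            depolChannel (((1 + κ) ^ j)⁻¹) X := by
          rw [depolChannel_depolChannel]
          congr 1
          field_simp
          ring
        have hmono : r ^ (j + 1) ≤ r ^ N := pow_le_pow_right₀ hr1 hj
        have hstep := hC κ (1 - (1 - p) * r ^ j) (1 - (1 - p) * r ^ (j + 1)) hκ hκ1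
          (by
            have h2 := mul_le_mul_of_nonneg_left hmono h1p.le
            rw [hrN, mul_div_cancel₀ _ h1p.ne'] at h2
            linarith)
          (by
            have h2 := mul_le_mul_of_nonneg_left (pow_le_pow_right₀ hr1 (Nat.le_add_right j 1)) h1p.le
            linarith)
          (by
            have : 0 < (1 - p) * r ^ j := by positivity
            linarith)
          (by
            have h2 := mul_le_mul_of_nonneg_left hr2 (by positivity : 0 ≤ (1 - p) * r ^ j)
            rw [pow_succ]
            linarith)
          (depolChannel (((1 + κ) ^ (j + 1))⁻¹) X) (hmM.depolChannel (hge _) (hle _))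
          (by rw [hcomp]; exact hmM.depolChannel (hge _) (hle _))
        rw [hcomp] at hstep
        push_cast
        linarith
    have hN' := hchain N le_rfl
    rw [hpow, inv_inv, hrN, mul_div_cancel₀ _ h1p.ne', sub_sub_cancel] at hN'
    have hloss : N * (C * κ ^ 2) ≤ |C| * c ^ 2 * (1 / (N : ℝ)) := by
      have h2 : C * κ ^ 2 ≤ |C| * (c / N) ^ 2 :=
        mul_le_mul (le_abs_self C) (pow_le_pow_left₀ hκ hκc 2) (by positivity) (abs_nonneg C)
      refine (mul_le_mul_of_nonneg_left h2 hN0.le).trans_eq ?_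
      field_simp
    linarith
  have hlim : Filter.Tendsto (fun N : ℕ => logNorm q (depolChannel γ X) + |C| * c ^ 2 * (1 / (N : ℝ)))
      Filter.atTop (nhds (logNorm q (depolChannel γ X) + |C| * c ^ 2 * 0)) :=
    (tendsto_one_div_atTop_nhds_zero_nat.const_mul _).const_add _
  rw [mul_zero, add_zero] at hlim
  obtain ⟨N₀, hN₀⟩ := exists_nat_ge c
  refine ge_of_tendsto hlim ?_
  filter_upwards [Filter.eventually_ge_atTop (max N₀ 1)] with N hN
  exact key N (lt_of_lt_of_le one_pos ((le_max_right _ _).trans hN))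
    (hN₀.trans (by exact_mod_cast (le_max_left _ _).trans hN))

end Evolution

section ReverseHolder

variable {ι : Type*} [Fintype ι] [DecidableEq ι]

theorem specMat_posDef {U : Matrix ι ι ℂ} (hU : Uᴴ * U = 1) {a : ι → ℝ} (ha : ∀ i, 0 < a i) :
    (specMat U a).PosDef := by
  refine PosDef.mul_mul_conjTranspose_same ?_ ?_
  · exact posDef_diagonal_iff.2 fun i => by exact_mod_cast ha i
  · intro v w h
    have h2 := congrArg (fun z => z ᵥ* Uᴴ) h
    simp only [vecMul_vecMul, mul_eq_one_comm.1 hU, vecMul_one] at h2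
    exact h2

theorem reverse_young {p x y : ℝ} (hp : p < 0) (hx : 0 < x) (hy : 0 < y) :
    x ^ (p / (p - 1)) / (p / (p - 1)) + y ^ p / p ≤ x * y := by
  have hp1 : p - 1 < 0 := by linarith
  have h0 : 0 < p / (p - 1) := div_pos_of_neg_of_neg hp hp1
  have h1 : p / (p - 1) ≤ 1 := (div_le_one_of_neg hp1).2 (by linarith)
  have h := rpow_le_tangent h0.le h1 (Real.rpow_pos_of_pos hy (p - 1)) hx.le
  have e1 : (y ^ (p - 1)) ^ (p / (p - 1)) = y ^ p := by
    rw [← Real.rpow_mul hy.le, mul_div_cancel₀ _ hp1.ne]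
  have e2 : (y ^ (p - 1)) ^ (p / (p - 1) - 1) = y := by
    rw [← Real.rpow_mul hy.le, mul_sub, mul_div_cancel₀ _ hp1.ne, mul_one, sub_sub_cancel,
      Real.rpow_one]
  have e3 : y * y ^ (p - 1) = y ^ p := by
    rw [Real.rpow_sub_one hy.ne', mul_div_cancel₀ _ hy.ne']
  rw [e1, e2, mul_sub, e3] at h
  rw [div_add' _ _ _ h0.ne', div_le_iff₀ h0]
  have e4 : y ^ p / p * (p / (p - 1)) = y ^ p * (p / (p - 1)) - y ^ p := by
    have := hp1.ne
    have := hp.ne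
    field_simp
    ring
  rw [e4]
  linarith

theorem logNorm_add_logNorm_le [Nonempty ι] {A B : Matrix ι ι ℂ} (hA : A.PosDef) (hB : B.PosDef)
    {p : ℝ} (hp : p < 0) : logNorm (p / (p - 1)) A + logNorm p B ≤ Real.log (ntrace (A * B)) := by
  obtain ⟨W, α, hW, rfl, hα⟩ := exists_specMat_pos hA
  obtain ⟨U, a, hU, rfl, ha⟩ := exists_specMat_pos hB
  have hp1 : p - 1 < 0 := by linarith
  have h0 : 0 < p / (p - 1) := div_pos_of_neg_of_neg hp hp1
  have hd : (0 : ℝ) < Fintype.card ι := by exact_mod_cast Fintype.card_pos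
  have hexp : ∀ (U : Matrix ι ι ℂ) (a : ι → ℝ) (r : ℝ), Uᴴ * U = 1 → (∀ i, 0 < a i) → r ≠ 0 →
      ∑ i, (Real.exp (-logNorm r (specMat U a)) * a i) ^ r = Fintype.card ι := by
    intro U a r hU ha hr
    have hS : 0 < (∑ i, a i ^ r) / (Fintype.card ι : ℝ) :=
      div_pos (Finset.sum_pos (fun i _ => Real.rpow_pos_of_pos (ha i) r) Finset.univ_nonempty) hd
    have e : ∀ i, (Real.exp (-logNorm r (specMat U a)) * a i) ^ r =
        ((∑ i, a i ^ r) / (Fintype.card ι : ℝ))⁻¹ * a i ^ r := by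
      intro i
      rw [Real.mul_rpow (Real.exp_pos _).le (ha i).le, ← Real.exp_mul, logNorm_specMat hU,
        neg_mul, mul_right_comm, one_div_mul_cancel hr, one_mul, Real.exp_neg, Real.exp_log hS]
    rw [Finset.sum_congr rfl fun i _ => e i, ← Finset.mul_sum]
    have := (div_pos_iff_of_pos_right hd).1 hS
    field_simp
  set u := logNorm (p / (p - 1)) (specMat W α) with hu
  set v := logNorm p (specMat U a) with hv
  have hx := hexp W α (p / (p - 1)) hW hα h0.ne'
  have hy := hexp U a p hU ha hp.ne
  rw [← hu] at hx
  rw [← hv] at hy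
  have hsum : ∑ i, ∑ j, overlap W U i j * ((Real.exp (-u) * α i) ^ (p / (p - 1)) / (p / (p - 1)) +
      (Real.exp (-v) * a j) ^ p / p) = Fintype.card ι := by
    simp only [mul_add, Finset.sum_add_distrib]
    rw [Finset.sum_comm (f := fun i j => overlap W U i j * ((Real.exp (-v) * a j) ^ p / p))]
    simp only [← Finset.sum_mul, sum_overlap_left hW hU, sum_overlap_right hW hU, one_mul]
    rw [← Finset.sum_div, ← Finset.sum_div, hx, hy]
    have := hp1.ne
    have := hp.ne
    field_simp
    ring
  have hle : (Fintype.card ι : ℝ) ≤ Real.exp (-u) * Real.exp (-v) * ∑ i, ∑ j, overlap W U i j * (α i * a j) := by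
    rw [← hsum, Finset.mul_sum]
    refine Finset.sum_le_sum fun i _ => ?_
    rw [Finset.mul_sum]
    refine Finset.sum_le_sum fun j _ => ?_
    have h := mul_le_mul_of_nonneg_left (reverse_young hp
      (mul_pos (Real.exp_pos (-u)) (hα i)) (mul_pos (Real.exp_pos (-v)) (ha j)))
      (overlap_nonneg W U i j)
    linarith
  rw [ntrace, trace_specMat_mul, Complex.ofReal_re]
  set T := ∑ i, ∑ j, overlap W U i j * (α i * a j) with hT
  rw [← Real.exp_add] at hle
  have h1 : Real.exp (u + v) ≤ T / Fintype.card ι := by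
    rw [le_div_iff₀ hd]
    have h2 := mul_le_mul_of_nonneg_left hle (Real.exp_pos (u + v)).le
    rw [← mul_assoc, ← Real.exp_add] at h2
    have e : u + v + (-u + -v) = 0 := by ring
    rwa [e, Real.exp_zero, one_mul] at h2
  exact (Real.le_log_iff_exp_le ((Real.exp_pos _).trans_le h1)).2 h1

theorem logNorm_le_log_ntrace [Nonempty ι] {A : Matrix ι ι ℂ} (hA : A.PosDef) {p : ℝ} (hp : p ≠ 0)
    (hp1 : p ≤ 1) : logNorm p A ≤ Real.log (ntrace A) := by
  have hd : (0 : ℝ) < Fintype.card ι := by exact_mod_cast Fintype.card_pos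
  rcases lt_or_gt_of_ne hp with hneg | hpos
  · have h := logNorm_add_logNorm_le (PosDef.one (n := ι) (R := ℂ)) hA hneg
    have h1 : (1 : Matrix ι ι ℂ) = specMat 1 (fun _ => 1) := by
      rw [specMat_const (by simp)]
      simp
    have h2 : logNorm (p / (p - 1)) (1 : Matrix ι ι ℂ) = 0 := by
      rw [h1, logNorm_specMat (by simp)]
      simp [hd.ne']
    rwa [h2, zero_add, Matrix.one_mul] at h
  · obtain ⟨U, a, hU, rfl, ha⟩ := exists_specMat_pos hA
    rw [logNorm_specMat hU, ntrace, trace_specMat hU, Complex.ofReal_re]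
    set t := (∑ i, a i) / (Fintype.card ι : ℝ) with ht
    have ht0 : 0 < t := div_pos (Finset.sum_pos (fun i _ => ha i) Finset.univ_nonempty) hd
    rw [one_div, inv_mul_le_iff₀ hpos, ← Real.log_rpow ht0]
    refine Real.log_le_log (div_pos (Finset.sum_pos (fun i _ => Real.rpow_pos_of_pos (ha i) p)
      Finset.univ_nonempty) hd) ?_
    rw [div_le_iff₀ hd]
    refine (Finset.sum_le_sum fun i _ => rpow_le_tangent hpos.le hp1 ht0 (ha i).le).trans_eq ?_
    rw [Finset.sum_add_distrib, ← Finset.mul_sum, ← Finset.mul_sum, Finset.sum_sub_distrib]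
    simp only [Finset.sum_const, Finset.card_univ, nsmul_eq_mul]
    rw [ht, mul_div_cancel₀ _ hd.ne']
    ring

end ReverseHolder

section Negative

variable {n : ℕ}

theorem SpectrumIn.posDef {ι : Type*} [Fintype ι] [DecidableEq ι] {m M : ℝ} {X : Matrix ι ι ℂ}
    (hX : SpectrumIn m M X) (hm : 0 < m) : X.PosDef := by
  obtain ⟨U, a, hU, rfl, ha⟩ := hX.exists_specMat
  exact specMat_posDef hU fun i => hm.trans_le (ha i).1

theorem depolChannel_posDef {γ : ℝ} (h0 : 0 ≤ γ) (h1 : γ ≤ 1)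
    {X : Matrix (Fin n → Fin 2) (Fin n → Fin 2) ℂ} (hX : X.PosDef) : (depolChannel γ X).PosDef := by
  obtain ⟨m, M, hm, -, -, hmM⟩ := exists_spectrumIn hX
  exact (hmM.depolChannel h0 h1).posDef hm

theorem logNorm_le_depolChannel_of_neg {p q γ : ℝ} (hqp : q ≤ p) (hp : p < 0)
    (h0 : 0 < γ) (h1 : γ ≤ 1) (hγ : γ ^ 2 * (1 - q) ≤ 1 - p)
    {X : Matrix (Fin n → Fin 2) (Fin n → Fin 2) ℂ} (hX : X.PosDef) :
    logNorm p X ≤ logNorm q (depolChannel γ X) := by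
  obtain ⟨V, b, hV, hVb, hb⟩ := exists_specMat_pos (depolChannel_posDef h0.le h1 hX)
  have hq : q < 0 := by linarith
  have hq1 : q - 1 < 0 := by linarith
  have hp1 : p - 1 < 0 := by linarith
  have hg := specMat_posDef hV fun i => Real.rpow_pos_of_pos (hb i) (q - 1)
  have hpos : 0 < p / (p - 1) := div_pos_of_neg_of_neg hp hp1
  have hA := logNorm_le_depolChannel_of_pos (p := q / (q - 1)) (q := p / (p - 1)) (γ := γ) hpos
    (by
      rw [div_le_iff_of_neg hp1, div_mul_eq_mul_div, div_le_iff_of_neg hq1]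
      linarith)
    ((div_lt_one_of_neg hq1).2 (by linarith)) h0 h1
    (by
      have e1 : 1 - p / (p - 1) = 1 / (1 - p) := by
        have : 1 - p ≠ 0 := by linarith
        have := hp1.ne
        field_simp
        ring
      have e2 : 1 - q / (q - 1) = 1 / (1 - q) := by
        have : 1 - q ≠ 0 := by linarith
        have := hq1.ne
        field_simp
        ring
      rw [e1, e2, mul_one_div, div_le_div_iff₀ (by linarith) (by linarith)]
      linarith) hg
  have hH := logNorm_add_logNorm_le (depolChannel_posDef h0.le h1 hg) hX hp
  have htr : ntrace (depolChannel γ (specMat V fun i => b i ^ (q - 1)) * X) =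
      (∑ i, b i ^ q) / Fintype.card (Fin n → Fin 2) := by
    rw [ntrace, ← trace_mul_depolChannel, hVb, specMat_mul hV, trace_specMat hV, Complex.ofReal_re]
    congr 1
    refine Finset.sum_congr rfl fun i _ => ?_
    rw [Real.rpow_sub_one (hb i).ne', div_mul_cancel₀ _ (hb i).ne']
  have hgn : logNorm (q / (q - 1)) (specMat V fun i => b i ^ (q - 1)) =
      (q - 1) / q * Real.log ((∑ i, b i ^ q) / Fintype.card (Fin n → Fin 2)) := by
    rw [logNorm_specMat hV, one_div_div]
    congr 4
    funext i
    rw [← Real.rpow_mul (hb i).le, mul_div_cancel₀ _ hq1.ne]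
  rw [htr] at hH
  rw [hgn] at hA
  rw [hVb, logNorm_specMat hV]
  set L := Real.log ((∑ i, b i ^ q) / Fintype.card (Fin n → Fin 2)) with hL
  have e : (q - 1) / q * L = L - 1 / q * L := by
    have := hq.ne
    field_simp
  linarith

theorem tendsto_logNorm_zero {ι : Type*} [Fintype ι] [DecidableEq ι] [Nonempty ι]
    {X : Matrix ι ι ℂ} (hX : X.PosDef) :
    ∃ K : ℝ, Filter.Tendsto (fun s => logNorm s X) (nhdsWithin 0 {0}ᶜ) (nhds K) := by
  obtain ⟨U, a, hU, rfl, ha⟩ := exists_specMat_pos hX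
  have hd : (Fintype.card ι : ℝ) ≠ 0 := by exact_mod_cast Fintype.card_ne_zero
  have h1 : HasDerivAt (fun s : ℝ => (∑ i, a i ^ s) / (Fintype.card ι : ℝ))
      ((∑ i, a i ^ (0 : ℝ) * Real.log (a i)) / (Fintype.card ι : ℝ)) 0 :=
    (HasDerivAt.fun_sum fun i _ => Real.hasStrictDerivAt_const_rpow (ha i) 0 |>.hasDerivAt).div_const _
  have h2 := h1.log (by simp [hd])
  have h3 := hasDerivAt_iff_tendsto_slope_zero.1 h2
  refine ⟨_, h3.congr fun s => ?_⟩
  rw [logNorm_specMat hU]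
  simp [hd]

theorem logNorm_le_depolChannel_of_neg_of_pos {p q γ : ℝ} (hq : q < 0) (hp : 0 < p) (hp1 : p < 1)
    (h0 : 0 < γ) (hγ : γ ^ 2 * (1 - q) ≤ 1 - p)
    {X : Matrix (Fin n → Fin 2) (Fin n → Fin 2) ℂ} (hX : X.PosDef) :
    logNorm p X ≤ logNorm q (depolChannel γ X) := by
  set γ₁ := √(1 - p) with hγ₁
  have hγ₁0 : 0 < γ₁ := Real.sqrt_pos.2 (by linarith)
  have hγ₁2 : γ₁ ^ 2 = 1 - p := Real.sq_sqrt (by linarith)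
  have hγ₁1 : γ₁ ≤ 1 := Real.sqrt_le_one.2 (by linarith)
  set γ₂ := γ / γ₁ with hγ₂
  have hγ₂0 : 0 < γ₂ := div_pos h0 hγ₁0
  have hγ₂2 : γ₂ ^ 2 * (1 - q) ≤ 1 := by
    rw [hγ₂, div_pow, hγ₁2, div_mul_eq_mul_div]
    exact (div_le_one (by linarith)).2 hγ
  have hγ₂1 : γ₂ ≤ 1 := by
    refine (sq_le_one_iff₀ hγ₂0.le).1 ?_
    nlinarith [sq_nonneg γ₂]
  have hcomp : depolChannel γ₂ (depolChannel γ₁ X) = depolChannel γ X := by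
    rw [depolChannel_depolChannel, hγ₂, div_mul_cancel₀ _ hγ₁0.ne']
  have hh := depolChannel_posDef hγ₁0.le hγ₁1 hX
  obtain ⟨K, hK⟩ := tendsto_logNorm_zero hh
  have hr : Filter.Tendsto (fun s => logNorm s (depolChannel γ₁ X)) (nhdsWithin 0 (Set.Ioi 0))
      (nhds K) := hK.mono_left (nhdsWithin_mono _ fun s hs => ne_of_gt hs)
  have hl : Filter.Tendsto (fun s => logNorm s (depolChannel γ₁ X)) (nhdsWithin 0 (Set.Iio 0))
      (nhds K) := hK.mono_left (nhdsWithin_mono _ fun s hs => ne_of_lt hs)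
  have b1 : logNorm p X ≤ K := by
    refine ge_of_tendsto hr ?_
    filter_upwards [Ioo_mem_nhdsGT hp] with s hs
    refine logNorm_le_depolChannel_of_pos hs.1 hs.2.le hp1 hγ₁0 hγ₁1 ?_ hX
    rw [hγ₁2]
    nlinarith [hs.1]
  have b2 : K ≤ logNorm q (depolChannel γ X) := by
    refine le_of_tendsto hl ?_
    filter_upwards [Ioo_mem_nhdsLT hq] with s hs
    rw [← hcomp]
    refine logNorm_le_depolChannel_of_neg hs.1.le hs.2 hγ₂0 hγ₂1 ?_ hh
    linarith [hs.2]
  exact b1.trans b2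

theorem logNorm_le_depolChannel {p q γ : ℝ} (hqp : q ≤ p) (hp1 : p ≤ 1) (hp0 : p ≠ 0)
    (hq0 : q ≠ 0) (h0 : 0 ≤ γ) (h1 : γ ≤ 1) (hγ : γ ^ 2 * (1 - q) ≤ 1 - p)
    (hγ0 : p = 1 → γ = 0)
    {X : Matrix (Fin n → Fin 2) (Fin n → Fin 2) ℂ} (hX : X.PosDef) :
    logNorm p X ≤ logNorm q (depolChannel γ X) := by
  rcases h0.eq_or_lt with rfl | h0
  · have hd : ((Fintype.card (Fin n → Fin 2) : ℕ) : ℝ) ≠ 0 := by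
      exact_mod_cast Fintype.card_ne_zero
    obtain ⟨U, a, hU, rfl, ha⟩ := exists_specMat_pos hX
    have ht : 0 < ntrace (specMat U a) := by
      rw [ntrace, trace_specMat hU, Complex.ofReal_re]
      exact div_pos (Finset.sum_pos (fun i _ => ha i) Finset.univ_nonempty)
        (by exact_mod_cast Fintype.card_pos)
    have h2 : depolChannel 0 (specMat U a) = specMat 1 (fun _ => ntrace (specMat U a)) := by
      rw [depolChannel_zero_apply, specMat_const (by simp), ntrace, trace_specMat hU,
        Complex.ofReal_re]
      push_cast
      rfl
    have h3 : logNorm q (depolChannel 0 (specMat U a)) = Real.log (ntrace (specMat U a)) := by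
      rw [h2, logNorm_specMat (by simp), Finset.sum_const, Finset.card_univ, nsmul_eq_mul,
        mul_div_cancel_left₀ _ hd, Real.log_rpow ht, ← mul_assoc,
        one_div_mul_cancel hq0, one_mul]
    rw [h3]
    exact logNorm_le_log_ntrace hX hp0 hp1
  · have hp1' : p < 1 := lt_of_le_of_ne hp1 fun h => h0.ne' (hγ0 h)
    rcases lt_or_gt_of_ne hp0 with hp | hp
    · exact logNorm_le_depolChannel_of_neg hqp hp h0 h1 hγ hX
    · rcases lt_or_gt_of_ne hq0 with hq | hq
      · exact logNorm_le_depolChannel_of_neg_of_pos hq hp hp1' h0 hγ hX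
      · exact logNorm_le_depolChannel_of_pos hq hqp hp1' h0 h1 hγ hX

end Negative

section Final

variable {n : ℕ}

theorem foldl_depolAt_sub_posSemidef {γ : ℝ} (h0 : 0 ≤ γ) (h1 : γ ≤ 1) (l : List (Fin n)) {c : ℝ}
    (hc : 0 ≤ c) {X Y : Matrix (Fin n → Fin 2) (Fin n → Fin 2) ℂ} (hY : Y.PosSemidef)
    (hXY : (X - c • Y).PosSemidef) :
    (l.foldl (fun g k => depolAt γ k g) X -
      (c * (1 - γ) ^ l.length) • l.foldl (fun g k => depolAt 0 k g) Y).PosSemidef := by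
  induction l generalizing c X Y with
  | nil => simpa using hXY
  | cons j l ih =>
    have h : (depolAt γ j X - (c * (1 - γ)) • depolAt 0 j Y).PosSemidef := by
      have hX : X.PosSemidef := by
        have := hXY.add (hY.smul hc)
        rwa [sub_add_cancel] at this
      have e : depolAt γ j X - (c * (1 - γ)) • depolAt 0 j Y =
          γ • X + (1 - γ) • depolAt 0 j (X - c • Y) := by
        have e2 : depolAt 0 j (X - c • Y) = depolAt 0 j X - c • depolAt 0 j Y := by
          rw [eq_sub_iff_add_eq, ← depolAt_zero_smul, ← depolAt_zero_add, sub_add_cancel]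
        rw [e2, depolAt_eq γ j X]
        module
      rw [e]
      exact (hX.smul h0).add ((depolAt_zero_posSemidef j hXY).smul (sub_nonneg.2 h1))
    have := ih (mul_nonneg hc (sub_nonneg.2 h1)) (depolAt_zero_posSemidef j hY) h
    rwa [mul_assoc, ← pow_succ'] at this

theorem depolChannel_posDef_of_lt {γ : ℝ} (h0 : 0 ≤ γ) (h1 : γ < 1)
    {X : Matrix (Fin n → Fin 2) (Fin n → Fin 2) ℂ} (hX : X.PosSemidef) (ht : 0 < X.trace.re) :
    (depolChannel γ X).PosDef := by
  have h := foldl_depolAt_sub_posSemidef h0 h1.le (List.finRange n) zero_le_one hX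
    (by rw [one_smul, sub_self]; exact PosSemidef.zero)
  have h2 : (depolChannel γ X - (1 * (1 - γ) ^ (List.finRange n).length) •
      depolChannel 0 X).PosSemidef := h
  have hD : ((1 * (1 - γ) ^ (List.finRange n).length) • depolChannel 0 X).PosDef := by
    have hc : (0 : ℝ) < X.trace.re / (Fintype.card (Fin n → Fin 2) : ℕ) :=
      div_pos ht (by exact_mod_cast Fintype.card_pos)
    have e : X.trace = ((X.trace.re : ℝ) : ℂ) := by
      obtain ⟨U, a, hU, rfl⟩ := exists_specMat hX.1
      rw [trace_specMat hU, Complex.ofReal_re]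
    have e2 : depolChannel 0 X =
        (X.trace.re / (Fintype.card (Fin n → Fin 2) : ℕ) : ℝ) • (1 : Matrix _ _ ℂ) := by
      rw [depolChannel_zero_apply, e]
      ext x y
      simp [Complex.real_smul]
    rw [e2, smul_smul]
    exact PosDef.one.smul (mul_pos (by rw [one_mul]; exact pow_pos (by linarith) _) hc)
  have := hD.posSemidef_add h2
  rwa [sub_add_cancel] at this

theorem snorm_eq_exp_logNorm {ι : Type*} [Fintype ι] [DecidableEq ι] [Nonempty ι]
    {X : Matrix ι ι ℂ} (hX : X.PosDef) (p : ℝ) : snorm p X = Real.exp (logNorm p X) := by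
  obtain ⟨U, a, hU, rfl, ha⟩ := exists_specMat_pos hX
  rw [snorm_specMat hU fun i => (ha i).le, logNorm_specMat hU, mul_comm, Real.rpow_def_of_pos]
  exact div_pos (Finset.sum_pos (fun i _ => Real.rpow_pos_of_pos (ha i) p) Finset.univ_nonempty)
    (by exact_mod_cast Fintype.card_pos)

theorem tendsto_snorm_add_const {ι : Type*} [Fintype ι] [DecidableEq ι] [Nonempty ι]
    {X : Matrix ι ι ℂ} (hX : X.PosSemidef) {q : ℝ} (h : 0 < q ∨ X.PosDef) :
    Filter.Tendsto (fun ε : ℝ => snorm q (X + ε • (1 : Matrix ι ι ℂ)))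
      (nhdsWithin 0 (Set.Ioi 0)) (nhds (snorm q X)) := by
  have hd : (0 : ℝ) < Fintype.card ι := by exact_mod_cast Fintype.card_pos
  obtain ⟨U, a, hU, rfl, ha⟩ := exists_specMat_nonneg hX
  have hcond : 0 < q ∨ ∀ i, 0 < a i := by
    refine h.imp_right fun hP => ?_
    obtain ⟨m, M, hm, -, -, hmM⟩ := exists_spectrumIn hP
    exact fun i => hm.trans_le ((spectrumIn_specMat hU).1 hmM i).1
  have e : ∀ ε : ℝ, specMat U a + ε • (1 : Matrix ι ι ℂ) = specMat U (fun i => a i + ε) := by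
    intro ε
    have := specMat_const hU ε
    rw [← specMat_add, this]
    rfl
  have hS : Filter.Tendsto (fun ε : ℝ => (∑ i, (a i + ε) ^ q) / (Fintype.card ι : ℝ))
      (nhdsWithin 0 (Set.Ioi 0)) (nhds ((∑ i, a i ^ q) / (Fintype.card ι : ℝ))) := by
    refine Filter.Tendsto.div_const (tendsto_finsetSum _ fun i _ => ?_) _
    have h1 : Filter.Tendsto (fun ε : ℝ => a i + ε) (nhdsWithin 0 (Set.Ioi 0)) (nhds (a i)) := by
      have : Filter.Tendsto (fun ε : ℝ => a i + ε) (nhds 0) (nhds (a i + 0)) :=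
        (continuous_const.add continuous_id).tendsto 0
      rw [add_zero] at this
      exact this.mono_left nhdsWithin_le_nhds
    refine h1.rpow_const ?_
    rcases hcond with hq | hpos
    · exact Or.inr hq.le
    · exact Or.inl (hpos i).ne'
  rw [snorm_specMat hU ha]
  refine Filter.Tendsto.congr' ?_ (hS.rpow_const (p := 1 / q) ?_)
  · filter_upwards [self_mem_nhdsWithin] with ε hε
    rw [e, snorm_specMat hU fun i => add_nonneg (ha i) (le_of_lt hε)]
  · rcases hcond with hq | hpos
    · exact Or.inr (by positivity)
    · exact Or.inl (div_pos (Finset.sum_pos (fun i _ => Real.rpow_pos_of_pos (hpos i) q)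
        Finset.univ_nonempty) hd).ne'

theorem snorm_le_depolChannel_of_posDef {p q γ : ℝ} (hqp : q ≤ p) (hp1 : p ≤ 1) (hp0 : p ≠ 0)
    (hq0 : q ≠ 0) (h0 : 0 ≤ γ) (h1 : γ ≤ 1) (hγ : γ ^ 2 * (1 - q) ≤ 1 - p)
    (hγ0 : p = 1 → γ = 0)
    {X : Matrix (Fin n → Fin 2) (Fin n → Fin 2) ℂ} (hX : X.PosDef) :
    snorm p X ≤ snorm q (depolChannel γ X) := by
  rw [snorm_eq_exp_logNorm hX, snorm_eq_exp_logNorm (depolChannel_posDef h0 h1 hX)]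
  exact Real.exp_le_exp.2 (logNorm_le_depolChannel hqp hp1 hp0 hq0 h0 h1 hγ hγ0 hX)

theorem snorm_nonneg {ι : Type*} [Fintype ι] [DecidableEq ι] {X : Matrix ι ι ℂ}
    (hX : X.PosSemidef) (p : ℝ) : 0 ≤ snorm p X := by
  obtain ⟨U, a, hU, rfl, ha⟩ := exists_specMat_nonneg hX
  rw [snorm_specMat hU ha]
  exact Real.rpow_nonneg (div_nonneg (Finset.sum_nonneg fun i _ => Real.rpow_nonneg (ha i) _)
    (Nat.cast_nonneg _)) _

end Final

/-- Quantum reverse hypercontractivity for the depolarizing channel. -/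
theorem quantum_reverse_hypercontractivity_depolarizing
    (n : ℕ) (hn : 1 ≤ n)
    (f : Matrix (Fin n → Fin 2) (Fin n → Fin 2) ℂ) (hf : f.PosSemidef)
    (p q : ℝ) (hqp : q ≤ p) (hp1 : p ≤ 1) (hp0 : p ≠ 0) (hq0 : q ≠ 0)
    (hfd : p < 0 → f.PosDef)
    (γ : ℝ) (hγ0 : 0 ≤ γ) (hγ1 : γ ≤ Real.sqrt ((1 - p) / (1 - q))) :
    snorm p f ≤ snorm q (depolChannel γ f) := by
  have hratio : (1 - p) / (1 - q) ≤ 1 := by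
    rcases hp1.eq_or_lt with rfl | hlt
    · simp
    · exact (div_le_one (by linarith)).2 (by linarith)
  have h1 : γ ≤ 1 := hγ1.trans (Real.sqrt_le_one.2 hratio)
  have hsq : γ ^ 2 ≤ (1 - p) / (1 - q) :=
    (Real.le_sqrt hγ0 (div_nonneg (by linarith) (by linarith))).1 hγ1
  have hγ : γ ^ 2 * (1 - q) ≤ 1 - p := by
    rcases (hqp.trans hp1).eq_or_lt with rfl | hlt
    · linarith
    · exact (le_div_iff₀ (by linarith)).1 hsq
  have hz : p = 1 → γ = 0 := by
    rintro rfl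
    simpa using le_antisymm hγ1 (by simpa using hγ0)
  rcases lt_or_gt_of_ne hp0 with hp | hp
  · exact snorm_le_depolChannel_of_posDef hqp hp1 hp0 hq0 hγ0 h1 hγ hz (hfd hp)
  have hTf := depolChannel_posSemidef hγ0 h1 hf
  obtain ⟨U, a, hU, hUa, ha⟩ := exists_specMat_nonneg hf
  by_cases htr : 0 < f.trace.re
  · have hlim := tendsto_snorm_add_const hTf (q := q) (by
      rcases lt_or_gt_of_ne hq0 with hq | hq
      · refine Or.inr (depolChannel_posDef_of_lt hγ0 (lt_of_le_of_ne h1 ?_) hf htr)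
        rintro rfl
        linarith
      · exact Or.inl hq)
    refine ge_of_tendsto hlim ?_
    filter_upwards [self_mem_nhdsWithin] with ε hε
    have hε' : (0 : ℝ) < ε := hε
    have e : f + ε • (1 : Matrix (Fin n → Fin 2) (Fin n → Fin 2) ℂ) =
        specMat U (fun i => a i + ε) := by
      rw [hUa, ← specMat_add, specMat_const hU ε]
      rfl
    have hpd : (f + ε • (1 : Matrix (Fin n → Fin 2) (Fin n → Fin 2) ℂ)).PosDef := by
      rw [e]
      exact specMat_posDef hU fun i => add_pos_of_nonneg_of_pos (ha i) hε'
    have h := snorm_le_depolChannel_of_posDef hqp hp1 hp0 hq0 hγ0 h1 hγ hz hpd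
    rw [depolChannel_add, depolChannel_smul, depolChannel_one] at h
    refine le_trans ?_ h
    rw [e, hUa, snorm_specMat hU ha, snorm_specMat hU fun i => add_nonneg (ha i) hε'.le]
    refine Real.rpow_le_rpow (div_nonneg (Finset.sum_nonneg fun i _ => Real.rpow_nonneg (ha i) _)
      (Nat.cast_nonneg _)) ?_ (by positivity)
    refine div_le_div_of_nonneg_right (Finset.sum_le_sum fun i _ => ?_) (Nat.cast_nonneg _)
    exact Real.rpow_le_rpow (ha i) (by linarith) hp.le
  · have hzero : ∀ i, a i = 0 := by
      rw [hUa, trace_specMat hU, Complex.ofReal_re] at htr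
      have := le_antisymm (not_lt.1 htr) (Finset.sum_nonneg fun i _ => ha i)
      exact fun i => (Finset.sum_eq_zero_iff_of_nonneg fun i _ => ha i).1 this i (Finset.mem_univ i)
    have h0 : snorm p f = 0 := by
      rw [hUa, snorm_specMat hU ha]
      simp [hzero, Real.zero_rpow hp0, hp0]
    rw [h0]
    exact snorm_nonneg hTf q
end

section
/- Hypercontractivity for the boolean cube (Bonami–Gross–Beckner): Let f : {0,1}^n → ℝ and fix real numbers p, q with 1 ≤ p ≤ q. Then for all γ with 0 ≤ γ ≤ √((p−1)/(q−1)) (interpreting the bound as γ = 0 allowed whenever p = 1), one has ‖T_γ(f)‖_q ≤ ‖f‖_p. -/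
open Matrix
open scoped ComplexOrder

theorem entropy_one_add_sub_le {v : ℝ} (hv0 : 0 ≤ v) (hv1 : v < 1) :
    ((1 + v) * Real.log (1 + v) + (1 - v) * Real.log (1 - v)) / 2 ≤ 1 - √(1 - v ^ 2) := by
  let φ : ℝ → ℝ := fun v =>
    1 - √(1 - v ^ 2) - ((1 + v) * Real.log (1 + v) + (1 - v) * Real.log (1 - v)) / 2
  have hφ : ∀ w ∈ Set.Icc 0 v,
      HasDerivAt φ (w / √(1 - w ^ 2) - (Real.log (1 + w) - Real.log (1 - w)) / 2) w := by
    intro w hw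
    have h1 : 0 < 1 + w := by linarith [hw.1]
    have h2 : 0 < 1 - w := by linarith [hw.2]
    have h3 : 0 < 1 - w ^ 2 := by nlinarith
    have hs := ((hasDerivAt_pow 2 w).const_sub 1).sqrt h3.ne'
    have ha := (hasDerivAt_id' w).const_add 1
    have hb := (hasDerivAt_id' w).const_sub 1
    have h := (hs.const_sub 1).sub
      (((ha.mul (ha.log h1.ne')).add (hb.mul (hb.log h2.ne'))).div_const 2)
    refine h.congr_deriv ?_
    have := Real.sqrt_pos.2 h3
    field_simp
    ring
  have hmono : MonotoneOn φ (Set.Icc 0 v) := by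
    refine monotoneOn_of_deriv_nonneg (convex_Icc 0 v)
      (fun w hw => (hφ w hw).continuousAt.continuousWithinAt)
      (fun w hw => (hφ w (interior_subset hw)).differentiableAt.differentiableWithinAt) ?_
    intro w hw
    have hw := interior_subset hw
    rw [(hφ w hw).deriv]
    have h1 : 0 < 1 + w := by linarith [hw.1]
    have h2 : 0 < 1 - w := by linarith [hw.2]
    have hx : 1 ≤ √(1 + w) / √(1 - w) := by
      rw [one_le_div (Real.sqrt_pos.2 h2)]
      exact Real.sqrt_le_sqrt (by linarith [hw.1])
    have h1' := Real.sqrt_pos.2 h1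
    have h2' := Real.sqrt_pos.2 h2
    have hsinh := Real.self_le_sinh_iff.2 (Real.log_nonneg hx)
    rw [Real.sinh_log (by positivity), Real.log_div h1'.ne' h2'.ne', Real.log_sqrt h1.le,
      Real.log_sqrt h2.le] at hsinh
    have e1 : √(1 - w ^ 2) = √(1 + w) * √(1 - w) := by
      rw [← Real.sqrt_mul h1.le]; congr 1; ring
    have e2 : (√(1 + w) / √(1 - w) - (√(1 + w) / √(1 - w))⁻¹) / 2 = w / √(1 - w ^ 2) := by
      rw [e1]
      field_simp
      rw [Real.sq_sqrt h1.le, Real.sq_sqrt h2.le]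
      ring
    linarith
  have := hmono (Set.left_mem_Icc.2 hv0) (Set.right_mem_Icc.2 hv0) hv0
  simp only [φ] at this
  norm_num at this
  linarith

/-- The logarithmic Sobolev inequality on the uniform two-point space. -/
theorem two_point_logSobolev {a b : ℝ} (hb : 0 < b) (hab : b ≤ a) :
    (a ^ 2 * Real.log (a ^ 2) + b ^ 2 * Real.log (b ^ 2)) / 2
      - (a ^ 2 + b ^ 2) / 2 * Real.log ((a ^ 2 + b ^ 2) / 2) ≤ (a - b) ^ 2 / 2 := by
  have ha : 0 < a := hb.trans_le hab
  set M := (a ^ 2 + b ^ 2) / 2 with hM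
  have hMpos : 0 < M := by positivity
  set v := (a ^ 2 - b ^ 2) / (2 * M) with hv
  have hv0 : 0 ≤ v := div_nonneg (by nlinarith) (by positivity)
  have hv1 : v < 1 := by
    rw [hv, div_lt_one (by positivity)]
    have : 0 < b ^ 2 := by positivity
    linarith
  have ea : a ^ 2 = M * (1 + v) := by rw [hv]; field_simp; rw [hM]; ring
  have eb : b ^ 2 = M * (1 - v) := by rw [hv]; field_simp; rw [hM]; ring
  have eab : M * √(1 - v ^ 2) = a * b := by
    rw [← Real.sqrt_sq (mul_pos ha hb).le, mul_pow, ea, eb,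
      show M * (1 + v) * (M * (1 - v)) = M ^ 2 * (1 - v ^ 2) by ring,
      Real.sqrt_mul (by positivity), Real.sqrt_sq hMpos.le]
  have h := mul_le_mul_of_nonneg_left (entropy_one_add_sub_le hv0 hv1) hMpos.le
  rw [mul_sub, eab] at h
  have hexp : (a - b) ^ 2 / 2 = M - a * b := by rw [hM]; ring
  rw [hexp, ea, eb, Real.log_mul hMpos.ne' (by linarith), Real.log_mul hMpos.ne' (by linarith)]
  linarith

/-- The two-point Stroock-Varopoulos inequality. -/
theorem stroock_varopoulos {r a b : ℝ} (hr : 1 < r) (hb : 0 < b) (hab : b ≤ a) :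
    (a ^ (r / 2) - b ^ (r / 2)) ^ 2
      ≤ r ^ 2 / (4 * (r - 1)) * ((a - b) * (a ^ (r - 1) - b ^ (r - 1))) := by
  have hr1 : 0 < r - 1 := by linarith
  have key : ∀ l : ℝ, 0 ≤ (a - b) * (l * l) + (-(4 / r * (a ^ (r / 2) - b ^ (r / 2)))) * l
      + (a ^ (r - 1) - b ^ (r - 1)) / (r - 1) := by
    intro l
    let φ : ℝ → ℝ := fun t => t * (l * l) + (-(4 / r * t ^ (r / 2))) * l + t ^ (r - 1) / (r - 1)
    have hφ : ∀ t ∈ Set.Icc b a, HasDerivAt φ ((t ^ (r / 2 - 1) - l) ^ 2) t := by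
      intro t ht
      have htp : 0 < t := hb.trans_le ht.1
      have h := ((((hasDerivAt_id' t).mul_const (l * l)).add
        ((((Real.hasDerivAt_rpow_const (p := r / 2) (Or.inl htp.ne')).const_mul
          (4 / r)).neg).mul_const l)).add
        ((Real.hasDerivAt_rpow_const (p := r - 1) (Or.inl htp.ne')).div_const (r - 1)))
      refine h.congr_deriv ?_
      have e : t ^ (r - 1 - 1) = (t ^ (r / 2 - 1)) ^ 2 := by
        rw [← Real.rpow_mul_natCast htp.le]; congr 1; push_cast; ring
      rw [e]
      field_simp
      ring
    have hmono : MonotoneOn φ (Set.Icc b a) := by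
      refine monotoneOn_of_deriv_nonneg (convex_Icc b a)
        (fun w hw => (hφ w hw).continuousAt.continuousWithinAt)
        (fun w hw => (hφ w (interior_subset hw)).differentiableAt.differentiableWithinAt) ?_
      intro w hw
      rw [(hφ w (interior_subset hw)).deriv]
      positivity
    have := hmono (Set.left_mem_Icc.2 hab) (Set.right_mem_Icc.2 hab) hab
    simp only [φ] at this
    rw [sub_div]
    linarith
  have h := discrim_le_zero key
  rw [discrim] at h
  have e : (a ^ (r / 2) - b ^ (r / 2)) ^ 2
      = r ^ 2 / 16 * (-(4 / r * (a ^ (r / 2) - b ^ (r / 2)))) ^ 2 := by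
    field_simp
    ring
  rw [e]
  calc _ ≤ r ^ 2 / 16 * (4 * (a - b) * ((a ^ (r - 1) - b ^ (r - 1)) / (r - 1))) := by
        gcongr; linarith
    _ = _ := by field_simp; ring

/-- The `r`-logarithmic Sobolev inequality on the uniform two-point space. -/
theorem two_point_logSobolev_rpow {r a b : ℝ} (hr : 1 < r) (hb : 0 < b) (hab : b ≤ a) :
    r * (a ^ r * Real.log a + b ^ r * Real.log b) / 2
      - (a ^ r + b ^ r) / 2 * Real.log ((a ^ r + b ^ r) / 2)
      ≤ r ^ 2 / (8 * (r - 1)) * ((a - b) * (a ^ (r - 1) - b ^ (r - 1))) := by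
  have ha : 0 < a := hb.trans_le hab
  have hsq : ∀ c : ℝ, 0 < c → (c ^ (r / 2)) ^ 2 = c ^ r := by
    intro c hc
    rw [← Real.rpow_mul_natCast hc.le]; congr 1; push_cast; ring
  have h := two_point_logSobolev (Real.rpow_pos_of_pos hb (r / 2))
    (Real.rpow_le_rpow hb.le hab (by linarith))
  have h' := stroock_varopoulos hr hb hab
  rw [hsq a ha, hsq b hb, Real.log_rpow ha, Real.log_rpow hb] at h
  have hr1 : 0 < r - 1 := by linarith
  have e : r ^ 2 / (8 * (r - 1)) * ((a - b) * (a ^ (r - 1) - b ^ (r - 1)))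
    = r ^ 2 / (4 * (r - 1)) * ((a - b) * (a ^ (r - 1) - b ^ (r - 1))) / 2 := by
    field_simp; ring
  rw [e]
  linarith

theorem antitoneOn_log_two_point {p q s : ℝ} (hp : 1 < p) (hs0 : 0 ≤ s) (hs : s ≤ √(p - 1)) :
    AntitoneOn (fun r => Real.log (((1 + s / √(r - 1)) ^ r + (1 - s / √(r - 1)) ^ r) / 2) / r)
      (Set.Icc p q) := by
  have hM : ∀ r ∈ Set.Icc p q,
      0 < ((1 + s / √(r - 1)) ^ r + (1 - s / √(r - 1)) ^ r) / 2 := by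
    intro r hr
    have h1 : s / √(r - 1) ≤ 1 :=
      div_le_one_of_le₀ (hs.trans (Real.sqrt_le_sqrt (by linarith [hr.1]))) (Real.sqrt_nonneg _)
    have h0 : 0 ≤ s / √(r - 1) := by positivity
    have := Real.rpow_pos_of_pos (show 0 < 1 + s / √(r - 1) by linarith) r
    have := Real.rpow_nonneg (show 0 ≤ 1 - s / √(r - 1) by linarith) r
    linarith
  have hcont : ContinuousOn
      (fun r => Real.log (((1 + s / √(r - 1)) ^ r + (1 - s / √(r - 1)) ^ r) / 2) / r)
      (Set.Icc p q) := by
    have hu : ContinuousOn (fun r : ℝ => s / √(r - 1)) (Set.Icc p q) :=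
      continuousOn_const.div (by fun_prop)
        (fun r hr => (Real.sqrt_pos.2 (by linarith [hr.1])).ne')
    refine ContinuousOn.div (ContinuousOn.log (((ContinuousOn.rpow (continuousOn_const.add hu)
      continuousOn_id fun r hr => Or.inr ?_).add (ContinuousOn.rpow (continuousOn_const.sub hu)
      continuousOn_id fun r hr => Or.inr ?_)).div_const 2) fun r hr => (hM r hr).ne')
      continuousOn_id fun r hr => ?_
    all_goals
      have hr0 : 0 < r := by linarith [hr.1]
      first | exact hr0 | exact hr0.ne'
  have hderiv : ∀ r ∈ Set.Ioo p q, ∃ d ≤ 0, HasDerivAt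
      (fun r => Real.log (((1 + s / √(r - 1)) ^ r + (1 - s / √(r - 1)) ^ r) / 2) / r) d r := by
    intro r hr
    have hr1 : 0 < r - 1 := by linarith [hr.1]
    have hr0 : 0 < r := by linarith
    have hsr := Real.sqrt_pos.2 hr1
    have hu0 : 0 ≤ s / √(r - 1) := by positivity
    have hu1 : s / √(r - 1) < 1 := by
      rw [div_lt_one hsr]
      exact hs.trans_lt (Real.sqrt_lt_sqrt (by linarith) (by linarith [hr.1]))
    have hu : HasDerivAt (fun r : ℝ => s / √(r - 1)) (-(s / √(r - 1)) / (2 * (r - 1))) r := by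
      have h := (hasDerivAt_const r s).div (((hasDerivAt_id' r).sub_const 1).sqrt hr1.ne') hsr.ne'
      refine h.congr_deriv ?_
      rw [Real.sq_sqrt hr1.le]
      field_simp
      ring
    have hMr := hM r ⟨hr.1.le, hr.2.le⟩
    have hA := (hu.const_add 1).rpow (hasDerivAt_id' r) (by linarith)
    have hB := (hu.const_sub 1).rpow (hasDerivAt_id' r) (by linarith)
    have h := (((hA.add hB).div_const 2).log hMr.ne').div (hasDerivAt_id' r) hr0.ne'
    refine ⟨_, ?_, h⟩
    have hls := two_point_logSobolev_rpow (show 1 < r by linarith)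
      (show 0 < 1 - s / √(r - 1) by linarith) (show 1 - s / √(r - 1) ≤ 1 + s / √(r - 1) by linarith)
    refine div_nonpos_of_nonpos_of_nonneg ?_ (by positivity)
    simp only [Pi.add_apply]
    generalize s / √(r - 1) = u at *
    generalize (1 + u) ^ (r - 1) = P at *
    generalize (1 - u) ^ (r - 1) = Q at *
    generalize (1 + u) ^ r = A at *
    generalize (1 - u) ^ r = B at *
    generalize Real.log (1 + u) = la at *
    generalize Real.log (1 - u) = lb at *
    generalize Real.log ((A + B) / 2) = lM at *
    rw [div_mul_eq_mul_div, mul_one, sub_nonpos, div_le_iff₀ hMr]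
    have e : r ^ 2 / (8 * (r - 1)) * ((1 + u - (1 - u)) * (P - Q))
        = r * (u / (2 * (r - 1)) * r * (P - Q)) / 2 := by field_simp; ring
    rw [e] at hls
    linear_combination hls
  refine antitoneOn_of_deriv_nonpos (convex_Icc p q) hcont ?_ ?_
  · intro r hr
    rw [interior_Icc] at hr
    obtain ⟨d, -, h⟩ := hderiv r hr
    exact h.differentiableAt.differentiableWithinAt
  · intro r hr
    rw [interior_Icc] at hr
    obtain ⟨d, hd, h⟩ := hderiv r hr
    rwa [h.deriv]

theorem two_point_hypercontractive_unit {p q b : ℝ} (hp : 1 < p) (hpq : p ≤ q) (hb0 : 0 ≤ b)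
    (hb1 : b ≤ 1) :
    ((1 + √(p - 1) / √(q - 1) * b) ^ q + (1 - √(p - 1) / √(q - 1) * b) ^ q) / 2
      ≤ (((1 + b) ^ p + (1 - b) ^ p) / 2) ^ (q / p) := by
  have hp1 : 0 < √(p - 1) := Real.sqrt_pos.2 (by linarith)
  have hq1 : √(p - 1) ≤ √(q - 1) := Real.sqrt_le_sqrt (by linarith)
  have h := antitoneOn_log_two_point (q := q) hp (s := b * √(p - 1)) (by positivity)
    (by nlinarith) (Set.left_mem_Icc.2 hpq) (Set.right_mem_Icc.2 hpq) hpq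
  simp only at h
  rw [mul_div_cancel_right₀ _ hp1.ne', mul_comm b, mul_div_right_comm] at h
  have hc : √(p - 1) / √(q - 1) * b ≤ 1 :=
    mul_le_one₀ (div_le_one_of_le₀ hq1 (by positivity)) hb0 hb1
  have hc0 : 0 ≤ √(p - 1) / √(q - 1) * b := by positivity
  set c := √(p - 1) / √(q - 1) * b
  have hMq : 0 < ((1 + c) ^ q + (1 - c) ^ q) / 2 := by
    have := Real.rpow_pos_of_pos (show 0 < 1 + c by linarith) q
    have := Real.rpow_nonneg (show 0 ≤ 1 - c by linarith) q
    linarith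
  have hMp : 0 < ((1 + b) ^ p + (1 - b) ^ p) / 2 := by
    have := Real.rpow_pos_of_pos (show 0 < 1 + b by linarith) p
    have := Real.rpow_nonneg (show 0 ≤ 1 - b by linarith) p
    linarith
  rw [← Real.log_le_log_iff hMq (Real.rpow_pos_of_pos hMp _), Real.log_rpow hMp]
  rw [div_le_iff₀ (by linarith)] at h
  calc _ ≤ _ := h
    _ = _ := by ring

theorem two_point_hypercontractive_of_le {p q x y : ℝ} (hp : 1 < p) (hpq : p ≤ q) (hy : 0 ≤ y)
    (hyx : y ≤ x) :
    (((1 + √(p - 1) / √(q - 1)) / 2 * x + (1 - √(p - 1) / √(q - 1)) / 2 * y) ^ q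
      + ((1 - √(p - 1) / √(q - 1)) / 2 * x + (1 + √(p - 1) / √(q - 1)) / 2 * y) ^ q) / 2
      ≤ ((x ^ p + y ^ p) / 2) ^ (q / p) := by
  rcases (hy.trans hyx).eq_or_lt with hx | hx
  · obtain rfl : y = 0 := by linarith
    subst hx
    rw [mul_zero, mul_zero, add_zero, Real.zero_rpow (by linarith), Real.zero_rpow (by linarith)]
    simp only [add_zero, zero_div]
    positivity
  set m := (x + y) / 2 with hm
  have hmpos : 0 < m := by positivity
  set b := (x - y) / (x + y) with hb
  have hb0 : 0 ≤ b := div_nonneg (by linarith) (by linarith)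
  have hb1 : b ≤ 1 := div_le_one_of_le₀ (by linarith) (by linarith)
  have ex : x = m * (1 + b) := by rw [hm, hb]; field_simp; ring
  have ey : y = m * (1 - b) := by rw [hm, hb]; field_simp; ring
  have h := two_point_hypercontractive_unit hp hpq hb0 hb1
  have hq1 : √(p - 1) ≤ √(q - 1) := Real.sqrt_le_sqrt (by linarith)
  have hγ1 : √(p - 1) / √(q - 1) ≤ 1 := div_le_one_of_le₀ hq1 (by positivity)
  have hγ0 : 0 ≤ √(p - 1) / √(q - 1) := by positivity
  generalize √(p - 1) / √(q - 1) = γ at *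
  have hc : γ * b ≤ 1 := mul_le_one₀ hγ1 hb0 hb1
  have hc0 : 0 ≤ γ * b := by positivity
  rw [show (1 + γ) / 2 * x + (1 - γ) / 2 * y = m * (1 + γ * b) by rw [ex, ey]; ring,
    show (1 - γ) / 2 * x + (1 + γ) / 2 * y = m * (1 - γ * b) by rw [ex, ey]; ring, ex, ey,
    Real.mul_rpow hmpos.le (by linarith), Real.mul_rpow hmpos.le (by linarith),
    Real.mul_rpow hmpos.le (by linarith), Real.mul_rpow hmpos.le (by linarith),
    ← mul_add, ← mul_add, mul_div_assoc, mul_div_assoc, Real.mul_rpow (by positivity),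
    ← Real.rpow_mul hmpos.le, mul_div_cancel₀ q (by linarith)]
  · gcongr
  · have := Real.rpow_nonneg (show 0 ≤ 1 - b by linarith) p
    positivity

theorem two_point_rpow_mean_le {p p' q x y : ℝ} (hp' : 0 < p') (hp : p' ≤ p) (hq : 0 ≤ q)
    (hx : 0 ≤ x) (hy : 0 ≤ y) :
    ((x ^ p' + y ^ p') / 2) ^ (q / p') ≤ ((x ^ p + y ^ p) / 2) ^ (q / p) := by
  have hp0 : 0 < p := by linarith
  have hr : 1 ≤ p / p' := (one_le_div hp').2 hp
  have h := (convexOn_rpow hr).2 (Set.mem_Ici.2 (Real.rpow_nonneg hx p'))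
    (Set.mem_Ici.2 (Real.rpow_nonneg hy p')) (show (0 : ℝ) ≤ 1 / 2 by norm_num)
    (show (0 : ℝ) ≤ 1 / 2 by norm_num) (by norm_num)
  simp only [smul_eq_mul] at h
  rw [← Real.rpow_mul hx, ← Real.rpow_mul hy, mul_div_cancel₀ _ hp'.ne'] at h
  rw [show q / p' = p / p' * (q / p) by field_simp, Real.rpow_mul (by positivity)]
  refine Real.rpow_le_rpow (by positivity) ?_ (by positivity)
  calc _ = (1 / 2 * x ^ p' + 1 / 2 * y ^ p') ^ (p / p') := by congr 1; ring
    _ ≤ _ := h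
    _ = _ := by ring

/-- Hypercontractivity on the uniform two-point space. -/
theorem two_point_hypercontractive {p q γ x y : ℝ} (hp : 1 ≤ p) (hpq : p ≤ q) (hγ0 : 0 ≤ γ)
    (hγ1 : γ ≤ √((p - 1) / (q - 1))) (hx : 0 ≤ x) (hy : 0 ≤ y) :
    (((1 + γ) / 2 * x + (1 - γ) / 2 * y) ^ q + ((1 - γ) / 2 * x + (1 + γ) / 2 * y) ^ q) / 2
      ≤ ((x ^ p + y ^ p) / 2) ^ (q / p) := by
  rcases hγ0.eq_or_lt with rfl | hγ
  · have h := two_point_rpow_mean_le one_pos hp (show 0 ≤ q by linarith) hx hy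
    simp only [Real.rpow_one, div_one] at h
    calc _ = ((x + y) / 2) ^ q := by ring_nf
      _ ≤ _ := h
  have hq : 1 < q := by
    by_contra! hq
    obtain rfl : q = 1 := by linarith
    simp at hγ1
    linarith
  have hq1 : 0 < q - 1 := by linarith
  have hsq : γ ^ 2 * (q - 1) ≤ p - 1 := by
    rw [← le_div_iff₀ hq1]
    exact (Real.le_sqrt' hγ).1 hγ1
  obtain ⟨p', hp'⟩ : ∃ p', p' = 1 + γ ^ 2 * (q - 1) := ⟨_, rfl⟩
  have hp'1 : 1 < p' := by
    have : 0 < γ ^ 2 * (q - 1) := by positivity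
    linarith
  have hp'p : p' ≤ p := by linarith
  have hγ' : γ = √(p' - 1) / √(q - 1) := by
    rw [hp', add_sub_cancel_left, Real.sqrt_mul (by positivity), Real.sqrt_sq hγ.le,
      mul_div_cancel_right₀ _ (Real.sqrt_pos.2 hq1).ne']
  refine le_trans ?_ (two_point_rpow_mean_le (by linarith) hp'p (by linarith) hx hy)
  rw [hγ']
  rcases le_total y x with h | h
  · exact two_point_hypercontractive_of_le hp'1 (hp'p.trans hpq) hy h
  · have := two_point_hypercontractive_of_le hp'1 (hp'p.trans hpq) hx h
    rw [add_comm (x ^ p')]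
    refine le_trans (le_of_eq ?_) this
    ring_nf

theorem sum_fin_succ_cube {n : ℕ} (F : (Fin (n + 1) → Fin 2) → ℝ) :
    ∑ x, F x = ∑ z : Fin n → Fin 2, (F (Fin.cons 0 z) + F (Fin.cons 1 z)) := by
  rw [← (Fin.consEquiv fun _ => Fin 2).sum_comp, Fintype.sum_prod_type, Fin.sum_univ_two,
    ← Finset.sum_add_distrib]
  rfl

theorem noiseOp_cons {n : ℕ} (γ : ℝ) (f : (Fin (n + 1) → Fin 2) → ℝ) (b : Fin 2)
    (z : Fin n → Fin 2) :
    noiseOp γ f (Fin.cons b z)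
      = (if (0 : Fin 2) = b then (1 + γ) / 2 else (1 - γ) / 2)
          * noiseOp γ (fun w => f (Fin.cons 0 w)) z
        + (if (1 : Fin 2) = b then (1 + γ) / 2 else (1 - γ) / 2)
          * noiseOp γ (fun w => f (Fin.cons 1 w)) z := by
  simp only [noiseOp]
  rw [sum_fin_succ_cube, Finset.sum_add_distrib, Finset.mul_sum, Finset.mul_sum]
  simp only [Fin.prod_univ_succ, Fin.cons_zero, Fin.cons_succ, mul_assoc]

theorem abs_noiseOp_le {n : ℕ} {γ : ℝ} (hγ0 : 0 ≤ γ) (hγ1 : γ ≤ 1) (f : (Fin n → Fin 2) → ℝ)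
    (x : Fin n → Fin 2) : |noiseOp γ f x| ≤ noiseOp γ (fun y => |f y|) x := by
  refine (Finset.abs_sum_le_sum_abs _ _).trans (Finset.sum_le_sum fun y _ => ?_)
  rw [abs_mul, abs_of_nonneg]
  exact Finset.prod_nonneg fun i _ => by split_ifs <;> linarith

theorem noiseOp_nonneg {n : ℕ} {γ : ℝ} (hγ0 : 0 ≤ γ) (hγ1 : γ ≤ 1) {f : (Fin n → Fin 2) → ℝ}
    (hf : ∀ x, 0 ≤ f x) (x : Fin n → Fin 2) : 0 ≤ noiseOp γ f x :=
  Finset.sum_nonneg fun y _ => mul_nonneg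
    (Finset.prod_nonneg fun i _ => by split_ifs <;> linarith) (hf y)

theorem sum_noiseOp_rpow_le {p q γ : ℝ} (hp : 1 ≤ p) (hpq : p ≤ q) (hγ0 : 0 ≤ γ) (hγ1 : γ ≤ 1)
    (hγ : γ ≤ √((p - 1) / (q - 1))) (n : ℕ) (f : (Fin n → Fin 2) → ℝ) (hf : ∀ x, 0 ≤ f x) :
    (∑ x, noiseOp γ f x ^ q) / 2 ^ n ≤ ((∑ x, f x ^ p) / 2 ^ n) ^ (q / p) := by
  have hp0 : 0 < p := by linarith
  have hq0 : 0 < q := by linarith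
  have hr : 1 ≤ q / p := (one_le_div hp0).2 hpq
  induction n with
  | zero =>
    have h : ∀ x, noiseOp γ f x = f x := fun x => by
      simp [noiseOp, Subsingleton.elim _ x]
    simp only [h]
    rw [Fintype.sum_unique, Fintype.sum_unique, pow_zero, div_one, div_one,
      ← Real.rpow_mul (hf _), mul_div_cancel₀ _ hp0.ne']
  | succ n ih =>
    set g : Fin 2 → (Fin n → Fin 2) → ℝ := fun b => noiseOp γ fun w => f (Fin.cons b w) with hg
    have hg0 : ∀ b z, 0 ≤ g b z := fun b z => noiseOp_nonneg hγ0 hγ1 (fun w => hf _) z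
    set S : Fin 2 → ℝ := fun b => ∑ w : Fin n → Fin 2, f (Fin.cons b w) ^ p with hS
    have hS0 : ∀ b, 0 ≤ S b := fun b => Finset.sum_nonneg fun w _ => Real.rpow_nonneg (hf _) _
    have hstep : ∀ b, (∑ z, (g b z ^ p / 2) ^ (q / p)) ^ (1 / (q / p))
        ≤ (2 ^ n) ^ (1 / (q / p)) * (S b / 2 ^ (n + 1)) := by
      intro b
      have h := ih (fun w => f (Fin.cons b w)) fun w => hf _
      have e : ∑ z, (g b z ^ p / 2) ^ (q / p) = 2 ^ n * ((∑ z, g b z ^ q) / 2 ^ n)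
          / 2 ^ (q / p) := by
        rw [mul_div_cancel₀ _ (by positivity), Finset.sum_div]
        refine Finset.sum_congr rfl fun z _ => ?_
        rw [Real.div_rpow (Real.rpow_nonneg (hg0 b z) p) (by norm_num), ← Real.rpow_mul (hg0 b z),
          mul_div_cancel₀ _ hp0.ne']
      have h0 : 0 ≤ S b / 2 ^ n := div_nonneg (hS0 b) (by positivity)
      calc _ ≤ (2 ^ n * (S b / 2 ^ n) ^ (q / p) / 2 ^ (q / p)) ^ (1 / (q / p)) := by
            rw [e]
            refine Real.rpow_le_rpow ?_ (by gcongr) (by positivity)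
            have := Finset.sum_nonneg fun z (_ : z ∈ Finset.univ) => Real.rpow_nonneg (hg0 b z) q
            positivity
        _ = _ := by
            rw [mul_div_assoc, ← Real.div_rpow h0 (by norm_num),
              Real.mul_rpow (by positivity) (by positivity), ← Real.rpow_mul (by positivity),
              mul_one_div_cancel (by positivity), Real.rpow_one, pow_succ, div_div]
    have hmink := Real.Lp_add_le_of_nonneg (Finset.univ : Finset (Fin n → Fin 2))
      (f := fun z => g 0 z ^ p / 2) (g := fun z => g 1 z ^ p / 2) hr
      (fun z _ => div_nonneg (Real.rpow_nonneg (hg0 0 z) p) (by norm_num))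
      (fun z _ => div_nonneg (Real.rpow_nonneg (hg0 1 z) p) (by norm_num))
    have hmink' := hmink.trans (add_le_add (hstep 0) (hstep 1))
    rw [← mul_add, ← add_div] at hmink'
    have hSS : 0 ≤ (S 0 + S 1) / 2 ^ (n + 1) :=
      div_nonneg (add_nonneg (hS0 0) (hS0 1)) (by positivity)
    have hbase : 0 ≤ ∑ z, (g 0 z ^ p / 2 + g 1 z ^ p / 2) ^ (q / p) :=
      Finset.sum_nonneg fun z _ => by
        have := Real.rpow_nonneg (hg0 0 z) p
        have := Real.rpow_nonneg (hg0 1 z) p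
        positivity
    have hpow := Real.rpow_le_rpow (Real.rpow_nonneg hbase _) hmink' (by linarith : 0 ≤ q / p)
    rw [← Real.rpow_mul hbase, one_div_mul_cancel (by positivity), Real.rpow_one,
      Real.mul_rpow (by positivity) hSS, ← Real.rpow_mul (by positivity),
      one_div_mul_cancel (by positivity), Real.rpow_one] at hpow
    rw [sum_fin_succ_cube, sum_fin_succ_cube (fun x => f x ^ p),
      Finset.sum_add_distrib (f := fun z => f (Fin.cons 0 z) ^ p)]
    rw [pow_succ, ← div_div, div_right_comm, div_le_iff₀ (by positivity), mul_comm _ (2 ^ n),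
      ← pow_succ, Finset.sum_div]
    refine le_trans (Finset.sum_le_sum fun z _ => ?_) hpow
    rw [noiseOp_cons, noiseOp_cons, ← add_div]
    simpa using two_point_hypercontractive hp hpq hγ0 hγ (hg0 0 z) (hg0 1 z)

/-- Hypercontractivity for the boolean cube (Bonami–Gross–Beckner). -/
theorem boolean_hypercontractivity
    (n : ℕ) (f : (Fin n → Fin 2) → ℝ)
    (p q : ℝ) (hp : 1 ≤ p) (hpq : p ≤ q)
    (γ : ℝ) (hγ0 : 0 ≤ γ) (hγ1 : γ ≤ Real.sqrt ((p - 1) / (q - 1))) :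
    lpnorm q (noiseOp γ f) ≤ lpnorm p f := by
  have hp0 : 0 < p := by linarith
  have hq0 : 0 < q := by linarith
  have hγ : γ ≤ 1 :=
    hγ1.trans (Real.sqrt_le_one.2 (div_le_one_of_le₀ (by linarith) (by linarith)))
  have h := sum_noiseOp_rpow_le hp hpq hγ0 hγ hγ1 n (fun y => |f y|) fun y => abs_nonneg _
  have hS : 0 ≤ (∑ x, |f x| ^ p) / 2 ^ n := by positivity
  have hle : (∑ x, |noiseOp γ f x| ^ q) / 2 ^ n ≤ ((∑ x, |f x| ^ p) / 2 ^ n) ^ (q / p) := by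
    refine le_trans ?_ h
    gcongr with x
    exact abs_noiseOp_le hγ0 hγ f x
  calc lpnorm q (noiseOp γ f) ≤ (((∑ x, |f x| ^ p) / 2 ^ n) ^ (q / p)) ^ (1 / q) :=
        Real.rpow_le_rpow (by positivity) hle (by positivity)
    _ = lpnorm p f := by
        rw [← Real.rpow_mul hS, lpnorm]
        congr 1
        field_simp
end
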